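/- arXiv:math/0701667 — 2 statements merged into one kernel-verified Lean document; each statement's English description precedes it below -/
import Mathlib

section
/- Let f be a real polynomial in N variables with exactly n+k+1 monomials (n ≥ 1, k ≥ 0) whose set of exponent vectors, regarded as points of ℝ^N, has affine span of dimension n. Then the (possibly singular) hypersurface X = {x ∈ ℝ^N_> : f(x) = 0} has at most 2 · ((e² + 3)/4) · 2^(k(k+1)/2) · 2^n · n^(k+1) connected components. -/
/-- The set of connected components of a subset `X` of `ℝ^N`, as subsets of `ℝ^N`. -/
def components {N : ℕ} (X : Set (Fin N → ℝ)) : Set (Set (Fin N → ℝ)) :=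
  {C | ∃ x ∈ X, C = connectedComponentIn X x}

namespace Fewnomial

open MvPolynomial in
/-- Substituting the line `t + X • ξ` into a polynomial. -/
noncomputable def lineHom {k : ℕ} (t ξ : Fin k → ℝ) :
    MvPolynomial (Fin k) ℝ →ₐ[ℝ] Polynomial ℝ :=
  MvPolynomial.aeval fun j => Polynomial.C (t j) + Polynomial.C (ξ j) * Polynomial.X

theorem eval_zero_lineHom {k : ℕ} (t ξ : Fin k → ℝ) (p : MvPolynomial (Fin k) ℝ) :
    (lineHom t ξ p).eval 0 = MvPolynomial.eval t p := by
  induction p using MvPolynomial.induction_on with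
  | C a => simp [lineHom]
  | add p q hp hq => simp [hp, hq]
  | mul_X p i hp => simp only [map_mul, Polynomial.eval_mul, hp]; simp [lineHom]

theorem eval_zero_derivative_lineHom {k : ℕ} (t ξ : Fin k → ℝ) (p : MvPolynomial (Fin k) ℝ) :
    (Polynomial.derivative (lineHom t ξ p)).eval 0 =
      ∑ j, MvPolynomial.eval t (MvPolynomial.pderiv j p) * ξ j := by
  induction p using MvPolynomial.induction_on with
  | C a => simp [lineHom]
  | add p q hp hq => simp [hp, hq, add_mul, Finset.sum_add_distrib]
  | mul_X p i hp =>
    have h1 : lineHom t ξ (MvPolynomial.X i) =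
      Polynomial.C (t i) + Polynomial.C (ξ i) * Polynomial.X := by simp [lineHom]
    simp only [map_mul, Polynomial.derivative_mul, Polynomial.eval_add, Polynomial.eval_mul, hp,
      eval_zero_lineHom, MvPolynomial.pderiv_mul, map_add, MvPolynomial.eval_X, add_mul,
      Finset.sum_add_distrib, h1]
    congr 1
    · rw [Finset.sum_mul]
      exact Finset.sum_congr rfl fun j _ => by simp; ring
    · simp [MvPolynomial.pderiv_X, Pi.single_apply, apply_ite (MvPolynomial.eval t)]

theorem lineHom_eq_X_mul {k : ℕ} (t ξ : Fin k → ℝ) (p : MvPolynomial (Fin k) ℝ)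
    (hp : MvPolynomial.eval t p = 0) :
    ∃ g : Polynomial ℝ, lineHom t ξ p = Polynomial.X * g ∧
      g.eval 0 = ∑ j, MvPolynomial.eval t (MvPolynomial.pderiv j p) * ξ j := by
  have h0 : (lineHom t ξ p).coeff 0 = 0 := by
    rw [Polynomial.coeff_zero_eq_eval_zero, eval_zero_lineHom, hp]
  obtain ⟨g, hg⟩ := Polynomial.X_dvd_iff.2 h0
  refine ⟨g, hg, ?_⟩
  rw [← eval_zero_derivative_lineHom, hg]
  simp

/-- Powers of a system that is regular at the points of `T`, multiplied by interpolation
polynomials of these points, are linearly independent. -/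
theorem eq_zero_of_sum_mul_aeval_eq_zero {k : ℕ} (G : Fin k → MvPolynomial (Fin k) ℝ)
    (T : Finset (Fin k → ℝ))
    (hT : ∀ z ∈ T, (∀ i, MvPolynomial.eval z (G i) = 0) ∧
      (Matrix.of fun i j => MvPolynomial.eval z (MvPolynomial.pderiv j (G i))).det ≠ 0)
    (q : (Fin k → ℝ) → MvPolynomial (Fin k) ℝ)
    (hq : ∀ t ∈ T, ∀ t' ∈ T, MvPolynomial.eval t' (q t) = if t = t' then 1 else 0)
    (H : (Fin k → ℝ) → MvPolynomial (Fin k) ℝ)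
    (h0 : ∑ t ∈ T, q t * MvPolynomial.aeval G (H t) = 0) :
    ∀ t ∈ T, H t = 0 := by
  classical
  by_contra! hne
  have hex : ∃ e : ℕ, ∃ t ∈ T, ∃ α, MvPolynomial.coeff α (H t) ≠ 0 ∧ α.degree = e := by
    obtain ⟨t, ht, hHt⟩ := hne
    obtain ⟨α, hα⟩ := MvPolynomial.ne_zero_iff.1 hHt
    exact ⟨_, t, ht, α, hα, rfl⟩
  obtain ⟨t₀, ht₀, α₀, hα₀, hdeg⟩ := Nat.find_spec hex
  have hmin : ∀ t ∈ T, ∀ α, MvPolynomial.coeff α (H t) ≠ 0 → Nat.find hex ≤ α.degree :=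
    fun t ht α hα => Nat.find_min' hex ⟨t, ht, α, hα, rfl⟩
  generalize Nat.find hex = e at hdeg hmin
  set A : Matrix (Fin k) (Fin k) ℝ :=
    Matrix.of fun i j => MvPolynomial.eval t₀ (MvPolynomial.pderiv j (G i)) with hA
  have hAdet : IsUnit A.det := (hT t₀ ht₀).2.isUnit
  have key : ∀ ξ : Fin k → ℝ,
      MvPolynomial.eval (A.mulVec ξ) (MvPolynomial.homogeneousComponent e (H t₀)) = 0 := by
    intro ξ
    choose g hg hg0 using fun i => lineHom_eq_X_mul t₀ ξ (G i) ((hT t₀ ht₀).1 i)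
    have hsub : ∀ t ∈ T, lineHom t₀ ξ (MvPolynomial.aeval G (H t)) =
        Polynomial.X ^ e * ∑ α ∈ (H t).support,
          Polynomial.C (MvPolynomial.coeff α (H t)) * Polynomial.X ^ (α.degree - e) *
            ∏ i, g i ^ α i := by
      intro t ht
      rw [MvPolynomial.aeval_def, MvPolynomial.eval₂_eq', map_sum, Finset.mul_sum]
      refine Finset.sum_congr rfl fun α hα => ?_
      have hle := hmin t ht α (MvPolynomial.mem_support_iff.1 hα)
      simp only [map_mul, map_prod, map_pow, hg, mul_pow, Finset.prod_mul_distrib,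
        Finset.prod_pow_eq_pow_sum]
      have : ∑ i, α i = e + (α.degree - e) := by
        rw [Finsupp.degree_eq_sum] at *
        omega
      rw [this, pow_add]
      have hC : lineHom t₀ ξ (algebraMap ℝ (MvPolynomial (Fin k) ℝ) (MvPolynomial.coeff α (H t)))
        = Polynomial.C (MvPolynomial.coeff α (H t)) := by simp [lineHom]
      rw [hC]
      ring
    have h1 := congrArg (lineHom t₀ ξ) h0
    rw [map_sum, map_zero] at h1
    have h2 : Polynomial.X ^ e * ∑ t ∈ T, lineHom t₀ ξ (q t) * ∑ α ∈ (H t).support,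
          Polynomial.C (MvPolynomial.coeff α (H t)) * Polynomial.X ^ (α.degree - e) *
            ∏ i, g i ^ α i = 0 := by
      rw [← h1, Finset.mul_sum]
      refine Finset.sum_congr rfl fun t ht => ?_
      rw [map_mul, hsub t ht]
      ring
    have h3 := (mul_eq_zero.1 h2).resolve_left (pow_ne_zero _ Polynomial.X_ne_zero)
    have h4 := congrArg (Polynomial.eval 0) h3
    rw [Polynomial.eval_finsetSum, Polynomial.eval_zero] at h4
    rw [Finset.sum_eq_single_of_mem t₀ ht₀] at h4
    · rw [Polynomial.eval_mul, eval_zero_lineHom, hq t₀ ht₀ t₀ ht₀, if_pos rfl, one_mul,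
        Polynomial.eval_finsetSum] at h4
      rw [← h4, MvPolynomial.homogeneousComponent_apply, map_sum, Finset.sum_filter]
      refine Finset.sum_congr rfl fun α hα => ?_
      have hle := hmin t₀ ht₀ α (MvPolynomial.mem_support_iff.1 hα)
      split_ifs with h
      · rw [MvPolynomial.eval_monomial, Finsupp.prod_fintype _ _ (by simp)]
        simp only [h, Polynomial.eval_mul, Polynomial.eval_C, tsub_self, pow_zero,
          Polynomial.eval_prod, Polynomial.eval_pow, hg0, mul_one]
        rfl
      · have : α.degree - e ≠ 0 := by omega
        simp [this]
    · intro t ht hne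
      rw [Polynomial.eval_mul, eval_zero_lineHom, hq t ht t₀ ht₀, if_neg hne, zero_mul]
  have hzero : MvPolynomial.homogeneousComponent e (H t₀) = 0 := by
    refine MvPolynomial.funext fun y => ?_
    have := key (A⁻¹.mulVec y)
    rw [Matrix.mulVec_mulVec, Matrix.mul_nonsing_inv _ hAdet, Matrix.one_mulVec] at this
    rw [this, map_zero]
  have := congrArg (MvPolynomial.coeff α₀) hzero
  rw [MvPolynomial.coeff_homogeneousComponent, if_pos hdeg] at this
  exact hα₀ this

/-- Exponent vectors with weighted degree at most `D`. -/
def weightedExps {k : ℕ} (d : Fin k → ℕ) (D : ℕ) : Finset (Fin k → ℕ) :=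
  (Fintype.piFinset fun _ => Finset.range (D + 1)).filter fun α => ∑ i, α i * d i ≤ D

theorem mem_weightedExps {k : ℕ} {d : Fin k → ℕ} (hd : ∀ i, 1 ≤ d i) {D : ℕ} {α : Fin k → ℕ} :
    α ∈ weightedExps d D ↔ ∑ i, α i * d i ≤ D := by
  simp only [weightedExps, Finset.mem_filter, Fintype.mem_piFinset, Finset.mem_range,
    and_iff_right_iff_imp]
  intro h i
  have h1 : α i * d i ≤ ∑ i, α i * d i :=
    Finset.single_le_sum (f := fun i => α i * d i) (fun _ _ => Nat.zero_le _) (Finset.mem_univ i)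
  have h2 := Nat.le_mul_of_pos_right (α i) (hd i)
  omega

theorem card_weightedExps_le {k : ℕ} (d : Fin k → ℕ) (D : ℕ) :
    (weightedExps d D).card ≤ (D + 1) ^ k := by
  refine (Finset.card_filter_le _ _).trans ?_
  simp

theorem card_exps_le_prod_mul {k : ℕ} {d : Fin k → ℕ} (hd : ∀ i, 1 ≤ d i) (D : ℕ) :
    (weightedExps (fun _ : Fin k => 1) D).card ≤ (∏ i, d i) * (weightedExps d D).card := by
  have : (∏ i, d i) * (weightedExps d D).card =
      ((Fintype.piFinset fun i => Finset.range (d i)) ×ˢ weightedExps d D).card := by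
    simp [Finset.card_product]
  rw [this]
  refine Finset.card_le_card_of_injOn (fun β => (fun i => β i % d i, fun i => β i / d i)) ?_ ?_
  · intro β hβ
    have hβ := (mem_weightedExps (fun _ => le_rfl)).1 hβ
    simp only [Finset.coe_product, Set.mem_prod, Finset.mem_coe, Fintype.mem_piFinset,
      Finset.mem_range, mem_weightedExps hd]
    refine ⟨fun i => Nat.mod_lt _ (hd i), le_trans (Finset.sum_le_sum fun i _ => ?_) hβ⟩
    simpa using Nat.div_mul_le_self (β i) (d i)
  · intro β _ β' _ h
    simp only [Prod.mk.injEq] at h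
    funext i
    rw [← Nat.div_add_mod (β i) (d i), ← Nat.div_add_mod (β' i) (d i), congrFun h.1 i,
      congrFun h.2 i]

theorem exists_interpolation {k : ℕ} (T : Finset (Fin k → ℝ)) :
    ∃ q : (Fin k → ℝ) → MvPolynomial (Fin k) ℝ,
      ∀ t ∈ T, ∀ t' ∈ T, MvPolynomial.eval t' (q t) = if t = t' then 1 else 0 := by
  classical
  have hsep : ∀ t t' : Fin k → ℝ, ∃ l : MvPolynomial (Fin k) ℝ,
      t ≠ t' → MvPolynomial.eval t l = 1 ∧ MvPolynomial.eval t' l = 0 := by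
    intro t t'
    by_cases h : t = t'
    · exact ⟨0, fun h' => absurd h h'⟩
    · obtain ⟨i, hi⟩ := Function.ne_iff.1 h
      refine ⟨MvPolynomial.C (t i - t' i)⁻¹ * (MvPolynomial.X i - MvPolynomial.C (t' i)),
        fun _ => ⟨?_, ?_⟩⟩
      · have := sub_ne_zero.2 hi
        simp [this]
      · simp
  choose l hl using hsep
  refine ⟨fun t => ∏ t' ∈ T.erase t, l t t', fun t ht t' ht' => ?_⟩
  rw [map_prod]
  split_ifs with h
  · subst h
    exact Finset.prod_eq_one fun s hs => (hl t s (Finset.ne_of_mem_erase hs).symm).1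
  · exact Finset.prod_eq_zero (Finset.mem_erase.2 ⟨fun h' => h h'.symm, ht'⟩) (hl t t' h).2

theorem card_mul_card_weightedExps_le {k : ℕ} (G : Fin k → MvPolynomial (Fin k) ℝ) (d : Fin k → ℕ)
    (hd : ∀ i, (G i).totalDegree ≤ d i) (hd1 : ∀ i, 1 ≤ d i) (T : Finset (Fin k → ℝ))
    (hT : ∀ z ∈ T, (∀ i, MvPolynomial.eval z (G i) = 0) ∧
      (Matrix.of fun i j => MvPolynomial.eval z (MvPolynomial.pderiv j (G i))).det ≠ 0) :
    ∃ c : ℕ, ∀ D, T.card * (weightedExps d D).card ≤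
      (weightedExps (fun _ : Fin k => 1) (D + c)).card := by
  classical
  obtain ⟨q, hq⟩ := exists_interpolation T
  refine ⟨T.sup fun t => (q t).totalDegree, fun D => ?_⟩
  set c := T.sup fun t => (q t).totalDegree
  let E := weightedExps d D
  let Hf : (T × E → ℝ) → (Fin k → ℝ) → MvPolynomial (Fin k) ℝ := fun a t =>
    if ht : t ∈ T then
      ∑ α : E, MvPolynomial.monomial (Finsupp.equivFunOnFinite.symm α.1) (a (⟨t, ht⟩, α)) else 0
  let L : (T × E → ℝ) →ₗ[ℝ] MvPolynomial (Fin k) ℝ :=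
    { toFun := fun a => ∑ t ∈ T, q t * MvPolynomial.aeval G (Hf a t)
      map_add' := by
        intro a b
        rw [← Finset.sum_add_distrib]
        refine Finset.sum_congr rfl fun t ht => ?_
        simp only [Hf, dif_pos ht, Pi.add_apply, map_add, Finset.sum_add_distrib, mul_add]
      map_smul' := by
        intro r a
        simp only [RingHom.id_apply]
        rw [Finset.smul_sum]
        refine Finset.sum_congr rfl fun t ht => ?_
        simp only [Hf, dif_pos ht, Pi.smul_apply,
          ← Finset.smul_sum, map_smul, mul_smul_comm] }
  have hLinj : ∀ a, L a = 0 → a = 0 := by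
    intro a ha
    have := eq_zero_of_sum_mul_aeval_eq_zero G T hT q hq (Hf a) ha
    funext ⟨⟨t, ht⟩, α⟩
    have h1 := congrArg (MvPolynomial.coeff (Finsupp.equivFunOnFinite.symm α.1)) (this t ht)
    simp only [Hf, dif_pos ht, MvPolynomial.coeff_sum, MvPolynomial.coeff_monomial,
      EmbeddingLike.apply_eq_iff_eq, MvPolynomial.coeff_zero] at h1
    rw [Finset.sum_eq_single α] at h1
    · simpa using h1
    · intro b _ hb
      rw [if_neg fun h => hb (Subtype.ext h)]
    · simp
  have hLdeg : ∀ a, (L a).totalDegree ≤ D + c := by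
    intro a
    refine MvPolynomial.totalDegree_finsetSum_le fun t ht => ?_
    refine (MvPolynomial.totalDegree_mul _ _).trans ?_
    rw [add_comm]
    refine add_le_add ?_ (Finset.le_sup (f := fun t => (q t).totalDegree) ht)
    simp only [Hf, dif_pos ht, map_sum]
    refine MvPolynomial.totalDegree_finsetSum_le fun α _ => ?_
    rw [MvPolynomial.aeval_monomial, Finsupp.prod_fintype _ _ (by simp)]
    refine (MvPolynomial.totalDegree_mul _ _).trans ?_
    rw [MvPolynomial.algebraMap_eq, MvPolynomial.totalDegree_C, zero_add]
    refine (MvPolynomial.totalDegree_finsetProd _ _).trans ?_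
    refine le_trans (Finset.sum_le_sum fun i _ => ?_) ((mem_weightedExps hd1).1 α.2)
    exact (MvPolynomial.totalDegree_pow _ _).trans (Nat.mul_le_mul_left _ (hd i))
  let E' := weightedExps (fun _ : Fin k => 1) (D + c)
  let C : MvPolynomial (Fin k) ℝ →ₗ[ℝ] (E' → ℝ) :=
    LinearMap.pi fun β => MvPolynomial.lcoeff ℝ (Finsupp.equivFunOnFinite.symm β.1)
  have hinj : Function.Injective (C ∘ₗ L) := by
    rw [← LinearMap.ker_eq_bot, LinearMap.ker_eq_bot']
    intro a ha
    refine hLinj a (MvPolynomial.ext _ _ fun β => ?_)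
    rw [MvPolynomial.coeff_zero]
    by_cases hβ : (β : Fin k → ℕ) ∈ E'
    · have := congrFun ha ⟨_, hβ⟩
      simpa [C] using this
    · by_contra hne
      refine hβ ((mem_weightedExps fun _ => le_rfl).2 ?_)
      have := (MvPolynomial.le_totalDegree (MvPolynomial.mem_support_iff.2 hne)).trans (hLdeg a)
      rw [Finsupp.sum_fintype _ _ (by simp)] at this
      simpa using this
  have := LinearMap.finrank_le_finrank_of_injective hinj
  rw [Module.finrank_fintype_fun_eq_card, Module.finrank_fintype_fun_eq_card] at this
  simpa using this

/-- Bézout's bound for the nondegenerate real zeros of a square polynomial system. -/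
theorem card_nondegenerate_zeros_le {k : ℕ} (G : Fin k → MvPolynomial (Fin k) ℝ) (d : Fin k → ℕ)
    (hd : ∀ i, (G i).totalDegree ≤ d i) (T : Finset (Fin k → ℝ))
    (hT : ∀ z ∈ T, (∀ i, MvPolynomial.eval z (G i) = 0) ∧
      (Matrix.of fun i j => MvPolynomial.eval z (MvPolynomial.pderiv j (G i))).det ≠ 0) :
    T.card ≤ ∏ i, d i := by
  by_cases hd1 : ∀ i, 1 ≤ d i
  · by_contra! hlt
    obtain ⟨c, hc⟩ := card_mul_card_weightedExps_le G d hd hd1 T hT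
    set P := ∏ i, d i with hP
    have hP1 : 1 ≤ P := Nat.one_le_iff_ne_zero.2
      (Finset.prod_ne_zero_iff.2 fun i _ => Nat.one_le_iff_ne_zero.1 (hd1 i))
    let s : ℕ → ℕ := fun D => (weightedExps (fun _ : Fin k => 1) D).card
    have hs : ∀ D, (P + 1) * s D ≤ P * s (D + c) := by
      intro D
      calc (P + 1) * s D ≤ T.card * (P * (weightedExps d D).card) :=
            Nat.mul_le_mul hlt (card_exps_le_prod_mul hd1 D)
        _ = P * (T.card * (weightedExps d D).card) := by ring
        _ ≤ P * s (D + c) := Nat.mul_le_mul_left _ (hc D)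
    have hs0 : 1 ≤ s 0 := Finset.card_pos.2
      ⟨0, (mem_weightedExps fun _ => le_rfl).2 (by simp)⟩
    have hP0 : (0 : ℝ) < P := by exact_mod_cast hP1
    have hpow : ∀ j : ℕ, ((1 : ℝ) + 1 / P) ^ j ≤ s (j * c) := by
      intro j
      induction j with
      | zero => simpa using hs0
      | succ j ih =>
        have h1 : ((P : ℝ) + 1) * s (j * c) ≤ P * s (j * c + c) := by exact_mod_cast hs (j * c)
        rw [pow_succ]
        have h2 : (1 + 1 / (P : ℝ)) ^ j * (1 + 1 / P) ≤ s (j * c) * (1 + 1 / P) := by gcongr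
        refine h2.trans ?_
        rw [show (j + 1) * c = j * c + c by ring]
        have : (s (j * c) : ℝ) * (1 + 1 / P) = ((P : ℝ) + 1) * s (j * c) / P := by
          field_simp
        rw [this, div_le_iff₀ hP0]
        linarith
    have hr : (1 : ℝ) < 1 + 1 / P := by
      have : (0 : ℝ) < 1 / P := by positivity
      linarith
    have hlim := tendsto_pow_const_div_const_pow_of_one_lt k hr
    have hε : (0 : ℝ) < 1 / ((c + 1) ^ k * 2 ^ k) := by positivity
    have hev := (hlim.eventually (gt_mem_nhds hε)).and (Filter.eventually_ge_atTop 1)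
    obtain ⟨j, hj, hj1⟩ := hev.exists
    have hb : (s (j * c) : ℝ) ≤ (c + 1) ^ k * 2 ^ k * (j : ℝ) ^ k := by
      have h1 : (s (j * c) : ℝ) ≤ ((j * c + 1 : ℕ) : ℝ) ^ k := by
        exact_mod_cast card_weightedExps_le _ _
      refine h1.trans ?_
      rw [← mul_pow, ← mul_pow]
      gcongr
      push_cast
      have : (1 : ℝ) ≤ j := by exact_mod_cast hj1
      have : (0 : ℝ) ≤ c := by positivity
      nlinarith
    have h3 := hpow j
    have hrj : (0 : ℝ) < (1 + 1 / (P : ℝ)) ^ j := by positivity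
    rw [div_lt_div_iff₀ hrj (by positivity)] at hj
    nlinarith
  · push Not at hd1
    obtain ⟨i, hi⟩ := hd1
    have hT0 : T = ∅ := by
      refine Finset.eq_empty_of_forall_notMem fun z hz => (hT z hz).2 ?_
      refine Matrix.det_eq_zero_of_row_eq_zero i fun j => ?_
      have h0 : (G i).totalDegree = 0 := by have := hd i; omega
      rw [MvPolynomial.totalDegree_eq_zero_iff_eq_C] at h0
      rw [Matrix.of_apply, h0]
      simp
    simp [hT0]

open Set Filter Topology

section CurveCount

variable {X Y : Type*} [TopologicalSpace X] [TopologicalSpace Y]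

theorem exists_nhds_injOn {f : X → Y} {K : Set X} (hf : IsLocalHomeomorphOn f K) {x : X}
    (hx : x ∈ K) : ∃ W, IsOpen W ∧ x ∈ W ∧ InjOn f W := by
  obtain ⟨e, hxe, rfl⟩ := hf x hx
  exact ⟨e.source, e.open_source, hxe, e.injOn⟩

theorem finite_fiber {f : X → Y} {K : Set X} (hf : IsLocalHomeomorphOn f K) (hK : IsCompact K)
    (y : Y) : {x | x ∈ K ∧ f x = y}.Finite := by
  choose! W hWo hxW hWi using fun x (hx : x ∈ K) => exists_nhds_injOn hf hx
  obtain ⟨t, htK, ht⟩ := hK.elim_nhds_subcover W fun x hx => (hWo x hx).mem_nhds (hxW x hx)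
  refine Set.Finite.subset (t.finite_toSet.biUnion (t := fun x => {z | z ∈ W x ∧ f z = y})
    fun x hx => ?_) ?_
  · refine Set.Subsingleton.finite fun a ha b hb => ?_
    exact hWi x (htK x hx) ha.1 hb.1 (ha.2.trans hb.2.symm)
  · rintro z ⟨hzK, hz⟩
    obtain ⟨x, hx, hzx⟩ := mem_iUnion₂.1 (ht hzK)
    exact mem_iUnion₂.2 ⟨x, hx, hzx, hz⟩

theorem eventually_encard_fiber_le [T2Space Y] {f : X → Y} {K : Set X}
    (hf : IsLocalHomeomorphOn f K) (hK : IsCompact K) (y : Y) :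
    ∀ᶠ y' in 𝓝 y, {x | x ∈ K ∧ f x = y'}.encard ≤ {x | x ∈ K ∧ f x = y}.encard := by
  choose! W hWo hxW hWi using fun x (hx : x ∈ K) => exists_nhds_injOn hf hx
  set I := {x | x ∈ K ∧ f x = y} with hI
  have hopen : IsOpen (⋃ x ∈ I, W x) := isOpen_biUnion fun x hx => hWo x hx.1
  have hK' : IsCompact (K \ ⋃ x ∈ I, W x) := hK.diff hopen
  have hcont : ContinuousOn f (K \ ⋃ x ∈ I, W x) := fun x hx =>
    (hf.continuousAt hx.1).continuousWithinAt
  have hcl : IsClosed (f '' (K \ ⋃ x ∈ I, W x)) := (hK'.image_of_continuousOn hcont).isClosed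
  have hy : y ∉ f '' (K \ ⋃ x ∈ I, W x) := by
    rintro ⟨x, ⟨hxK, hx⟩, hxy⟩
    exact hx (mem_iUnion₂.2 ⟨x, ⟨hxK, hxy⟩, hxW x hxK⟩)
  filter_upwards [hcl.isOpen_compl.mem_nhds hy] with y' hy'
  have hex : ∀ z ∈ {x | x ∈ K ∧ f x = y'}, ∃ x ∈ I, z ∈ W x := by
    rintro z ⟨hzK, hz⟩
    by_contra! hne
    refine hy' ⟨z, ⟨hzK, fun hz' => ?_⟩, hz⟩
    obtain ⟨x, hx, hzx⟩ := mem_iUnion₂.1 hz'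
    exact hne x hx hzx
  choose! g hgI hgW using hex
  refine encard_le_encard_of_injOn (f := g) hgI fun a ha b hb hab => ?_
  refine hWi (g a) (hgI a ha).1 (hgW a ha) ?_ (ha.2.trans hb.2.symm)
  rw [hab]
  exact hgW b hb

theorem eventually_le_encard_fiber [T2Space X] {f : X → Y} {K : Set X}
    (hf : IsLocalHomeomorphOn f K) {y : Y} {I : Set X} (hI : I.Finite)
    (hIK : I ⊆ interior K) (hIy : ∀ x ∈ I, f x = y) :
    ∀ᶠ y' in 𝓝 y, I.encard ≤ {x | x ∈ K ∧ f x = y'}.encard := by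
  obtain ⟨U, hU, hdisj⟩ := hI.t2_separation
  have h1 : ∀ x ∈ I, ∀ᶠ y' in 𝓝 y, ∃ z ∈ U x ∩ interior K, f z = y' := by
    intro x hx
    have hn : U x ∩ interior K ∈ 𝓝 x :=
      ((hU x).2.inter isOpen_interior).mem_nhds ⟨(hU x).1, hIK hx⟩
    have := image_mem_map (m := f) hn
    rw [hf.map_nhds_eq (interior_subset (hIK hx)), hIy x hx] at this
    exact this
  filter_upwards [(eventually_all_finite hI).2 h1] with y' hy'
  choose! g hg hgy using hy'
  refine encard_le_encard_of_injOn (f := g)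
    (fun x hx => ⟨interior_subset (hg x hx).2, hgy x hx⟩) fun a ha b hb hab => ?_
  by_contra hne
  refine disjoint_left.1 (hdisj ha hb hne) (hg a ha).1 ?_
  rw [hab]
  exact (hg b hb).1

/-- Points of a fibre of a local homeomorphism on a compact set are at most as many as the
boundary points that are met when the value moves along an injective curve leaving the image. -/
theorem encard_le_encard_frontier_of_curve [T2Space X] [T2Space Y] {f : X → Y} {K : Set X}
    (hf : IsLocalHomeomorphOn f K) (hK : IsCompact K) {c : ℝ → Y} (hc : Continuous c)
    (hinj : Function.Injective c) {R : ℝ} (hR : ∀ r, R ≤ r → c r ∉ f '' K)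
    {P : Set X} (hP : P ⊆ interior K) (hPc : ∀ x ∈ P, f x = c 0) :
    P.encard ≤ {x | x ∈ K \ interior K ∧ ∃ r, 0 < r ∧ f x = c r}.encard := by
  set N : ℝ → Set X := fun r => {x | x ∈ K ∧ f x = c r} with hN
  set F : ℝ → Set X := fun r => {x | x ∈ K \ interior K ∧ ∃ r', 0 < r' ∧ r' < r ∧ f x = c r'}
    with hF
  have hFmono : ∀ {r r'}, r ≤ r' → F r ⊆ F r' := by
    rintro r r' h x ⟨hx, s, hs, hsr, hxs⟩
    exact ⟨hx, s, hs, hsr.trans_le h, hxs⟩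
  have hright : ∀ r, 0 ≤ r → ∀ I ⊆ N r, I ⊆ interior K → ∀ᶠ r' in 𝓝[>] r,
      I.encard ≤ (N r').encard := by
    intro r _ I hI hIK
    have := eventually_le_encard_fiber hf ((finite_fiber hf hK (c r)).subset hI) hIK
      (fun x hx => (hI hx).2)
    exact (hc.continuousAt.eventually this).filter_mono nhdsWithin_le_nhds
  have hall : ∀ r, 0 ≤ r → P.encard ≤ (N r).encard + (F r).encard := by
    by_contra! hbad
    set B : Set ℝ := {r | 0 ≤ r ∧ (N r).encard + (F r).encard < P.encard} with hB
    have hBne : B.Nonempty := by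
      obtain ⟨r, h0, h⟩ := hbad
      exact ⟨r, h0, h⟩
    have hBb : BddBelow B := ⟨0, fun r hr => hr.1⟩
    set r₀ := sInf B with hr₀
    have hr0 : 0 ≤ r₀ := le_csInf hBne fun r hr => hr.1
    have hlt : ∀ r, 0 ≤ r → r < r₀ → P.encard ≤ (N r).encard + (F r).encard := by
      intro r h0 hr
      by_contra! h
      exact absurd (csInf_le hBb (show r ∈ B from ⟨h0, h⟩)) (not_le.2 hr)
    have hPN : P ⊆ N 0 := fun x hx => ⟨interior_subset (hP hx), hPc x hx⟩
    have hgood : P.encard ≤ (N r₀).encard + (F r₀).encard := by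
      rcases hr0.eq_or_lt with h | h
      · rw [← h]
        exact (encard_le_encard hPN).trans le_self_add
      · have h1 := hc.continuousAt.eventually (eventually_encard_fiber_le hf hK (c r₀))
        have h2 : ∀ᶠ r in 𝓝[<] r₀, P.encard ≤ (N r₀).encard + (F r₀).encard := by
          filter_upwards [h1.filter_mono nhdsWithin_le_nhds, self_mem_nhdsWithin,
            (eventually_gt_nhds h).filter_mono nhdsWithin_le_nhds] with r hr hr' hr0'
          refine (hlt r hr0'.le hr').trans (add_le_add hr (encard_le_encard (hFmono (le_of_lt hr'))))
        exact h2.exists.choose_spec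
    have hev : ∀ᶠ r in 𝓝[>] r₀, P.encard ≤ (N r).encard + (F r).encard := by
      rcases hr0.eq_or_lt with h | h
      · filter_upwards [hright r₀ hr0 P (by rw [← h]; exact hPN) hP] with r hr
        exact hr.trans le_self_add
      · have hsplit : (N r₀).encard = (N r₀ ∩ interior K).encard + (N r₀ \ interior K).encard := by
          rw [add_comm, encard_sdiff_add_encard_inter]
        filter_upwards [hright r₀ hr0 (N r₀ ∩ interior K) inter_subset_left inter_subset_right,
          self_mem_nhdsWithin] with r hr hr'
        have hsub : (N r₀ \ interior K) ∪ F r₀ ⊆ F r := by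
          refine union_subset ?_ (hFmono (le_of_lt hr'))
          rintro x ⟨⟨hxK, hx⟩, hxi⟩
          exact ⟨⟨hxK, hxi⟩, r₀, h, hr', hx⟩
        have hdj : Disjoint (N r₀ \ interior K) (F r₀) := by
          rw [disjoint_left]
          rintro x ⟨⟨_, hx⟩, _⟩ ⟨_, s, _, hs, hxs⟩
          exact hs.ne (hinj (hxs.symm.trans hx))
        have := encard_le_encard hsub
        rw [encard_union_eq hdj] at this
        calc P.encard ≤ _ := hgood
          _ = (N r₀ ∩ interior K).encard + ((N r₀ \ interior K).encard + (F r₀).encard) := by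
            rw [hsplit, add_assoc]
          _ ≤ _ := add_le_add hr this
    obtain ⟨δ, hδ, hδ'⟩ := (mem_nhdsGT_iff_exists_Ioo_subset).1 hev
    obtain ⟨b, hbB, hb⟩ := exists_lt_of_csInf_lt hBne (show sInf B < δ from hδ)
    have hb0 : r₀ ≤ b := csInf_le hBb hbB
    rcases hb0.eq_or_lt with h | h
    · exact absurd hgood (not_le.2 (h ▸ hbB.2))
    · exact absurd (hδ' ⟨h, hb⟩) (not_le.2 hbB.2)
  have hfin := hall (max R 0) (le_max_right _ _)
  have hempty : N (max R 0) = ∅ := by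
    refine eq_empty_of_forall_notMem fun x hx => ?_
    exact hR _ (le_max_left _ _) ⟨x, hx.1, hx.2⟩
  rw [hempty, encard_empty, zero_add] at hfin
  refine hfin.trans (encard_le_encard ?_)
  rintro x ⟨hx, s, hs, _, hxs⟩
  exact ⟨hx, s, hs, hxs⟩

end CurveCount

open MeasureTheory

/-- Almost every fibre of `f` over `Δ` has at most `B` points. -/
def AEFiberBound {k : ℕ} (Δ : Set (Fin k → ℝ)) (f : (Fin k → ℝ) → (Fin k → ℝ)) (B : ℕ) : Prop :=
  ∀ᵐ s : Fin k → ℝ, {z | z ∈ Δ ∧ f z = s}.encard ≤ B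

theorem ae_ae_update {k : ℕ} (j : Fin k) {p : (Fin k → ℝ) → Prop} (hp : ∀ᵐ s, p s) :
    ∀ᵐ s : Fin k → ℝ, ∀ᵐ τ : ℝ, p (Function.update s j τ) := by
  obtain _ | k := k
  · exact j.elim0
  have he := volume_preserving_piFinSuccAbove (fun _ : Fin (k + 1) => ℝ) j
  have h1 : ∀ᵐ x : ℝ × (Fin k → ℝ),
      p ((MeasurableEquiv.piFinSuccAbove (fun _ : Fin (k + 1) => ℝ) j).symm x) :=
    (he.symm _).quasiMeasurePreserving.ae hp
  have h2 : ∀ᵐ x : (Fin k → ℝ) × ℝ,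
      p ((MeasurableEquiv.piFinSuccAbove (fun _ : Fin (k + 1) => ℝ) j).symm x.swap) :=
    Measure.measurePreserving_swap.quasiMeasurePreserving.ae h1
  have h3 := Measure.ae_ae_of_ae_prod h2
  have h4 := (Measure.quasiMeasurePreserving_snd.comp he.quasiMeasurePreserving).ae h3
  filter_upwards [h4] with s hs
  filter_upwards [hs] with τ hτ
  have : Function.update s j τ = (MeasurableEquiv.piFinSuccAbove (fun _ : Fin (k + 1) => ℝ) j).symm
      ((Prod.snd ∘ (MeasurableEquiv.piFinSuccAbove (fun _ : Fin (k + 1) => ℝ) j)) s, τ).swap := by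
    exact (Fin.insertNth_removeNth j τ s).symm
  rw [this]
  exact hτ

theorem AEFiberBound.ae_ae {k : ℕ} {Δ : Set (Fin k → ℝ)} {f : (Fin k → ℝ) → (Fin k → ℝ)}
    {j : Fin k} {g : (Fin k → ℝ) → ℝ} {B : ℕ}
    (h : AEFiberBound Δ (fun z => Function.update (f z) j (g z)) B) :
    ∀ᵐ s : Fin k → ℝ, ∀ᵐ τ : ℝ, {z | z ∈ Δ ∧ g z = τ ∧ ∀ i, i ≠ j → f z i = s i}.encard ≤ B := by
  filter_upwards [ae_ae_update j h] with s hs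
  filter_upwards [hs] with τ hτ
  refine le_trans (encard_le_encard ?_) hτ
  rintro z ⟨hz, hg, hf⟩
  refine ⟨hz, ?_⟩
  funext i
  by_cases hi : i = j
  · subst hi; simp [hg]
  · simp [hi, hf i hi]

theorem ae_det_ne_zero {k : ℕ} {Δ : Set (Fin k → ℝ)} {f : (Fin k → ℝ) → (Fin k → ℝ)}
    {f' : (Fin k → ℝ) → (Fin k → ℝ) →L[ℝ] (Fin k → ℝ)}
    (hf : ∀ z ∈ Δ, HasStrictFDerivAt f (f' z) z) :
    ∀ᵐ s : Fin k → ℝ, ∀ z ∈ Δ, f z = s → (f' z).det ≠ 0 := by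
  have h := addHaar_image_eq_zero_of_det_fderivWithin_eq_zero (μ := (volume : Measure (Fin k → ℝ)))
    (s := {z | z ∈ Δ ∧ (f' z).det = 0}) (f := f) (f' := f')
    (fun z hz => (hf z hz.1).hasFDerivAt.hasFDerivWithinAt) fun z hz => hz.2
  filter_upwards [measure_eq_zero_iff_ae_notMem.1 h] with s hs z hz hzs h0
  exact hs ⟨z, ⟨hz, h0⟩, hzs⟩

/-- The data needed to count fibres by moving one coordinate of the value: a strictly
differentiable map, a function vanishing exactly where the Jacobian does, and an exhaustion by
compact superlevel sets. -/
structure RolleData {k : ℕ} (Δ : Set (Fin k → ℝ)) (f : (Fin k → ℝ) → (Fin k → ℝ))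
    (J r : (Fin k → ℝ) → ℝ) where
  isOpen : IsOpen Δ
  deriv : (Fin k → ℝ) → (Fin k → ℝ) →L[ℝ] (Fin k → ℝ)
  hasStrictFDerivAt : ∀ z ∈ Δ, HasStrictFDerivAt f (deriv z) z
  continuousOn_jac : ContinuousOn J Δ
  jac_eq_zero : ∀ z ∈ Δ, J z = 0 ↔ (deriv z).det = 0
  continuousOn_exhaust : ContinuousOn r Δ
  isCompact : ∀ L, IsCompact {z | z ∈ Δ ∧ L ≤ r z}

namespace RolleData

variable {k : ℕ} {Δ : Set (Fin k → ℝ)} {f : (Fin k → ℝ) → (Fin k → ℝ)}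
  {J r : (Fin k → ℝ) → ℝ}

theorem isLocalHomeomorphOn (D : RolleData Δ f J r) :
    IsLocalHomeomorphOn f {z | z ∈ Δ ∧ J z ≠ 0} := by
  intro z hz
  have hdet : (D.deriv z).det ≠ 0 := fun h => hz.2 ((D.jac_eq_zero z hz.1).2 h)
  let e := (D.deriv z).toContinuousLinearEquivOfDetNeZero hdet
  have he : (e : (Fin k → ℝ) →L[ℝ] (Fin k → ℝ)) = D.deriv z := by
    ext; simp [e]
  have h : HasStrictFDerivAt f (e : (Fin k → ℝ) →L[ℝ] (Fin k → ℝ)) z := by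
    rw [he]; exact D.hasStrictFDerivAt z hz.1
  exact ⟨h.toOpenPartialHomeomorph f, h.mem_toOpenPartialHomeomorph_source, rfl⟩

theorem continuousOn (D : RolleData Δ f J r) : ContinuousOn f Δ := fun z hz =>
  (D.hasStrictFDerivAt z hz).hasFDerivAt.continuousAt.continuousWithinAt

theorem encard_le (D : RolleData Δ f J r) (j : Fin k) (s : Fin k → ℝ) {ε δ τ L : ℝ}
    (hδ : |δ| = 1) (hτ : 0 < τ) {P : Set (Fin k → ℝ)}
    (hP : ∀ z ∈ P, z ∈ Δ ∧ f z = s ∧ τ < ε * J z ∧ L < r z) :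
    P.encard ≤
      {z | z ∈ Δ ∧ ε * J z = τ ∧ (∀ i, i ≠ j → f z i = s i) ∧ 0 < δ * (f z j - s j)}.encard +
      {z | z ∈ Δ ∧ r z = L ∧ τ ≤ ε * J z ∧ (∀ i, i ≠ j → f z i = s i) ∧
        0 < δ * (f z j - s j)}.encard := by
  set K : Set (Fin k → ℝ) := {z | z ∈ Δ ∧ τ ≤ ε * J z ∧ L ≤ r z} with hKdef
  have hJc : ContinuousOn (fun z => ε * J z) Δ := continuousOn_const.mul D.continuousOn_jac
  have hK : IsCompact K := by
    have hC := D.isCompact L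
    have h1 := (hJc.mono fun z (hz : z ∈ {z | z ∈ Δ ∧ L ≤ r z}) => hz.1).preimage_isClosed_of_isClosed
      hC.isClosed (isClosed_Ici (a := τ))
    refine hC.of_isClosed_subset (s := {z | z ∈ Δ ∧ L ≤ r z}) (t := K) ?_ fun z hz => ⟨hz.1, hz.2.2⟩
    convert h1 using 1
    ext z
    simp only [K, mem_ofPred_eq, mem_inter_iff, mem_preimage, mem_Ici]
    tauto
  have hint : ∀ z, z ∈ Δ → τ < ε * J z → L < r z → z ∈ interior K := by
    intro z hz h1 h2
    have ho1 := hJc.isOpen_inter_preimage D.isOpen (isOpen_Ioi (a := τ))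
    have ho2 := D.continuousOn_exhaust.isOpen_inter_preimage D.isOpen (isOpen_Ioi (a := L))
    refine mem_interior.2 ⟨_, ?_, ho1.inter ho2, ⟨hz, h1⟩, ⟨hz, h2⟩⟩
    rintro w ⟨⟨hw, hw1⟩, ⟨_, hw2⟩⟩
    exact ⟨hw, le_of_lt hw1, le_of_lt hw2⟩
  have hloc : IsLocalHomeomorphOn f K := by
    refine fun z hz => D.isLocalHomeomorphOn z ⟨hz.1, fun h => ?_⟩
    have := hz.2.1
    rw [h, mul_zero] at this
    exact absurd this (not_le.2 hτ)
  let c : ℝ → Fin k → ℝ := fun ρ => Function.update s j (s j + δ * ρ)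
  have hc : Continuous c := continuous_const.update j (by fun_prop)
  have hδ0 : δ ≠ 0 := by
    rintro rfl
    simp at hδ
  have hinj : Function.Injective c := by
    intro a b hab
    have := congrFun hab j
    simp only [c, Function.update_self, add_right_inj] at this
    exact mul_left_cancel₀ hδ0 this
  have hcont : ContinuousOn (fun z => f z j) K :=
    (continuous_apply j).comp_continuousOn (D.continuousOn.mono fun z hz => hz.1)
  obtain ⟨M, hM⟩ := hK.exists_bound_of_continuousOn hcont
  have hR : ∀ ρ, M + |s j| + 1 ≤ ρ → c ρ ∉ f '' K := by
    rintro ρ hρ ⟨z, hz, hzc⟩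
    have h1 := hM z hz
    have h2 := congrFun hzc j
    simp only [c, Function.update_self] at h2
    rw [h2, Real.norm_eq_abs] at h1
    have h3 : |δ * ρ| ≤ |s j + δ * ρ| + |s j| := by
      have := abs_sub (s j + δ * ρ) (s j)
      simpa using this
    rw [abs_mul, hδ, one_mul] at h3
    have := le_abs_self ρ
    linarith
  have hmain := encard_le_encard_frontier_of_curve hloc hK hc hinj hR (P := P)
    (fun z hz => hint z (hP z hz).1 (hP z hz).2.2.1 (hP z hz).2.2.2)
    (fun z hz => by simp [c, (hP z hz).2.1])
  refine hmain.trans ((encard_le_encard ?_).trans (encard_union_le _ _))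
  rintro z ⟨⟨⟨hz, hzJ, hzr⟩, hzi⟩, ρ, hρ, hfz⟩
  have hoff : ∀ i, i ≠ j → f z i = s i := by
    intro i hi
    rw [hfz]
    simp [c, hi]
  have hpos : 0 < δ * (f z j - s j) := by
    rw [hfz]
    simp only [c, Function.update_self, add_sub_cancel_left]
    rw [← mul_assoc, ← sq, ← sq_abs, hδ]
    simpa using hρ
  by_cases h1 : ε * J z = τ
  · exact Or.inl ⟨hz, h1, hoff, hpos⟩
  · refine Or.inr ⟨hz, ?_, hzJ, hoff, hpos⟩
    by_contra h2
    exact hzi (hint z hz (lt_of_le_of_ne hzJ (Ne.symm h1)) (lt_of_le_of_ne hzr (Ne.symm h2)))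

theorem two_mul_encard_le (D : RolleData Δ f J r) (j : Fin k) (s : Fin k → ℝ) {ε τ L : ℝ}
    (hτ : 0 < τ) {P : Set (Fin k → ℝ)}
    (hP : ∀ z ∈ P, z ∈ Δ ∧ f z = s ∧ τ < ε * J z ∧ L < r z) :
    2 * P.encard ≤
      {z | z ∈ Δ ∧ ε * J z = τ ∧ ∀ i, i ≠ j → f z i = s i}.encard +
      {z | z ∈ Δ ∧ r z = L ∧ τ ≤ ε * J z ∧ ∀ i, i ≠ j → f z i = s i}.encard := by
  have h1 := D.encard_le j s (δ := 1) (by simp) hτ hP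
  have h2 := D.encard_le j s (δ := -1) (by simp) hτ hP
  have hsum := add_le_add h1 h2
  rw [← two_mul, add_add_add_comm, ← encard_union_eq, ← encard_union_eq] at hsum
  · refine hsum.trans (add_le_add (encard_le_encard ?_) (encard_le_encard ?_))
    · rintro z (h | h)
      · exact ⟨h.1, h.2.1, h.2.2.1⟩
      · exact ⟨h.1, h.2.1, h.2.2.1⟩
    · rintro z (h | h)
      · exact ⟨h.1, h.2.1, h.2.2.1, h.2.2.2.1⟩
      · exact ⟨h.1, h.2.1, h.2.2.1, h.2.2.2.1⟩
  · rw [disjoint_left]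
    rintro z ⟨_, _, _, _, h⟩ ⟨_, _, _, _, h'⟩
    linarith
  · rw [disjoint_left]
    rintro z ⟨_, _, _, h⟩ ⟨_, _, _, h'⟩
    linarith

theorem encard_le_of_forall_finite {α : Type*} {Z : Set α} {B : ℕ}
    (h : ∀ P ⊆ Z, P.Finite → P.encard ≤ B) : Z.encard ≤ B := by
  by_contra! hlt
  have : ((B + 1 : ℕ) : ℕ∞) ≤ Z.encard := by
    push_cast
    exact Order.add_one_le_of_lt hlt
  obtain ⟨P, hPZ, hP⟩ := exists_subset_encard_eq this
  have h1 := h P hPZ (finite_of_encard_eq_coe hP)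
  rw [hP] at h1
  norm_cast at h1
  omega

theorem exists_mem_Ioo_of_ae {p : ℝ → Prop} (hp : ∀ᵐ x, p x) {a b : ℝ} (hab : a < b) :
    ∃ x, a < x ∧ x < b ∧ p x := by
  obtain ⟨x, hpx, hx⟩ := (Measure.dense_of_ae hp).inter_nhds_nonempty
    (Ioo_mem_nhds (left_lt_add_div_two.2 hab) (add_div_two_lt_right.2 hab))
  exact ⟨x, hx.1, hx.2, hpx⟩

theorem exists_pos_lt_abs {P : Set (Fin k → ℝ)} (hP : P.Finite) (hJ : ∀ z ∈ P, J z ≠ 0) :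
    ∃ τ, 0 < τ ∧ ∀ z ∈ P, τ ≤ |J z| := by
  rcases P.eq_empty_or_nonempty with rfl | hne
  · exact ⟨1, one_pos, by simp⟩
  · obtain ⟨z, hz, hmin⟩ := exists_min_image P (fun z => |J z|) hP hne
    exact ⟨|J z|, abs_pos.2 (hJ z hz), hmin⟩

theorem exists_le_of_finite {P : Set (Fin k → ℝ)} (hP : P.Finite) :
    ∃ L, ∀ z ∈ P, L ≤ r z := by
  obtain ⟨L, hL⟩ := (hP.image r).bddBelow
  exact ⟨L, fun z hz => hL (mem_image_of_mem r hz)⟩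

theorem ae_exists_level {B : ℕ} {j : Fin k}
    (h : AEFiberBound Δ (fun z => Function.update (f z) j (J z)) B) :
    ∀ᵐ s : Fin k → ℝ, ∀ τ₀ : ℝ, 0 < τ₀ → ∃ τ, 0 < τ ∧ τ < τ₀ ∧
      {z | z ∈ Δ ∧ 1 * J z = τ ∧ ∀ i, i ≠ j → f z i = s i}.encard ≤ B ∧
      {z | z ∈ Δ ∧ -1 * J z = τ ∧ ∀ i, i ≠ j → f z i = s i}.encard ≤ B := by
  filter_upwards [h.ae_ae] with s hs τ₀ hτ₀
  have hneg := (Measure.measurePreserving_neg (volume : Measure ℝ)).quasiMeasurePreserving.ae hs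
  obtain ⟨τ, h0, h1, h2, h3⟩ := exists_mem_Ioo_of_ae (hs.and hneg) hτ₀
  refine ⟨τ, h0, h1, by simpa using h2, ?_⟩
  convert h3 using 6
  constructor <;> intro h <;> linarith

theorem encard_eq_add_of_ne_zero {P : Set (Fin k → ℝ)} {τ : ℝ} (hτ : ∀ z ∈ P, τ < |J z|) :
    P.encard ≤ {z | z ∈ P ∧ τ < 1 * J z}.encard + {z | z ∈ P ∧ τ < -1 * J z}.encard := by
  refine (encard_le_encard ?_).trans (encard_union_le _ _)
  intro z hz
  rcases abs_cases (J z) with h | h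
  · exact Or.inl ⟨hz, by rw [one_mul, ← h.1]; exact hτ z hz⟩
  · exact Or.inr ⟨hz, by rw [neg_one_mul, ← h.1]; exact hτ z hz⟩

theorem aeFiberBound (D : RolleData Δ f J r) (j : Fin k) {B₁ B₂ B : ℕ}
    (h₁ : AEFiberBound Δ (fun z => Function.update (f z) j (J z)) B₁)
    (h₂ : ∀ᵐ s : Fin k → ℝ, ∀ L₀ : ℝ, ∃ L, L < L₀ ∧
      {z | z ∈ Δ ∧ r z = L ∧ ∀ i, i ≠ j → f z i = s i}.encard ≤ B₂)
    (hB : 2 * B₁ + B₂ ≤ 2 * B) : AEFiberBound Δ f B := by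
  filter_upwards [ae_exists_level h₁, h₂, ae_det_ne_zero D.hasStrictFDerivAt] with s hs1 hs2 hdet
  refine encard_le_of_forall_finite fun P hPZ hP => ?_
  have hJ : ∀ z ∈ P, J z ≠ 0 := fun z hz h =>
    hdet z (hPZ hz).1 (hPZ hz).2 ((D.jac_eq_zero z (hPZ hz).1).1 h)
  obtain ⟨τ₀, hτ₀, hPτ⟩ := exists_pos_lt_abs hP hJ
  obtain ⟨L₀, hPL⟩ := exists_le_of_finite (r := r) hP
  obtain ⟨τ, hτ, hττ, hp, hn⟩ := hs1 τ₀ hτ₀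
  obtain ⟨L, hL, hLB⟩ := hs2 L₀
  have hcover := encard_eq_add_of_ne_zero (J := J) fun z hz => hττ.trans_le (hPτ z hz)
  have h1 := D.two_mul_encard_le j s (ε := 1) (L := L) hτ (P := {z | z ∈ P ∧ τ < 1 * J z})
    fun z hz => ⟨(hPZ hz.1).1, (hPZ hz.1).2, hz.2, hL.trans_le (hPL z hz.1)⟩
  have h2 := D.two_mul_encard_le j s (ε := -1) (L := L) hτ (P := {z | z ∈ P ∧ τ < -1 * J z})
    fun z hz => ⟨(hPZ hz.1).1, (hPZ hz.1).2, hz.2, hL.trans_le (hPL z hz.1)⟩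
  have hR : {z | z ∈ Δ ∧ r z = L ∧ τ ≤ 1 * J z ∧ ∀ i, i ≠ j → f z i = s i}.encard +
      {z | z ∈ Δ ∧ r z = L ∧ τ ≤ -1 * J z ∧ ∀ i, i ≠ j → f z i = s i}.encard ≤ B₂ := by
    rw [← encard_union_eq]
    · refine (encard_le_encard ?_).trans hLB
      rintro z (h | h)
      · exact ⟨h.1, h.2.1, h.2.2.2⟩
      · exact ⟨h.1, h.2.1, h.2.2.2⟩
    · rw [disjoint_left]
      rintro z ⟨_, _, h, _⟩ ⟨_, _, h', _⟩
      linarith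
  have htot : 2 * P.encard ≤ ((2 * B₁ + B₂ : ℕ) : ℕ∞) := by
    calc 2 * P.encard ≤ 2 * _ := mul_le_mul_right hcover 2
      _ ≤ _ := (mul_add _ _ _).le.trans (add_le_add h1 h2)
      _ ≤ (B₁ + B₁ : ℕ∞) + B₂ := by
        rw [add_add_add_comm]
        exact add_le_add (add_le_add hp hn) hR
      _ = _ := by push_cast; ring
  rw [hP.encard_eq_coe] at htot ⊢
  norm_cast at htot ⊢
  omega

/-- Rolle step: replace one coordinate by the Jacobian, or by the exhaustion function. -/
theorem aeFiberBound_of_update (D : RolleData Δ f J r) (j : Fin k) {B₁ B₂ B : ℕ}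
    (h₁ : AEFiberBound Δ (fun z => Function.update (f z) j (J z)) B₁)
    (h₂ : AEFiberBound Δ (fun z => Function.update (f z) j (r z)) B₂)
    (hB : 2 * B₁ + B₂ ≤ 2 * B) : AEFiberBound Δ f B := by
  refine D.aeFiberBound j h₁ ?_ hB
  filter_upwards [h₂.ae_ae] with s hs L₀
  obtain ⟨L, _, hL, h⟩ := exists_mem_Ioo_of_ae hs (sub_one_lt L₀)
  exact ⟨L, hL, h⟩

/-- Rolle step when another coordinate is the exhaustion function. -/
theorem aeFiberBound_of_coord_ne (D : RolleData Δ f J r) {i j : Fin k} (hij : i ≠ j)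
    (hi : ∀ z ∈ Δ, f z i = r z) {B : ℕ}
    (h₁ : AEFiberBound Δ (fun z => Function.update (f z) j (J z)) B) : AEFiberBound Δ f B := by
  refine D.aeFiberBound (B₂ := 0) j h₁ (Eventually.of_forall fun s L₀ => ?_) (by omega)
  refine ⟨min L₀ (s i) - 1, by linarith [min_le_left L₀ (s i)], ?_⟩
  rw [Nat.cast_zero, nonpos_iff_eq_zero, encard_eq_zero]
  refine eq_empty_of_forall_notMem fun z hz => ?_
  have h1 := hz.2.2 i hij
  rw [hi z hz.1, hz.2.1] at h1
  linarith [min_le_right L₀ (s i)]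

/-- Rolle step for the coordinate equal to the exhaustion function. -/
theorem aeFiberBound_of_coord_eq (D : RolleData Δ f J r) {j : Fin k}
    (hj : ∀ z ∈ Δ, f z j = r z) {B : ℕ}
    (h₁ : AEFiberBound Δ (fun z => Function.update (f z) j (J z)) B) :
    AEFiberBound Δ f (2 * B) := by
  filter_upwards [ae_exists_level h₁, ae_det_ne_zero D.hasStrictFDerivAt] with s hs1 hdet
  refine encard_le_of_forall_finite fun P hPZ hP => ?_
  have hJ : ∀ z ∈ P, J z ≠ 0 := fun z hz h =>
    hdet z (hPZ hz).1 (hPZ hz).2 ((D.jac_eq_zero z (hPZ hz).1).1 h)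
  obtain ⟨τ₀, hτ₀, hPτ⟩ := exists_pos_lt_abs hP hJ
  obtain ⟨τ, hτ, hττ, hp, hn⟩ := hs1 τ₀ hτ₀
  have hcover := encard_eq_add_of_ne_zero (J := J) fun z hz => hττ.trans_le (hPτ z hz)
  have hr : ∀ z ∈ P, s j - 1 < r z := by
    intro z hz
    rw [← hj z (hPZ hz).1, (hPZ hz).2]
    exact sub_one_lt _
  have key : ∀ ε : ℝ, {z | z ∈ Δ ∧ ε * J z = τ ∧ ∀ i, i ≠ j → f z i = s i}.encard ≤ B →
      {z | z ∈ P ∧ τ < ε * J z}.encard ≤ B := by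
    intro ε hε
    have h1 := D.encard_le j s (ε := ε) (δ := 1) (L := s j - 1) (by simp) hτ
      (P := {z | z ∈ P ∧ τ < ε * J z})
      fun z hz => ⟨(hPZ hz.1).1, (hPZ hz.1).2, hz.2, hr z hz.1⟩
    have h2 : {z | z ∈ Δ ∧ r z = s j - 1 ∧ τ ≤ ε * J z ∧ (∀ i, i ≠ j → f z i = s i) ∧
        0 < 1 * (f z j - s j)} = ∅ := by
      refine eq_empty_of_forall_notMem fun z hz => ?_
      have h := hz.2.2.2.2
      rw [hj z hz.1, hz.2.1] at h
      linarith
    rw [h2, encard_empty, add_zero] at h1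
    refine h1.trans ((encard_le_encard ?_).trans hε)
    exact fun z hz => ⟨hz.1, hz.2.1, hz.2.2.1⟩
  refine hcover.trans ((add_le_add (key 1 hp) (key (-1) hn)).trans ?_)
  push_cast
  rw [two_mul]

end RolleData

theorem totalDegree_pderiv_succ_le {σ : Type*} {p : MvPolynomial σ ℝ} {j : σ}
    (h : MvPolynomial.pderiv j p ≠ 0) :
    (MvPolynomial.pderiv j p).totalDegree + 1 ≤ p.totalDegree := by
  classical
  obtain ⟨m, hm, hdeg⟩ := Finset.exists_mem_eq_sup _ (MvPolynomial.support_nonempty.2 h)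
    fun s => s.sum fun _ e => e
  have hc : MvPolynomial.coeff (m + Finsupp.single j 1) p ≠ 0 := by
    intro h0
    rw [MvPolynomial.mem_support_iff, MvPolynomial.coeff_pderiv, h0, zero_mul] at hm
    exact hm rfl
  have h1 := MvPolynomial.le_totalDegree (MvPolynomial.mem_support_iff.2 hc)
  rw [Finsupp.sum_add_index' (fun _ => rfl) (fun _ _ _ => rfl),
    Finsupp.sum_single_index rfl] at h1
  exact (add_le_add_left hdeg.le 1).trans h1

theorem totalDegree_det_le {σ m : Type*} [Fintype m] [DecidableEq m]
    (N : Matrix m m (MvPolynomial σ ℝ)) (ρ γ : m → ℤ)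
    (h : ∀ x y, N x y ≠ 0 → ((N x y).totalDegree : ℤ) ≤ ρ x + γ y) {B : ℕ}
    (hB : ∑ x, ρ x + ∑ y, γ y ≤ B) : N.det.totalDegree ≤ B := by
  rw [Matrix.det_apply']
  refine MvPolynomial.totalDegree_finsetSum_le fun τ _ => ?_
  have hsign : ((Equiv.Perm.sign τ : ℤ) : MvPolynomial σ ℝ) =
      MvPolynomial.C ((Equiv.Perm.sign τ : ℤ) : ℝ) := by simp
  rw [hsign]
  refine (MvPolynomial.totalDegree_mul _ _).trans ?_
  rw [MvPolynomial.totalDegree_C, zero_add]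
  by_cases h0 : ∃ i, N (τ i) i = 0
  · obtain ⟨i, hi⟩ := h0
    simp [Finset.prod_eq_zero (f := fun i => N (τ i) i) (Finset.mem_univ i) hi]
  · push Not at h0
    refine (MvPolynomial.totalDegree_finsetProd _ _).trans ?_
    have h1 : ∑ i, ((N (τ i) i).totalDegree : ℤ) ≤ ∑ i, (ρ (τ i) + γ i) :=
      Finset.sum_le_sum fun i _ => h _ _ (h0 i)
    rw [Finset.sum_add_distrib, Equiv.sum_comp τ ρ] at h1
    exact_mod_cast h1.trans hB

theorem hasStrictFDerivAt_eval {k : ℕ} (p : MvPolynomial (Fin k) ℝ) (z : Fin k → ℝ) :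
    HasStrictFDerivAt (fun z => MvPolynomial.eval z p)
      (∑ j, MvPolynomial.eval z (MvPolynomial.pderiv j p) •
        (ContinuousLinearMap.proj j : (Fin k → ℝ) →L[ℝ] ℝ)) z := by
  induction p using MvPolynomial.induction_on with
  | C a => simpa using hasStrictFDerivAt_const a z
  | add p q hp hq =>
    simp only [map_add, add_smul, Finset.sum_add_distrib]
    exact hp.add hq
  | mul_X p i hp =>
    have hX : HasStrictFDerivAt (fun z : Fin k → ℝ => z i)
        (ContinuousLinearMap.proj i : (Fin k → ℝ) →L[ℝ] ℝ) z :=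
      (ContinuousLinearMap.proj i : (Fin k → ℝ) →L[ℝ] ℝ).hasStrictFDerivAt
    simp only [map_mul, MvPolynomial.eval_X]
    refine (hp.mul hX).congr_fderiv ?_
    ext v
    simp [MvPolynomial.pderiv_X, Pi.single_apply, add_mul,
      Finset.sum_add_distrib, apply_ite (MvPolynomial.eval z), Finset.mul_sum]
    exact Finset.sum_congr rfl fun j _ => by ring

section Mixed

variable {k : ℕ} {A : Type*} [Fintype A]

/-- A map whose coordinates in `S` are combinations of logarithms of the forms `q`, and whose
other coordinates are the polynomials `G`. -/
noncomputable def mixedMap (q : A → MvPolynomial (Fin k) ℝ) (S : Finset (Fin k))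
    (b : Fin k → A → ℝ) (G : Fin k → MvPolynomial (Fin k) ℝ) (z : Fin k → ℝ) : Fin k → ℝ :=
  fun i => if i ∈ S then ∑ a, b i a * Real.log (MvPolynomial.eval z (q a))
    else MvPolynomial.eval z (G i)

/-- The Jacobian matrix of `mixedMap`. -/
noncomputable def mixedMatrix (q : A → MvPolynomial (Fin k) ℝ) (S : Finset (Fin k))
    (b : Fin k → A → ℝ) (G : Fin k → MvPolynomial (Fin k) ℝ) (z : Fin k → ℝ) :
    Matrix (Fin k) (Fin k) ℝ :=
  Matrix.of fun i j =>
    if i ∈ S then ∑ a, b i a * ((MvPolynomial.eval z (q a))⁻¹ *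
      MvPolynomial.eval z (MvPolynomial.pderiv j (q a)))
    else MvPolynomial.eval z (MvPolynomial.pderiv j (G i))

theorem hasStrictFDerivAt_mixedMap (q : A → MvPolynomial (Fin k) ℝ) (S : Finset (Fin k))
    (b : Fin k → A → ℝ) (G : Fin k → MvPolynomial (Fin k) ℝ) {z : Fin k → ℝ}
    (hz : ∀ a, 0 < MvPolynomial.eval z (q a)) :
    HasStrictFDerivAt (mixedMap q S b G)
      (LinearMap.toContinuousLinearMap (Matrix.toLin' (mixedMatrix q S b G z))) z := by
  rw [hasStrictFDerivAt_pi']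
  intro i
  by_cases hi : i ∈ S
  · have h : HasStrictFDerivAt (fun z => ∑ a, b i a * Real.log (MvPolynomial.eval z (q a)))
        (∑ a, b i a • ((MvPolynomial.eval z (q a))⁻¹ •
          ∑ j, MvPolynomial.eval z (MvPolynomial.pderiv j (q a)) •
            (ContinuousLinearMap.proj j : (Fin k → ℝ) →L[ℝ] ℝ))) z :=
      HasStrictFDerivAt.fun_sum fun a _ =>
        ((hasStrictFDerivAt_eval (q a) z).log (hz a).ne').const_mul (b i a)
    have hfun : (fun z => mixedMap q S b G z i) =
        fun z => ∑ a, b i a * Real.log (MvPolynomial.eval z (q a)) := by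
      funext z
      simp [mixedMap, hi]
    rw [hfun]
    refine h.congr_fderiv ?_
    · ext v
      simp [mixedMatrix, hi, Matrix.mulVec, dotProduct, Finset.sum_mul, Finset.mul_sum]
      rw [Finset.sum_comm]
      exact Finset.sum_congr rfl fun a _ => Finset.sum_congr rfl fun j _ => by ring
  · have hfun : (fun z => mixedMap q S b G z i) = fun z => MvPolynomial.eval z (G i) := by
      funext z
      simp [mixedMap, hi]
    rw [hfun]
    refine (hasStrictFDerivAt_eval (G i) z).congr_fderiv ?_
    · ext v
      simp [mixedMatrix, hi, Matrix.mulVec, dotProduct]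

/-- A polynomial proportional to the Jacobian determinant of `mixedMap`, as a bordered
determinant. -/
noncomputable def mixedJac [DecidableEq A] (q : A → MvPolynomial (Fin k) ℝ) (S : Finset (Fin k))
    (b : Fin k → A → ℝ) (G : Fin k → MvPolynomial (Fin k) ℝ) : MvPolynomial (Fin k) ℝ :=
  (Matrix.fromBlocks (Matrix.diagonal q) (Matrix.of fun a j => MvPolynomial.pderiv j (q a))
    (Matrix.of fun i a => if i ∈ S then MvPolynomial.C (-b i a) else 0)
    (Matrix.of fun i j => if i ∈ S then 0 else MvPolynomial.pderiv j (G i))).det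

theorem eval_mixedJac [DecidableEq A] (q : A → MvPolynomial (Fin k) ℝ) (S : Finset (Fin k))
    (b : Fin k → A → ℝ) (G : Fin k → MvPolynomial (Fin k) ℝ) {z : Fin k → ℝ}
    (hz : ∀ a, 0 < MvPolynomial.eval z (q a)) :
    MvPolynomial.eval z (mixedJac q S b G) =
      (∏ a, MvPolynomial.eval z (q a)) * (mixedMatrix q S b G z).det := by
  have hu : IsUnit (fun a => MvPolynomial.eval z (q a)) :=
    Pi.isUnit_iff.2 fun a => (hz a).ne'.isUnit
  have : Invertible (Matrix.diagonal fun a => MvPolynomial.eval z (q a)) :=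
    (Matrix.isUnit_diagonal.2 hu).invertible
  rw [mixedJac, RingHom.map_det, RingHom.mapMatrix_apply, Matrix.fromBlocks_map,
    Matrix.diagonal_map (map_zero _)]
  rw [Matrix.det_fromBlocks₁₁, Matrix.det_diagonal, Matrix.invOf_eq_nonsing_inv,
    Matrix.inv_diagonal]
  congr 2
  ext i j
  have hinv : Ring.inverse (fun a => MvPolynomial.eval z (q a)) =
      fun a => (MvPolynomial.eval z (q a))⁻¹ := by
    rw [Ring.inverse_of_isUnit hu]
    funext a
    refine eq_inv_of_mul_eq_one_left ?_
    exact congrFun hu.val_inv_mul a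
  rw [hinv]
  by_cases hi : i ∈ S
  · simp [mixedMatrix, hi, Matrix.mul_apply, Matrix.diagonal_apply, mul_assoc]
  · simp [mixedMatrix, hi, Matrix.mul_apply]

theorem totalDegree_mixedJac_le [DecidableEq A] {q : A → MvPolynomial (Fin k) ℝ}
    (hq : ∀ a, (q a).totalDegree ≤ 1) {S : Finset (Fin k)} (b : Fin k → A → ℝ)
    {G : Fin k → MvPolynomial (Fin k) ℝ} {d : Fin k → ℕ} (hd : ∀ i, (G i).totalDegree ≤ d i)
    {c : ℕ} (hc : Fintype.card A = k + c) :
    (mixedJac q S b G).totalDegree ≤ c + ∑ i ∈ Sᶜ, d i := by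
  refine totalDegree_det_le _ (Sum.elim (fun _ => 1) fun i => if i ∈ S then 0 else (d i : ℤ))
    (Sum.elim (fun _ => 0) fun _ => -1) ?_ ?_
  · rintro (a | i) (a' | j)
    · simp only [Matrix.fromBlocks_apply₁₁, Matrix.diagonal_apply, Sum.elim_inl]
      split_ifs
      · intro _; exact_mod_cast hq a
      · simp
    · simp only [Matrix.fromBlocks_apply₁₂, Matrix.of_apply, Sum.elim_inl, Sum.elim_inr]
      intro h
      have := totalDegree_pderiv_succ_le h
      have := hq a
      omega
    · simp only [Matrix.fromBlocks_apply₂₁, Matrix.of_apply, Sum.elim_inl, Sum.elim_inr]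
      split_ifs
      · simp
      · simp
    · simp only [Matrix.fromBlocks_apply₂₂, Matrix.of_apply, Sum.elim_inr]
      split_ifs
      · simp
      · intro h
        have := totalDegree_pderiv_succ_le h
        have := hd i
        omega
  · rw [Fintype.sum_sum_type, Fintype.sum_sum_type]
    simp only [Sum.elim_inl, Sum.elim_inr, Finset.sum_const, Finset.card_univ, hc,
      Fintype.card_fin, Finset.sum_ite]
    have : Finset.univ.filter (fun i => i ∉ S) = Sᶜ := by ext; simp
    rw [this]
    push_cast
    simp
    linarith

theorem continuousOn_sum_log {q : A → MvPolynomial (Fin k) ℝ} {Δ : Set (Fin k → ℝ)}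
    (hpos : ∀ z ∈ Δ, ∀ a, 0 < MvPolynomial.eval z (q a)) (ρ : A → ℝ) :
    ContinuousOn (fun z => ∑ a, ρ a * Real.log (MvPolynomial.eval z (q a))) Δ :=
  continuousOn_finsetSum _ fun a _ => continuousOn_const.mul
    ((MvPolynomial.continuous_eval (q a)).continuousOn.log fun z hz => (hpos z hz a).ne')

/-- The Rolle data of a mixed map. -/
noncomputable def mixedRolleData [DecidableEq A] (q : A → MvPolynomial (Fin k) ℝ)
    (S : Finset (Fin k)) (b : Fin k → A → ℝ) (G : Fin k → MvPolynomial (Fin k) ℝ)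
    {Δ : Set (Fin k → ℝ)} (hΔ : IsOpen Δ) (hpos : ∀ z ∈ Δ, ∀ a, 0 < MvPolynomial.eval z (q a))
    {r : (Fin k → ℝ) → ℝ} (hr : ContinuousOn r Δ) (hK : ∀ L, IsCompact {z | z ∈ Δ ∧ L ≤ r z}) :
    RolleData Δ (mixedMap q S b G) (fun z => MvPolynomial.eval z (mixedJac q S b G)) r where
  isOpen := hΔ
  deriv z := LinearMap.toContinuousLinearMap (Matrix.toLin' (mixedMatrix q S b G z))
  hasStrictFDerivAt z hz := hasStrictFDerivAt_mixedMap q S b G (hpos z hz)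
  continuousOn_jac := (MvPolynomial.continuous_eval _).continuousOn
  jac_eq_zero z hz := by
    rw [eval_mixedJac q S b G (hpos z hz), mul_eq_zero,
      or_iff_right (Finset.prod_ne_zero_iff.2 fun a _ => (hpos z hz a).ne')]
    rw [ContinuousLinearMap.det, LinearMap.coe_toContinuousLinearMap, LinearMap.det_toLin']
  continuousOn_exhaust := hr
  isCompact := hK

theorem update_mixedMap_poly (q : A → MvPolynomial (Fin k) ℝ) (S : Finset (Fin k))
    (b : Fin k → A → ℝ) (G : Fin k → MvPolynomial (Fin k) ℝ) (j : Fin k)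
    (Γ : MvPolynomial (Fin k) ℝ) (z : Fin k → ℝ) :
    Function.update (mixedMap q S b G z) j (MvPolynomial.eval z Γ) =
      mixedMap q (S.erase j) b (Function.update G j Γ) z := by
  funext i
  by_cases hi : i = j
  · subst hi; simp [mixedMap]
  · simp [mixedMap, hi]

theorem update_mixedMap_log (q : A → MvPolynomial (Fin k) ℝ) {S : Finset (Fin k)}
    (b : Fin k → A → ℝ) (G : Fin k → MvPolynomial (Fin k) ℝ) {j : Fin k} (hj : j ∈ S)
    (ρ : A → ℝ) (z : Fin k → ℝ) :
    Function.update (mixedMap q S b G z) j (∑ a, ρ a * Real.log (MvPolynomial.eval z (q a))) =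
      mixedMap q S (Function.update b j ρ) G z := by
  funext i
  by_cases hi : i = j
  · subst hi; simp [mixedMap, hj]
  · simp [mixedMap, hi]

theorem sum_update_compl_erase {S : Finset (Fin k)} {j : Fin k} (hj : j ∈ S) (d : Fin k → ℕ)
    (e : ℕ) : ∑ i ∈ (S.erase j)ᶜ, Function.update d j e i = e + ∑ i ∈ Sᶜ, d i := by
  rw [Finset.compl_erase, Finset.sum_insert (by simp [hj]), Function.update_self,
    Finset.sum_update_of_notMem (by simp [hj])]

theorem prod_update_compl_erase {S : Finset (Fin k)} {j : Fin k} (hj : j ∈ S) (d : Fin k → ℕ)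
    (e : ℕ) : ∏ i ∈ (S.erase j)ᶜ, Function.update d j e i = e * ∏ i ∈ Sᶜ, d i := by
  rw [Finset.compl_erase, Finset.prod_insert (by simp [hj]), Function.update_self,
    Finset.prod_update_of_notMem (by simp [hj])]

theorem totalDegree_update_le {G : Fin k → MvPolynomial (Fin k) ℝ} {d : Fin k → ℕ}
    (hd : ∀ i, (G i).totalDegree ≤ d i) (j : Fin k) {Γ : MvPolynomial (Fin k) ℝ} {e : ℕ}
    (hΓ : Γ.totalDegree ≤ e) (i : Fin k) :
    (Function.update G j Γ i).totalDegree ≤ Function.update d j e i := by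
  by_cases hi : i = j
  · subst hi; simpa using hΓ
  · simpa [hi] using hd i

/-- Bézout's bound for almost every fibre of a polynomial map. -/
theorem aeFiberBound_polynomial (q : A → MvPolynomial (Fin k) ℝ) (b : Fin k → A → ℝ)
    (Δ : Set (Fin k → ℝ)) {G : Fin k → MvPolynomial (Fin k) ℝ} {d : Fin k → ℕ}
    (hd : ∀ i, (G i).totalDegree ≤ d i) :
    AEFiberBound Δ (mixedMap q ∅ b G) (∏ i, d i) := by
  let A₀ : Fin 0 → MvPolynomial (Fin k) ℝ := Fin.elim0
  have hf : mixedMap q ∅ b G = mixedMap A₀ ∅ (fun _ => Fin.elim0) G := by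
    funext z i
    simp [mixedMap]
  rw [hf]
  have h := ae_det_ne_zero (Δ := Δ) (fun z _ =>
    hasStrictFDerivAt_mixedMap A₀ ∅ (fun _ => Fin.elim0) G (z := z) fun a => a.elim0)
  filter_upwards [h] with s hs
  refine RolleData.encard_le_of_forall_finite fun P hP hPf => ?_
  have hle : hPf.toFinset.card ≤ ∏ i, d i := by
    refine card_nondegenerate_zeros_le (fun i => G i - MvPolynomial.C (s i)) d
      (fun i => ?_) _ fun z hz => ⟨fun i => ?_, ?_⟩
    · exact (MvPolynomial.totalDegree_sub_C_le _ _).trans (hd i)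
    · have := congrFun (hP (hPf.mem_toFinset.1 hz)).2 i
      simp only [mixedMap, Finset.notMem_empty, if_false] at this
      simp [this]
    · have := hs z (hP (hPf.mem_toFinset.1 hz)).1 (hP (hPf.mem_toFinset.1 hz)).2
      rw [ContinuousLinearMap.det, LinearMap.coe_toContinuousLinearMap, LinearMap.det_toLin'] at this
      convert this using 3
      ext i j
      simp [mixedMatrix]
  rw [hPf.encard_eq_coe_toFinset_card]
  exact_mod_cast hle

section Chain

variable [DecidableEq A] {q : A → MvPolynomial (Fin k) ℝ} {Δ : Set (Fin k → ℝ)} {ρ : A → ℝ} {c : ℕ}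

theorem aeFiberBound_mixedMap_of_exhaust (hq : ∀ a, (q a).totalDegree ≤ 1) (hΔ : IsOpen Δ)
    (hpos : ∀ z ∈ Δ, ∀ a, 0 < MvPolynomial.eval z (q a))
    (hK : ∀ L, IsCompact {z | z ∈ Δ ∧ L ≤ ∑ a, ρ a * Real.log (MvPolynomial.eval z (q a))})
    (hc : Fintype.card A = k + c) (s : ℕ) :
    ∀ (S : Finset (Fin k)) (b : Fin k → A → ℝ) (G : Fin k → MvPolynomial (Fin k) ℝ)
      (d : Fin k → ℕ), S.card = s + 1 → (∀ i, (G i).totalDegree ≤ d i) →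
      ∀ i₀ ∈ S, b i₀ = ρ → AEFiberBound Δ (mixedMap q S b G)
        (2 * (∏ i ∈ Sᶜ, d i) * (c + ∑ i ∈ Sᶜ, d i) ^ (s + 1) * 2 ^ (s + 1).choose 2) := by
  induction s with
  | zero =>
    intro S b G d hS hd i₀ hi₀ hb
    have D := mixedRolleData q S b G hΔ hpos (continuousOn_sum_log hpos ρ) hK
    have hS' : S.erase i₀ = ∅ := by
      rw [← Finset.card_eq_zero, Finset.card_erase_of_mem hi₀, hS]
    have hΓ := totalDegree_mixedJac_le hq b (S := S) hd hc
    have h1 := aeFiberBound_polynomial q b Δ (totalDegree_update_le hd i₀ hΓ)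
    have h2 := D.aeFiberBound_of_coord_eq (j := i₀) (B := _) (fun z _ => by
      simp [mixedMap, hi₀, hb]) (by
        simp only [update_mixedMap_poly]
        rw [hS']
        exact h1)
    convert h2 using 1
    have := prod_update_compl_erase hi₀ d (c + ∑ i ∈ Sᶜ, d i)
    rw [hS', Finset.compl_empty] at this
    rw [this]
    simp
    ring
  | succ s ih =>
    intro S b G d hS hd i₀ hi₀ hb
    have D := mixedRolleData q S b G hΔ hpos (continuousOn_sum_log hpos ρ) hK
    obtain ⟨j, hj, hji⟩ := S.exists_mem_ne (by omega) i₀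
    have hΓ := totalDegree_mixedJac_le hq b (S := S) hd hc
    have h1 := ih (S.erase j) b _ _ (by rw [Finset.card_erase_of_mem hj, hS]; rfl)
      (totalDegree_update_le hd j hΓ) i₀ (Finset.mem_erase.2 ⟨hji.symm, hi₀⟩) hb
    have h2 := D.aeFiberBound_of_coord_ne hji.symm (fun z _ => by
      simp [mixedMap, hi₀, hb]) (by
        simp only [update_mixedMap_poly]
        exact h1)
    convert h2 using 1
    rw [prod_update_compl_erase hj, sum_update_compl_erase hj,
      show (s + 1 + 1).choose 2 = (s + 1) + (s + 1).choose 2 by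
        rw [Nat.choose_succ_succ' (s + 1) 1, Nat.choose_one_right]]
    rw [show c + (c + ∑ i ∈ Sᶜ, d i + ∑ i ∈ Sᶜ, d i) = 2 * (c + ∑ i ∈ Sᶜ, d i) by ring, mul_pow]
    ring

theorem aeFiberBound_mixedMap (hq : ∀ a, (q a).totalDegree ≤ 1) (hΔ : IsOpen Δ)
    (hpos : ∀ z ∈ Δ, ∀ a, 0 < MvPolynomial.eval z (q a))
    (hK : ∀ L, IsCompact {z | z ∈ Δ ∧ L ≤ ∑ a, ρ a * Real.log (MvPolynomial.eval z (q a))})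
    (hc : Fintype.card A = k + c) (s : ℕ) :
    ∀ (S : Finset (Fin k)) (b : Fin k → A → ℝ) (G : Fin k → MvPolynomial (Fin k) ℝ)
      (d : Fin k → ℕ), S.card = s → (∀ i, (G i).totalDegree ≤ d i) →
      AEFiberBound Δ (mixedMap q S b G)
        ((s + 1) * (∏ i ∈ Sᶜ, d i) * (c + ∑ i ∈ Sᶜ, d i) ^ s * 2 ^ s.choose 2) := by
  induction s with
  | zero =>
    intro S b G d hS hd
    obtain rfl := Finset.card_eq_zero.1 hS
    simpa using aeFiberBound_polynomial q b Δ hd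
  | succ s ih =>
    intro S b G d hS hd
    have D := mixedRolleData q S b G hΔ hpos (continuousOn_sum_log hpos ρ) hK
    obtain ⟨j, hj⟩ := Finset.card_pos.1 (show 0 < S.card by omega)
    have hΓ := totalDegree_mixedJac_le hq b (S := S) hd hc
    have h1 := ih (S.erase j) b _ _ (by rw [Finset.card_erase_of_mem hj, hS]; rfl)
      (totalDegree_update_le hd j hΓ)
    have h2 := aeFiberBound_mixedMap_of_exhaust hq hΔ hpos hK hc s S (Function.update b j ρ) G d
      hS hd j hj (Function.update_self _ _ _)
    refine D.aeFiberBound_of_update j (by simp only [update_mixedMap_poly]; exact h1)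
      (by simp only [update_mixedMap_log q b G hj]; exact h2) (le_of_eq ?_)
    rw [prod_update_compl_erase hj, sum_update_compl_erase hj,
      show (s + 1).choose 2 = s + s.choose 2 by
        rw [Nat.choose_succ_succ' s 1, Nat.choose_one_right]]
    rw [show c + (c + ∑ i ∈ Sᶜ, d i + ∑ i ∈ Sᶜ, d i) = 2 * (c + ∑ i ∈ Sᶜ, d i) by ring, mul_pow]
    ring

/-- Fibre bound for a logarithmic map all of whose coordinates but the first only involve the
forms `q`, the first one involving the larger family `q'`. -/
theorem aeFiberBound_log {k n : ℕ} {A A' : Type*} [Fintype A] [DecidableEq A] [Fintype A']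
    [DecidableEq A'] {q : A → MvPolynomial (Fin (k + 1)) ℝ} {q' : A' → MvPolynomial (Fin (k + 1)) ℝ}
    {Δ : Set (Fin (k + 1) → ℝ)} {ρ : A → ℝ}
    (hq : ∀ a, (q a).totalDegree ≤ 1) (hq' : ∀ a, (q' a).totalDegree ≤ 1) (hΔ : IsOpen Δ)
    (hpos : ∀ z ∈ Δ, ∀ a, 0 < MvPolynomial.eval z (q a))
    (hpos' : ∀ z ∈ Δ, ∀ a, 0 < MvPolynomial.eval z (q' a))
    (hK : ∀ L, IsCompact {z | z ∈ Δ ∧ L ≤ ∑ a, ρ a * Real.log (MvPolynomial.eval z (q a))})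
    (hc : Fintype.card A = k + 1 + (n + 1)) (hc' : Fintype.card A' = k + 1 + (n + 2))
    (b : Fin (k + 1) → A → ℝ) (b' : Fin (k + 1) → A' → ℝ)
    (hb : ∀ i, i ≠ 0 → ∀ z, ∑ a, b' i a * Real.log (MvPolynomial.eval z (q' a)) =
      ∑ a, b i a * Real.log (MvPolynomial.eval z (q a))) :
    AEFiberBound Δ (fun z i => ∑ a, b' i a * Real.log (MvPolynomial.eval z (q' a)))
      ((k + 1) * (n + 2) * (2 * n + 3) ^ k * 2 ^ k.choose 2 +
        (n + 1) ^ (k + 1) * 2 ^ (k + 1).choose 2) := by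
  have hf : (fun z i => ∑ a, b' i a * Real.log (MvPolynomial.eval z (q' a))) =
      mixedMap q' Finset.univ b' 0 := by
    funext z i
    simp [mixedMap]
  rw [hf]
  have D := mixedRolleData q' Finset.univ b' 0 hΔ hpos' (continuousOn_sum_log hpos ρ) hK
  have hd0 : ∀ i : Fin (k + 1), ((0 : Fin (k + 1) → MvPolynomial (Fin (k + 1)) ℝ) i).totalDegree ≤
      (0 : Fin (k + 1) → ℕ) i := by simp
  have hΓ := totalDegree_mixedJac_le hq' b' (S := Finset.univ) hd0 hc'
  have hU : (Finset.univ.erase (0 : Fin (k + 1))).card = k := by simp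
  have h1 := aeFiberBound_mixedMap hq hΔ hpos hK hc k (Finset.univ.erase 0) b _ _ hU
    (totalDegree_update_le hd0 0 hΓ)
  have h2 := aeFiberBound_mixedMap_of_exhaust hq hΔ hpos hK hc k Finset.univ
    (Function.update b 0 ρ) 0 0 (by simp) hd0 0 (Finset.mem_univ _) (Function.update_self _ _ _)
  have e1 : ∀ z, Function.update (mixedMap q' Finset.univ b' 0 z) 0
      (MvPolynomial.eval z (mixedJac q' Finset.univ b' 0)) =
      mixedMap q (Finset.univ.erase 0) b
        (Function.update 0 0 (mixedJac q' Finset.univ b' 0)) z := by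
    intro z
    funext i
    by_cases hi : i = 0
    · subst hi; simp [mixedMap]
    · simpa [mixedMap, hi] using hb i hi z
  have e2 : ∀ z, Function.update (mixedMap q' Finset.univ b' 0 z) 0
      (∑ a, ρ a * Real.log (MvPolynomial.eval z (q a))) =
      mixedMap q Finset.univ (Function.update b 0 ρ) 0 z := by
    intro z
    funext i
    by_cases hi : i = 0
    · subst hi; simp [mixedMap]
    · simpa [mixedMap, hi] using hb i hi z
  refine D.aeFiberBound_of_update 0 (by simp only [e1]; exact h1)
    (by simp only [e2]; exact h2) (le_of_eq ?_)
  rw [prod_update_compl_erase (Finset.mem_univ _), sum_update_compl_erase (Finset.mem_univ _)]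
  simp only [Finset.compl_univ, Finset.sum_empty, Finset.prod_empty, Pi.zero_apply]
  ring

end Chain

end Mixed

/-- The affine form with linear part `v` and constant term `c`, as a polynomial. -/
noncomputable def affineForm {k : ℕ} (v : Fin k → ℝ) (c : ℝ) : MvPolynomial (Fin k) ℝ :=
  ∑ l, MvPolynomial.C (v l) * MvPolynomial.X l + MvPolynomial.C c

theorem eval_affineForm {k : ℕ} (v : Fin k → ℝ) (c : ℝ) (z : Fin k → ℝ) :
    MvPolynomial.eval z (affineForm v c) = ∑ l, v l * z l + c := by
  simp [affineForm]

theorem totalDegree_affineForm_le {k : ℕ} (v : Fin k → ℝ) (c : ℝ) :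
    (affineForm v c).totalDegree ≤ 1 := by
  refine (MvPolynomial.totalDegree_add _ _).trans (max_le ?_ (by simp))
  refine MvPolynomial.totalDegree_finsetSum_le fun l _ => ?_
  refine (MvPolynomial.totalDegree_mul _ _).trans ?_
  simp

/-- The affine parametrisation of the Gale dual chart normalised at the coordinate `i₀`. -/
noncomputable def galeForm {ι : Type*} {k : ℕ} (s t : ι → ℝ) (i₀ : ι) (b : Fin k → ι → ℝ)
    (i : ι) : MvPolynomial (Fin k) ℝ :=
  affineForm (fun l => s i * (b l i - b l i₀ / t i₀ * t i)) (s i * (s i₀ / t i₀ * t i))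

theorem eval_galeForm {ι : Type*} {k : ℕ} (s t : ι → ℝ) (i₀ : ι) (b : Fin k → ι → ℝ)
    (i : ι) (z : Fin k → ℝ) :
    MvPolynomial.eval z (galeForm s t i₀ b i) =
      s i * (∑ l, z l * b l i + (s i₀ - ∑ l, z l * b l i₀) / t i₀ * t i) := by
  have h : (s i₀ - ∑ l, z l * b l i₀) / t i₀ * t i =
      s i₀ / t i₀ * t i - ∑ l, z l * (b l i₀ / t i₀ * t i) := by
    rw [sub_div, sub_mul, Finset.sum_div, Finset.sum_mul]
    congr 1
    exact Finset.sum_congr rfl fun l _ => by ring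
  rw [galeForm, eval_affineForm, h, add_sub, mul_sub, mul_add, Finset.mul_sum, Finset.mul_sum]
  have h2 : ∑ l, s i * (b l i - b l i₀ / t i₀ * t i) * z l =
      ∑ l, s i * (z l * b l i) - ∑ l, s i * (z l * (b l i₀ / t i₀ * t i)) := by
    rw [← Finset.sum_sub_distrib]
    exact Finset.sum_congr rfl fun l _ => by ring
  rw [h2]
  ring

theorem eval_galeForm_self {ι : Type*} {k : ℕ} {s t : ι → ℝ} {i₀ : ι} (b : Fin k → ι → ℝ)
    (hs : s i₀ * s i₀ = 1) (ht : t i₀ ≠ 0) (z : Fin k → ℝ) :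
    MvPolynomial.eval z (galeForm s t i₀ b i₀) = 1 := by
  rw [eval_galeForm, div_mul_cancel₀ _ ht]
  linear_combination hs

theorem isCompact_galeForm_mem_Icc {ι : Type*} [Fintype ι] {k : ℕ} {s t : ι → ℝ} {i₀ : ι}
    {b : Fin k → ι → ℝ} (hs : ∀ i, s i * s i = 1) (ht : ∑ i, t i = 1)
    (hb : LinearIndependent ℝ b) (hb0 : ∀ l, ∑ i, b l i = 0) (l u : ℝ) :
    IsCompact {z : Fin k → ℝ | ∀ i, MvPolynomial.eval z (galeForm s t i₀ b i) ∈ Icc l u} := by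
  let f : (Fin k → ℝ) →ₗ[ℝ] (ι → ℝ) :=
    { toFun := fun z i => ∑ j, s i * (b j i - b j i₀ / t i₀ * t i) * z j
      map_add' := fun x y => by
        ext i; simp [mul_add, Finset.sum_add_distrib]
      map_smul' := fun r x => by
        ext i
        simp only [Pi.smul_apply, smul_eq_mul, RingHom.id_apply, Finset.mul_sum]
        exact Finset.sum_congr rfl fun l _ => by ring }
  have hf : LinearMap.ker f = ⊥ := by
    rw [LinearMap.ker_eq_bot']
    intro z hz
    have h1 : ∀ i, ∑ j, z j * b j i = (∑ j, z j * b j i₀ / t i₀) * t i := by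
      intro i
      have h := congrFun hz i
      simp only [f, LinearMap.coe_mk, AddHom.coe_mk, Pi.zero_apply] at h
      have h3 : ∑ j, s i * (b j i - b j i₀ / t i₀ * t i) * z j =
          s i * (∑ j, z j * b j i - (∑ j, z j * b j i₀ / t i₀) * t i) := by
        rw [Finset.sum_mul, ← Finset.sum_sub_distrib, Finset.mul_sum]
        exact Finset.sum_congr rfl fun l _ => by ring
      rw [h3] at h
      rcases mul_eq_zero.1 h with h | h
      · have := hs i
        rw [h] at this
        norm_num at this
      · linarith
    have h2 : ∑ j, z j * b j i₀ / t i₀ = 0 := by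
      have h := Finset.sum_congr (rfl : (Finset.univ : Finset ι) = _) fun i _ => h1 i
      rw [← Finset.mul_sum, ht, mul_one, Finset.sum_comm] at h
      rw [← h]
      refine Finset.sum_eq_zero fun l _ => ?_
      rw [← Finset.mul_sum, hb0, mul_zero]
    rw [Fintype.linearIndependent_iff] at hb
    ext l
    refine hb z ?_ l
    ext i
    simp [h1 i, h2]
  have hemb := LinearMap.isClosedEmbedding_of_injective hf
  have hcpt : IsCompact (Set.pi univ fun i => Icc (l - s i * (s i₀ / t i₀ * t i))
      (u - s i * (s i₀ / t i₀ * t i))) := isCompact_univ_pi fun i => isCompact_Icc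
  refine (hemb.isCompact_preimage hcpt).of_isClosed_subset ?_ ?_
  · simp only [ofPred_forall]
    exact isClosed_iInter fun i => isClosed_Icc.preimage (MvPolynomial.continuous_eval _)
  · intro z hz i _
    have h := hz i
    rw [galeForm, eval_affineForm] at h
    change ∑ j, s i * (b j i - b j i₀ / t i₀ * t i) * z j ∈ _
    exact ⟨by linarith [h.1], by linarith [h.2]⟩

theorem isCompact_log_superlevel {ι : Type*} [Fintype ι] [DecidableEq ι] {k : ℕ} {s t : ι → ℝ}
    {i₀ : ι} {b : Fin k → ι → ℝ} (hs : ∀ i, s i * s i = 1) (ht0 : t i₀ ≠ 0) (ht : ∑ i, t i = 1)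
    (hb : LinearIndependent ℝ b) (hb0 : ∀ l, ∑ i, b l i = 0) (L : ℝ) :
    IsCompact {z : Fin k → ℝ | (∀ i, 0 < MvPolynomial.eval z (galeForm s t i₀ b i)) ∧
      L ≤ ∑ i, (Real.log (MvPolynomial.eval z (galeForm s t i₀ b i)) -
        Real.log (∑ j, MvPolynomial.eval z (galeForm s t i₀ b j)))} := by
  set p : ι → (Fin k → ℝ) → ℝ := fun i z => MvPolynomial.eval z (galeForm s t i₀ b i) with hp
  have hpc : ∀ i, Continuous (p i) := fun i => MvPolynomial.continuous_eval _
  have hp0 : ∀ z, p i₀ z = 1 := fun z => eval_galeForm_self b (hs i₀) ht0 z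
  have hC := isCompact_galeForm_mem_Icc (i₀ := i₀) hs ht hb hb0 (Real.exp L) (Real.exp (-L))
  have hcont : ContinuousOn (fun z => ∑ i, (Real.log (p i z) - Real.log (∑ j, p j z)))
      {z | ∀ i, p i z ∈ Icc (Real.exp L) (Real.exp (-L))} := by
    refine continuousOn_finsetSum _ fun i _ => ContinuousOn.sub ?_ ?_
    · exact (hpc i).continuousOn.log fun z hz => ((Real.exp_pos _).trans_le (hz i).1).ne'
    · refine (continuous_finsetSum _ fun j _ => hpc j).continuousOn.log fun z hz => ?_
      exact (Finset.sum_pos (fun j _ => (Real.exp_pos _).trans_le (hz j).1)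
        ⟨i, Finset.mem_univ i⟩).ne'
  have hcl := hcont.preimage_isClosed_of_isClosed hC.isClosed (isClosed_Ici (a := L))
  convert hC.of_isClosed_subset hcl inter_subset_left using 1
  ext z
  constructor
  · rintro ⟨hpos, hL⟩
    refine ⟨fun i => ?_, hL⟩
    have hle : ∀ i, p i z ≤ ∑ j, p j z := fun i =>
      Finset.single_le_sum (f := fun j => p j z) (fun j _ => (hpos j).le) (Finset.mem_univ i)
    have hlog : ∀ i, Real.log (p i z) - Real.log (∑ j, p j z) ≤ 0 := fun i =>
      sub_nonpos.2 (Real.log_le_log (hpos i) (hle i))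
    have hge : ∀ i, L ≤ Real.log (p i z) - Real.log (∑ j, p j z) := fun i => by
      refine hL.trans ?_
      rw [← Finset.add_sum_erase _ _ (Finset.mem_univ i)]
      have := Finset.sum_nonpos (s := Finset.univ.erase i) fun j _ => hlog j
      linarith
    have h1 : 1 ≤ ∑ j, p j z := (hp0 z).symm.le.trans (hle i₀)
    have h2 := hge i₀
    rw [hp0 z, Real.log_one, zero_sub] at h2
    have h3 := hge i
    have h4 := hlog i
    have h5 := Real.log_nonneg h1
    have h6 : 0 < p i z := hpos i
    rw [← Real.exp_log h6]
    exact ⟨Real.exp_le_exp.2 (by linarith), Real.exp_le_exp.2 (by linarith)⟩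
  · rintro ⟨hz, hL⟩
    exact ⟨fun i => (Real.exp_pos _).trans_le (hz i).1, hL⟩

/-- The explicit bound for the number of solutions of a generic Gale dual system. -/
def galeBound (n : ℕ) : ℕ → ℕ
  | 0 => 1
  | k + 1 => (k + 1) * (n + 2) * (2 * n + 3) ^ k * 2 ^ k.choose 2 +
      (n + 1) ^ (k + 1) * 2 ^ (k + 1).choose 2

theorem aeFiberBound_gale {ι : Type*} [Fintype ι] [DecidableEq ι] {n k : ℕ} {s t : ι → ℝ}
    {i₀ ip im : ι} {b : Fin (k + 1) → ι → ℝ} (hcard : Fintype.card ι = n + (k + 1) + 1)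
    (hs : ∀ i, s i * s i = 1) (hip : s ip = 1) (him : s im = -1)
    (ht0 : t i₀ ≠ 0) (ht : ∑ i, t i = 1)
    (hb : LinearIndependent ℝ b) (hb0 : ∀ l, ∑ i, b l i = 0)
    (hβ : ∀ l, l ≠ 0 → ∑ i with s i = 1, b l i = 0) :
    AEFiberBound {z | ∀ i, 0 < MvPolynomial.eval z (galeForm s t i₀ b i)}
      (fun z l => ∑ i, b l i * Real.log (MvPolynomial.eval z (galeForm s t i₀ b i)) -
        (∑ i with s i = 1, b l i) *
          (Real.log (∑ i with s i = 1, MvPolynomial.eval z (galeForm s t i₀ b i)) -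
            Real.log (∑ i with s i = -1, MvPolynomial.eval z (galeForm s t i₀ b i))))
      (galeBound n (k + 1)) := by
  set p := galeForm s t i₀ b with hp
  have hp0 : ∀ z, MvPolynomial.eval z (p i₀) = 1 := fun z => eval_galeForm_self b (hs i₀) ht0 z
  have hdeg : ∀ i, (p i).totalDegree ≤ 1 := fun i => totalDegree_affineForm_le _ _
  have hsum : ∀ S : Finset ι, (∑ i ∈ S, p i).totalDegree ≤ 1 := fun S =>
    MvPolynomial.totalDegree_finsetSum_le fun i _ => hdeg i
  set Δ : Set (Fin (k + 1) → ℝ) := {z | ∀ i, 0 < MvPolynomial.eval z (p i)} with hΔ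
  have hΔo : IsOpen Δ := by
    simp only [hΔ, ofPred_forall]
    exact isOpen_iInter_of_finite fun i =>
      isOpen_lt continuous_const (MvPolynomial.continuous_eval _)
  have hsumpos : ∀ z ∈ Δ, ∀ S : Finset ι, S.Nonempty → 0 < MvPolynomial.eval z (∑ i ∈ S, p i) := by
    intro z hz S hS
    rw [map_sum]
    exact Finset.sum_pos (fun i _ => hz i) hS
  let q : ι → MvPolynomial (Fin (k + 1)) ℝ := fun i => if i = i₀ then ∑ j, p j else p i
  let q' : Option ι → MvPolynomial (Fin (k + 1)) ℝ := fun o => o.elim (∑ i with s i = 1, p i)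
    fun i => if i = i₀ then ∑ i with s i = -1, p i else p i
  let β : Fin (k + 1) → ℝ := fun l => ∑ i with s i = 1, b l i
  let b₁ : Fin (k + 1) → ι → ℝ := fun l i => if i = i₀ then 0 else b l i
  let b₂ : Fin (k + 1) → Option ι → ℝ := fun l o => o.elim (-β l)
    fun i => if i = i₀ then β l else b l i
  have h₁ : ∀ l z, ∑ a, b₁ l a * Real.log (MvPolynomial.eval z (q a)) =
      ∑ a, b l a * Real.log (MvPolynomial.eval z (p a)) := by
    intro l z
    refine Finset.sum_congr rfl fun a _ => ?_
    by_cases ha : a = i₀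
    · simp [b₁, ha, hp0]
    · simp [b₁, q, ha]
  have h₂ : ∀ l z, ∑ a, b₂ l a * Real.log (MvPolynomial.eval z (q' a)) =
      ∑ a, b l a * Real.log (MvPolynomial.eval z (p a)) -
        β l * (Real.log (∑ i with s i = 1, MvPolynomial.eval z (p i)) -
          Real.log (∑ i with s i = -1, MvPolynomial.eval z (p i))) := by
    intro l z
    rw [Fintype.sum_option]
    have : ∀ a, b₂ l (some a) * Real.log (MvPolynomial.eval z (q' (some a))) =
        (if a = i₀ then β l * Real.log (∑ i with s i = -1, MvPolynomial.eval z (p i)) else 0) +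
          b l a * Real.log (MvPolynomial.eval z (p a)) := by
      intro a
      by_cases ha : a = i₀
      · simp [b₂, q', ha, hp0]
      · simp [b₂, q', ha]
    simp only [this, Finset.sum_add_distrib, Finset.sum_ite_eq', Finset.mem_univ, if_true]
    simp only [b₂, q', Option.elim_none, map_sum]
    ring
  have key := aeFiberBound_log (k := k) (n := n) (A := ι) (A' := Option ι) (q := q) (q' := q')
    (Δ := Δ) (ρ := fun i => if i = i₀ then -(Fintype.card ι : ℝ) else 1)
    (fun a => by by_cases ha : a = i₀ <;> simp only [q, ha, if_true, if_false, hsum, hdeg])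
    (fun a => by
      cases a with
      | none => exact hsum _
      | some a => by_cases ha : a = i₀ <;> simp [q', ha, hsum, hdeg])
    hΔo
    (fun z hz a => by
      by_cases ha : a = i₀
      · simp only [q, ha, if_true]
        exact hsumpos z hz _ ⟨i₀, Finset.mem_univ _⟩
      · simp only [q, ha, if_false]
        exact hz a)
    (fun z hz a => by
      cases a with
      | none => exact hsumpos z hz _ ⟨ip, by simp [hip]⟩
      | some a =>
        by_cases ha : a = i₀
        · simp only [q', ha, if_true, Option.elim_some]
          exact hsumpos z hz _ ⟨im, by simp [him]⟩
        · simp only [q', ha, if_false, Option.elim_some]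
          exact hz a)
    (fun L => by
      have h := isCompact_log_superlevel (i₀ := i₀) hs ht0 ht hb hb0 L
      convert h using 1
      ext z
      refine and_congr_right fun _ => ?_
      have : ∀ a, (if a = i₀ then -(Fintype.card ι : ℝ) else 1) *
          Real.log (MvPolynomial.eval z (q a)) =
          (if a = i₀ then -(Fintype.card ι : ℝ) *
            Real.log (∑ j, MvPolynomial.eval z (p j)) else 0) +
          Real.log (MvPolynomial.eval z (p a)) := by
        intro a
        by_cases ha : a = i₀
        · simp [q, ha, hp0]
        · simp [q, ha]
      simp only [this, Finset.sum_add_distrib, Finset.sum_ite_eq', Finset.mem_univ, if_true,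
        Finset.sum_sub_distrib, Finset.sum_const, Finset.card_univ, nsmul_eq_mul]
      rw [show ∀ x y z : ℝ, -x * y + z = z - x * y by intros; ring])
    (by omega) (by simp; omega) b₁ b₂
    (fun l hl z => by rw [h₁, h₂]; simp only [β, hβ l hl, zero_mul, sub_zero])
  simp only [h₂] at key
  exact key

/-- The space of affine relations: vectors orthogonal to `H` whose coordinates sum to zero. -/
def relations {ι : Type*} [Fintype ι] (H : Submodule ℝ (ι → ℝ)) : Submodule ℝ (ι → ℝ) where
  carrier := {b | ∑ i, b i = 0 ∧ ∀ v ∈ H, ∑ i, b i * v i = 0}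
  add_mem' := by
    rintro x y ⟨hx, hx'⟩ ⟨hy, hy'⟩
    refine ⟨by simp [Finset.sum_add_distrib, hx, hy], fun v hv => ?_⟩
    simp [add_mul, Finset.sum_add_distrib, hx' v hv, hy' v hv]
  zero_mem' := by simp
  smul_mem' := by
    rintro r x ⟨hx, hx'⟩
    refine ⟨by simp [← Finset.mul_sum, hx], fun v hv => ?_⟩
    simp [mul_assoc, ← Finset.mul_sum, hx' v hv]

theorem finrank_relations {ι : Type*} [Fintype ι] {n k : ℕ} {H : Submodule ℝ (ι → ℝ)}
    {i₀ : ι} (hH : ∀ v ∈ H, v i₀ = 0) (hn : Module.finrank ℝ H = n)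
    (hcard : Fintype.card ι = n + k + 1) : Module.finrank ℝ (relations H) = k := by
  classical
  set H' : Submodule ℝ (ι → ℝ) := H ⊔ Submodule.span ℝ {1} with hH'
  have hd : H ⊓ Submodule.span ℝ {1} = ⊥ := by
    rw [Submodule.eq_bot_iff]
    rintro x ⟨hx, hx'⟩
    obtain ⟨r, rfl⟩ := Submodule.mem_span_singleton.1 hx'
    have := hH _ hx
    simp only [Pi.smul_apply, Pi.one_apply, smul_eq_mul, mul_one] at this
    rw [this, zero_smul]
  have h1 : Module.finrank ℝ H' = n + 1 := by
    have h := Submodule.finrank_sup_add_finrank_inf_eq H (Submodule.span ℝ {(1 : ι → ℝ)})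
    have : (1 : ι → ℝ) ≠ 0 := fun h => one_ne_zero (congrFun h i₀)
    rw [hd, finrank_bot, add_zero, hn, finrank_span_singleton this] at h
    exact h
  have h2 := Subspace.finrank_add_finrank_dualAnnihilator_eq H'
  rw [h1, Module.finrank_fintype_fun_eq_card, hcard] at h2
  have h3 : relations H = H'.dualAnnihilator.comap (dotProductEquiv ℝ ι).toLinearMap := by
    ext x
    rw [Submodule.mem_comap, Submodule.mem_dualAnnihilator]
    simp only [LinearEquiv.coe_coe, dotProductEquiv_apply_apply]
    constructor
    · rintro ⟨hx, hx'⟩ w hw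
      obtain ⟨v, hv, u, hu, rfl⟩ := Submodule.mem_sup.1 hw
      obtain ⟨r, rfl⟩ := Submodule.mem_span_singleton.1 hu
      have := hx' v hv
      simp only [dotProduct, Pi.add_apply, Pi.smul_apply, Pi.one_apply, smul_eq_mul, mul_one,
        mul_add, Finset.sum_add_distrib, ← Finset.sum_mul, hx, this, zero_mul, add_zero]
    · intro h
      refine ⟨?_, fun v hv => h v (Submodule.mem_sup_left hv)⟩
      have := h 1 (Submodule.mem_sup_right (Submodule.mem_span_singleton_self _))
      simpa [dotProduct] using this
  rw [h3, Submodule.comap_equiv_eq_map_symm, LinearEquiv.finrank_map_eq]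
  omega

theorem exists_linearIndependent_forall_ne_zero_apply_eq_zero {V : Type*} [AddCommGroup V]
    [Module ℝ V] [Module.Finite ℝ V] {k : ℕ} (hk : Module.finrank ℝ V = k + 1) (β : V →ₗ[ℝ] ℝ) :
    ∃ b : Fin (k + 1) → V, LinearIndependent ℝ b ∧ ∀ l, l ≠ 0 → β (b l) = 0 := by
  have h1 : k ≤ Module.finrank ℝ (LinearMap.ker β) := by
    have h := LinearMap.finrank_range_add_finrank_ker β
    have h2 := Submodule.finrank_le (LinearMap.range β)
    rw [Module.finrank_self] at h2
    omega
  obtain ⟨f, hf⟩ := exists_linearIndependent_of_le_finrank h1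
  have hf' := hf.map' (LinearMap.ker β).subtype (Submodule.ker_subtype _)
  obtain ⟨x, hx⟩ := exists_linearIndependent_cons_of_lt_finrank hf' (by omega)
  refine ⟨_, hx, fun l hl => ?_⟩
  obtain ⟨j, rfl⟩ := Fin.exists_succ_eq.2 hl
  simp only [Fin.cons_succ]
  exact (f j).2

/-- `p` is the positive Gale dual vector attached to a critical point `q` for the coefficients
`exp ∘ a` and the weights `t`. -/
def IsGaleVector {ι : Type*} [Fintype ι] (H : Submodule ℝ (ι → ℝ)) (s t : ι → ℝ) (i₀ : ι)
    (a q p : ι → ℝ) : Prop :=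
  (∀ i, 0 < p i) ∧ p i₀ = 1 ∧ (∃ τ : ℝ, (fun i => s i * p i - τ * t i) ∈ relations H) ∧
    ∃ c : ℝ → ℝ, (∀ i, Real.log (p i) = a i + q i + c (s i)) ∧
      c 1 - c (-1) = Real.log (∑ i with s i = 1, p i) - Real.log (∑ i with s i = -1, p i)

theorem IsGaleVector.eq_of_eq {ι : Type*} [Fintype ι] {H : Submodule ℝ (ι → ℝ)} {s t : ι → ℝ}
    {i₀ : ι} {a q q' p : ι → ℝ} (hs : ∀ i, s i = 1 ∨ s i = -1) (hq : q i₀ = 0) (hq' : q' i₀ = 0)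
    (h : IsGaleVector H s t i₀ a q p) (h' : IsGaleVector H s t i₀ a q' p) : q = q' := by
  obtain ⟨-, -, -, c, hc, hcc⟩ := h
  obtain ⟨-, -, -, c', hc', hcc'⟩ := h'
  have h0 : c (s i₀) = c' (s i₀) := by linarith [hc i₀, hc' i₀]
  have h1 : ∀ i, c (s i) = c' (s i) := by
    intro i
    rcases hs i with hi | hi <;> rcases hs i₀ with hi0 | hi0 <;> rw [hi0] at h0 <;> rw [hi] <;>
      linarith
  ext i
  linarith [hc i, hc' i, h1 i]

theorem exists_dense_encard_isGaleVector_le {ι : Type*} [Fintype ι] {n k : ℕ}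
    {H : Submodule ℝ (ι → ℝ)} {s t : ι → ℝ} {i₀ ip im : ι} (hH : ∀ v ∈ H, v i₀ = 0)
    (hn : Module.finrank ℝ H = n) (hcard : Fintype.card ι = n + k + 1)
    (hs : ∀ i, s i = 1 ∨ s i = -1) (hip : s ip = 1) (him : s im = -1)
    (htpos : ∀ i, 0 < t i) (ht : ∑ i, t i = 1) :
    ∃ G : Set (ι → ℝ), Dense G ∧ ∀ a ∈ G,
      {q | q ∈ H ∧ ∃ p, IsGaleVector H s t i₀ a q p}.encard ≤ galeBound n k := by
  classical
  have hfr := finrank_relations hH hn hcard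
  have hss : ∀ i, s i * s i = 1 := fun i => by rcases hs i with h | h <;> rw [h] <;> norm_num
  cases k with
  | zero =>
    refine ⟨univ, dense_univ, fun a _ => ?_⟩
    have hbot : relations H = ⊥ := Submodule.finrank_eq_zero.1 hfr
    rw [galeBound, Nat.cast_one, encard_le_one_iff]
    have hp : ∀ q p, IsGaleVector H s t i₀ a q p → ∀ i, p i = s i₀ * s i * t i / t i₀ := by
      rintro q p ⟨-, hp0, ⟨τ, hτ⟩, -⟩ i
      rw [hbot, Submodule.mem_bot] at hτ
      have h1 : s i * p i - τ * t i = 0 := congrFun hτ i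
      have h2 : s i₀ * p i₀ - τ * t i₀ = 0 := congrFun hτ i₀
      rw [hp0] at h2
      rw [eq_div_iff (htpos i₀).ne']
      linear_combination (t i₀ * s i) * h1 - t i * s i * h2 - t i₀ * p i * hss i
    rintro q q' ⟨hq, p, hqp⟩ ⟨hq', p', hqp'⟩
    have : p = p' := funext fun i => by rw [hp q p hqp, hp q' p' hqp']
    subst this
    exact hqp.eq_of_eq hs (hH q hq) (hH q' hq') hqp'
  | succ k =>
    obtain ⟨b', hb', hβ'⟩ := exists_linearIndependent_forall_ne_zero_apply_eq_zero hfr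
      ((∑ i with s i = 1, LinearMap.proj i : (ι → ℝ) →ₗ[ℝ] ℝ) ∘ₗ (relations H).subtype)
    set b : Fin (k + 1) → ι → ℝ := fun l => b' l with hb_def
    have hb : LinearIndependent ℝ b := hb'.map' (relations H).subtype (Submodule.ker_subtype _)
    have hb0 : ∀ l, ∑ i, b l i = 0 := fun l => (b' l).2.1
    have hbH : ∀ l, ∀ v ∈ H, ∑ i, b l i * v i = 0 := fun l => (b' l).2.2
    have hβ : ∀ l, l ≠ 0 → ∑ i with s i = 1, b l i = 0 := fun l hl => by
      have := hβ' l hl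
      simpa using this
    have hspan : ∀ x ∈ relations H, ∃ z : Fin (k + 1) → ℝ, ∀ i, x i = ∑ l, z l * b l i := by
      intro x hx
      let B := basisOfLinearIndependentOfCardEqFinrank hb' (by simp [hfr])
      refine ⟨fun l => B.repr ⟨x, hx⟩ l, fun i => ?_⟩
      have h := congrArg (fun y : relations H => (y : ι → ℝ) i) (B.sum_repr ⟨x, hx⟩)
      simp only [B, coe_basisOfLinearIndependentOfCardEqFinrank, Submodule.coe_sum,
        Submodule.coe_smul, Finset.sum_apply, Pi.smul_apply, smul_eq_mul] at h
      exact h.symm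
    have hae := aeFiberBound_gale (n := n) (i₀ := i₀) hcard hss hip him (htpos i₀).ne' ht hb hb0 hβ
    let κ := Matrix.mulVecLin (Matrix.of b)
    have hκ : Function.Surjective κ := by
      rw [← LinearMap.range_eq_top]
      refine Submodule.eq_top_of_finrank_eq ?_
      have := LinearIndependent.rank_matrix (M := Matrix.of b) hb
      rw [Matrix.rank] at this
      simp [κ, this]
    refine ⟨κ ⁻¹' _, (Measure.dense_of_ae hae).preimage (κ.isOpenMap_of_finiteDimensional hκ),
      fun a ha => ?_⟩
    refine le_trans ?_ ha
    have hz : ∀ q ∈ {q | q ∈ H ∧ ∃ p, IsGaleVector H s t i₀ a q p}, ∃ z : Fin (k + 1) → ℝ,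
        IsGaleVector H s t i₀ a q fun i => MvPolynomial.eval z (galeForm s t i₀ b i) := by
      rintro q ⟨hq, p, hp⟩
      obtain ⟨hpos, hp0, ⟨τ, hτ⟩, c, hc, hcc⟩ := id hp
      obtain ⟨z, hz⟩ := hspan _ hτ
      refine ⟨z, ?_⟩
      convert hp using 1
      ext i
      rw [eval_galeForm, ← hz, ← hz, hp0]
      have := (htpos i₀).ne'
      rw [show (s i₀ - (s i₀ * 1 - τ * t i₀)) / t i₀ = τ by field_simp; ring]
      linear_combination p i * hss i
    choose! z hz using hz
    refine encard_le_encard_of_injOn (f := z) ?_ ?_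
    · intro q hq
      obtain ⟨hpos, hp0, -, c, hc, hcc⟩ := hz q hq
      refine ⟨hpos, ?_⟩
      ext l
      have h1 : ∀ g : ℝ → ℝ, ∑ i, b l i * g (s i) =
          g 1 * ∑ i with s i = 1, b l i - g (-1) * ∑ i with s i = 1, b l i := by
        intro g
        have h2 : ∑ i with ¬ s i = 1, b l i = - ∑ i with s i = 1, b l i := by
          have := Finset.sum_filter_add_sum_filter_not Finset.univ (fun i => s i = 1) (b l)
          rw [hb0] at this
          linarith
        rw [← Finset.sum_filter_add_sum_filter_not Finset.univ (fun i => s i = 1),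
          Finset.mul_sum, sub_eq_add_neg, ← mul_neg, ← h2, Finset.mul_sum]
        congr 1
        · refine Finset.sum_congr rfl fun i hi => ?_
          rw [(Finset.mem_filter.1 hi).2, mul_comm]
        · refine Finset.sum_congr rfl fun i hi => ?_
          rw [(hs i).resolve_left (Finset.mem_filter.1 hi).2, mul_comm]
      simp only [hc, mul_add, Finset.sum_add_distrib, hbH l q hq.1, h1 c, ← hcc]
      simp only [κ, Matrix.mulVecLin_apply, Matrix.mulVec, dotProduct, Matrix.of_apply]
      ring
    · intro q hq q' hq' hqq
      have h1 := hz q hq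
      rw [hqq] at h1
      exact h1.eq_of_eq hs (hH q hq.1) (hH q' hq'.1) (hz q' hq')

/-- The exponential sum with signs `s` and coefficients `exp ∘ a`. -/
noncomputable def signedSum {ι : Type*} [Fintype ι] (s a θ : ι → ℝ) : ℝ :=
  ∑ i, s i * Real.exp (a i + θ i)

/-- The part of the exponential sum with sign `σ`. -/
noncomputable def partSum {ι : Type*} [Fintype ι] (s : ι → ℝ) (σ : ℝ) (a θ : ι → ℝ) : ℝ :=
  ∑ i with s i = σ, Real.exp (a i + θ i)

/-- The height function with weights `t`. -/
noncomputable def height {ι : Type*} [Fintype ι] (t a θ : ι → ℝ) : ℝ :=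
  Real.log (∑ i, Real.exp (a i + θ i)) - ∑ i, t i * θ i

theorem sum_eq_sum_filter_add {ι : Type*} [Fintype ι] {s : ι → ℝ}
    (hs : ∀ i, s i = 1 ∨ s i = -1) (f : ι → ℝ) :
    ∑ i, f i = ∑ i with s i = 1, f i + ∑ i with s i = -1, f i := by
  rw [← Finset.sum_filter_add_sum_filter_not Finset.univ (fun i => s i = 1)]
  congr 1
  refine Finset.sum_congr ?_ fun _ _ => rfl
  ext i
  rcases hs i with h | h <;> simp [h] <;> norm_num

theorem signedSum_eq {ι : Type*} [Fintype ι] {s : ι → ℝ} (hs : ∀ i, s i = 1 ∨ s i = -1)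
    (a θ : ι → ℝ) : signedSum s a θ = partSum s 1 a θ - partSum s (-1) a θ := by
  rw [signedSum, sum_eq_sum_filter_add hs, partSum, partSum, sub_eq_add_neg,
    ← Finset.sum_neg_distrib]
  congr 1 <;> refine Finset.sum_congr rfl fun i hi => ?_ <;>
    rw [(Finset.mem_filter.1 hi).2] <;> ring

theorem partSum_pos {ι : Type*} [Fintype ι] {s : ι → ℝ} {σ : ℝ} {j : ι} (hj : s j = σ)
    (a θ : ι → ℝ) : 0 < partSum s σ a θ :=
  Finset.sum_pos (fun _ _ => Real.exp_pos _) ⟨j, by simp [hj]⟩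

theorem partSum_neg_one_eq {ι : Type*} [Fintype ι] {s : ι → ℝ} (hs : ∀ i, s i = 1 ∨ s i = -1)
    {a θ : ι → ℝ} (h : signedSum s a θ = 0) : partSum s (-1) a θ = partSum s 1 a θ := by
  rw [signedSum_eq hs] at h
  linarith

/-- `q` is a critical point on the zero set of `signedSum s a` with multipliers `w`. -/
def IsCriticalWith {ι : Type*} [Fintype ι] (H : Submodule ℝ (ι → ℝ)) (s t a q : ι → ℝ)
    (w : ℝ → ℝ) : Prop :=
  q ∈ H ∧ signedSum s a q = 0 ∧ ∀ v ∈ H,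
    ∑ i, w (s i) * (Real.exp (a i + q i) / partSum s 1 a q) * v i =
      (w 1 + w (-1)) * ∑ i, t i * v i

theorem exists_isCriticalWith {ι : Type*} [Fintype ι] {H : Submodule ℝ (ι → ℝ)}
    {s t a : ι → ℝ} {ip : ι} (hs : ∀ i, s i = 1 ∨ s i = -1) (hip : s ip = 1) {q : H}
    (hq : signedSum s a q = 0)
    (hmin : IsLocalMinOn (fun θ : H => height t a θ) {θ : H | signedSum s a θ = 0} q) :
    ∃ w : ℝ → ℝ, (w 1 ≠ 0 ∨ w (-1) ≠ 0) ∧ IsCriticalWith H s t a q w := by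
  let e : ι → H →L[ℝ] ℝ := fun i => (ContinuousLinearMap.proj i).comp H.subtypeL
  have he : ∀ i, HasStrictFDerivAt (fun θ : H => (θ : ι → ℝ) i) (e i) q := fun i =>
    (e i).hasStrictFDerivAt
  have hexp : ∀ i, HasStrictFDerivAt (fun θ : H => Real.exp (a i + (θ : ι → ℝ) i))
      (Real.exp (a i + (q : ι → ℝ) i) • e i) q := fun i => ((he i).const_add (a i)).exp
  have hG : HasStrictFDerivAt (fun θ : H => signedSum s a θ)
      (∑ i, s i • (Real.exp (a i + (q : ι → ℝ) i) • e i)) q :=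
    HasStrictFDerivAt.fun_sum fun i _ => (hexp i).const_mul (s i)
  have hTpos : 0 < ∑ i, Real.exp (a i + (q : ι → ℝ) i) :=
    Finset.sum_pos (fun _ _ => Real.exp_pos _) ⟨ip, Finset.mem_univ _⟩
  have hh : HasStrictFDerivAt (fun θ : H => height t a θ)
      ((∑ i, Real.exp (a i + (q : ι → ℝ) i))⁻¹ •
        (∑ i, Real.exp (a i + (q : ι → ℝ) i) • e i) - ∑ i, t i • e i) q :=
    ((HasStrictFDerivAt.fun_sum fun i _ => hexp i).log hTpos.ne').sub
      (HasStrictFDerivAt.fun_sum fun i _ => (he i).const_mul (t i))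
  have hset : {θ : H | signedSum s a θ = 0} = {θ : H | signedSum s a θ = signedSum s a q} := by
    rw [hq]
  rw [hset] at hmin
  obtain ⟨α, β, hαβ, hzero⟩ := IsLocalExtrOn.exists_multipliers_of_hasStrictFDerivAt_1d
    (Or.inl hmin) hG hh
  set P := partSum s 1 a q with hP
  have hPpos : 0 < P := partSum_pos hip a q
  have hT : ∑ i, Real.exp (a i + (q : ι → ℝ) i) = 2 * P := by
    have := partSum_neg_one_eq hs hq
    rw [sum_eq_sum_filter_add hs]
    change P + partSum s (-1) a q = _
    rw [this, ← hP]
    ring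
  refine ⟨fun σ => α * P * σ + β / 2, ?_, q.2, hq, fun v hv => ?_⟩
  · by_contra! hcon
    have hβ : β = 0 := by linarith [hcon.1, hcon.2]
    have hα : α * P = 0 := by linarith [hcon.1, hcon.2]
    exact hαβ (by rw [hβ, (mul_eq_zero.1 hα).resolve_right hPpos.ne']; rfl)
  · have h := congrArg (fun L : H →L[ℝ] ℝ => L ⟨v, hv⟩) hzero
    simp only [add_apply, smul_apply,
      sub_apply, sum_apply, smul_eq_mul, hT,
      zero_apply, e, ContinuousLinearMap.comp_apply, Submodule.subtypeL_apply,
      ContinuousLinearMap.proj_apply] at h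
    have h2 : ∑ i, (α * P * s i + β / 2) * (Real.exp (a i + (q : ι → ℝ) i) / P) * v i =
        α * ∑ i, s i * (Real.exp (a i + (q : ι → ℝ) i) * v i) +
          β * ((2 * P)⁻¹ * ∑ i, Real.exp (a i + (q : ι → ℝ) i) * v i) := by
      simp only [Finset.mul_sum, ← Finset.sum_add_distrib]
      refine Finset.sum_congr rfl fun i _ => ?_
      field_simp
    rw [h2]
    linear_combination h

theorem IsCriticalWith.exists_isGaleVector {ι : Type*} [Fintype ι] {H : Submodule ℝ (ι → ℝ)}
    {s t a q : ι → ℝ} {w : ℝ → ℝ} {i₀ ip : ι} (hs : ∀ i, s i = 1 ∨ s i = -1) (hip : s ip = 1)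
    (ht : ∑ i, t i = 1)
    (h : IsCriticalWith H s t a q w) (hw : w 1 * w (-1) < 0) :
    ∃ p, IsGaleVector H s t i₀ a q p := by
  obtain ⟨hqH, hq, hcrit⟩ := h
  set P := partSum s 1 a q with hP
  have hPpos : 0 < P := partSum_pos hip a q
  have hM : partSum s (-1) a q = P := partSum_neg_one_eq hs hq
  set π : ι → ℝ := fun i => Real.exp (a i + q i) / P with hπ
  have hπpos : ∀ i, 0 < π i := fun i => div_pos (Real.exp_pos _) hPpos
  have hπp : ∑ i with s i = 1, π i = 1 := by
    rw [← Finset.sum_div]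
    exact div_self hPpos.ne'
  have hπm : ∑ i with s i = -1, π i = 1 := by
    rw [← Finset.sum_div]
    change partSum s (-1) a q / P = 1
    rw [hM]
    exact div_self hPpos.ne'
  set g : ι → ℝ := fun i => s i * w (s i) with hg
  have hgg : ∀ i j, 0 < g i * g j := by
    intro i j
    have h1 : w 1 ≠ 0 := fun h => by simp [h] at hw
    have h2 : w (-1) ≠ 0 := fun h => by simp [h] at hw
    have h1' := mul_self_pos.2 h1
    have h2' := mul_self_pos.2 h2
    rcases hs i with hi | hi <;> rcases hs j with hj | hj <;> simp only [hg, hi, hj] <;> nlinarith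
  set D := g i₀ * π i₀ with hD
  have hgne : ∀ i, g i ≠ 0 := fun i h => by have := hgg i i; simp [h] at this
  have hDne : D ≠ 0 := mul_ne_zero (hgne _) (hπpos _).ne'
  have hgD : ∀ i, 0 < g i / D := by
    intro i
    rw [hD, ← div_div]
    refine div_pos ?_ (hπpos _)
    rw [div_eq_mul_inv]
    have := hgg i i₀
    have h3 := mul_self_pos.2 (hgne i₀)
    rw [show g i * (g i₀)⁻¹ = g i * g i₀ / (g i₀ * g i₀) by field_simp [hgne i₀]]
    exact div_pos this h3
  have hss : ∀ i, s i * s i = 1 := fun i => by rcases hs i with h | h <;> rw [h] <;> norm_num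
  refine ⟨fun i => g i / D * π i, fun i => mul_pos (hgD i) (hπpos i), ?_,
    ⟨(w 1 + w (-1)) / D, ?_, fun v hv => ?_⟩,
    fun σ => Real.log (σ * w σ / D) - Real.log P, fun i => ?_, ?_⟩
  · change g i₀ / D * π i₀ = 1
    rw [div_mul_eq_mul_div, ← hD]
    exact div_self hDne
  · simp only [Finset.sum_sub_distrib, ← Finset.mul_sum, ht]
    have : ∀ i, s i * (g i / D * π i) = w (s i) * π i / D := fun i => by
      simp only [hg]
      linear_combination (w (s i) / D * π i) * hss i
    simp only [this]
    rw [← Finset.sum_div, sum_eq_sum_filter_add hs]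
    have e1 : ∑ i with s i = 1, w (s i) * π i = w 1 := by
      refine (Finset.sum_congr rfl fun i hi => ?_).trans
        ((Finset.mul_sum _ _ (w 1)).symm.trans (by rw [hπp, mul_one]))
      rw [(Finset.mem_filter.1 hi).2]
    have e2 : ∑ i with s i = -1, w (s i) * π i = w (-1) := by
      refine (Finset.sum_congr rfl fun i hi => ?_).trans
        ((Finset.mul_sum _ _ (w (-1))).symm.trans (by rw [hπm, mul_one]))
      rw [(Finset.mem_filter.1 hi).2]
    rw [e1, e2]
    ring
  · have : ∀ i, (s i * (g i / D * π i) - (w 1 + w (-1)) / D * t i) * v i =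
        (w (s i) * π i * v i - (w 1 + w (-1)) * (t i * v i)) / D := fun i => by
      simp only [hg]
      linear_combination (w (s i) / D * π i * v i) * hss i
    simp only [this]
    rw [← Finset.sum_div, Finset.sum_sub_distrib, ← Finset.mul_sum, hcrit v hv, sub_self, zero_div]
  · change Real.log (g i / D * π i) = a i + q i + (Real.log (g i / D) - Real.log P)
    rw [Real.log_mul (hgD i).ne' (hπpos i).ne', hπ, Real.log_div (Real.exp_pos _).ne' hPpos.ne',
      Real.log_exp]
    ring
  · have e1 : ∑ i with s i = 1, g i / D * π i = 1 * w 1 / D := by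
      refine (Finset.sum_congr rfl fun i hi => ?_).trans
        ((Finset.mul_sum _ _ (1 * w 1 / D)).symm.trans (by rw [hπp, mul_one]))
      simp only [hg, (Finset.mem_filter.1 hi).2]
    have e2 : ∑ i with s i = -1, g i / D * π i = -1 * w (-1) / D := by
      refine (Finset.sum_congr rfl fun i hi => ?_).trans
        ((Finset.mul_sum _ _ (-1 * w (-1) / D)).symm.trans (by rw [hπm, mul_one]))
      simp only [hg, (Finset.mem_filter.1 hi).2]
    rw [e1, e2]
    ring

theorem sum_mul_le_log_sum_mul_exp {ι : Type*} {S : Finset ι} {π d : ι → ℝ} {r : ℝ}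
    (hπ : ∀ i ∈ S, 0 < π i) (h1 : ∑ i ∈ S, π i = 1) (hr : 0 < r)
    (hsum : ∑ i ∈ S, π i * Real.exp (d i) = r) :
    ∑ i ∈ S, π i * d i ≤ Real.log r ∧
      (∑ i ∈ S, π i * d i = Real.log r → ∀ i ∈ S, d i = Real.log r) := by
  have h0 : ∀ i ∈ S, 0 ≤ π i * (Real.exp (d i - Real.log r) - 1 - (d i - Real.log r)) :=
    fun i hi => mul_nonneg (hπ i hi).le (by linarith [Real.add_one_le_exp (d i - Real.log r)])
  have hs : ∑ i ∈ S, π i * (Real.exp (d i - Real.log r) - 1 - (d i - Real.log r)) =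
      Real.log r - ∑ i ∈ S, π i * d i := by
    have : ∀ i, π i * (Real.exp (d i - Real.log r) - 1 - (d i - Real.log r)) =
        π i * Real.exp (d i) / r - π i - π i * d i + π i * Real.log r := fun i => by
      rw [Real.exp_sub, Real.exp_log hr]
      ring
    simp only [this, Finset.sum_add_distrib, Finset.sum_sub_distrib, ← Finset.sum_div,
      ← Finset.sum_mul, hsum, h1, div_self hr.ne']
    ring
  refine ⟨by linarith [Finset.sum_nonneg h0], fun heq i hi => ?_⟩
  rw [heq, sub_self] at hs
  have h2 := (Finset.sum_eq_zero_iff_of_nonneg h0).1 hs i hi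
  have h3 := (mul_eq_zero.1 h2).resolve_left (hπ i hi).ne'
  by_contra hne
  have := Real.add_one_lt_exp (sub_ne_zero.2 hne)
  linarith

/-- Genericity of the weights `t` with respect to the sign class `σ`. -/
def GenericWeights {ι : Type*} [Fintype ι] (H : Submodule ℝ (ι → ℝ)) (s t : ι → ℝ) (σ : ℝ) :
    Prop :=
  (∀ d ∈ H, ∀ δ : ℝ, (∀ i, s i = σ → d i = δ) → d = 0) ∨
    ∃ d ∈ H, ∃ δ : ℝ, (∀ i, s i = σ → d i = δ) ∧ ∑ i, t i * d i ≠ δ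

theorem IsCriticalWith.log_div_le {ι : Type*} [Fintype ι] {H : Submodule ℝ (ι → ℝ)}
    {s t a q q' : ι → ℝ} {w : ℝ → ℝ} {ip : ι} (hs : ∀ i, s i = 1 ∨ s i = -1)
    (hip : s ip = 1) (h : IsCriticalWith H s t a q w) (h1 : 0 ≤ w 1) (h2 : 0 ≤ w (-1))
    (hw : w 1 + w (-1) = 1) (hq' : q' ∈ H) (hq'0 : signedSum s a q' = 0) :
    ∑ i, t i * (q' i - q i) ≤ Real.log (partSum s 1 a q' / partSum s 1 a q) ∧
      (∑ i, t i * (q' i - q i) = Real.log (partSum s 1 a q' / partSum s 1 a q) →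
        ∀ σ, (σ = 1 ∨ σ = -1) → w σ ≠ 0 → ∀ i, s i = σ →
          q' i - q i = Real.log (partSum s 1 a q' / partSum s 1 a q)) := by
  obtain ⟨hqH, hq, hcrit⟩ := h
  set P := partSum s 1 a q with hP
  set P' := partSum s 1 a q' with hP'
  have hPpos : 0 < P := partSum_pos hip a q
  have hPpos' : 0 < P' := partSum_pos hip a q'
  have hM : partSum s (-1) a q = P := partSum_neg_one_eq hs hq
  have hM' : partSum s (-1) a q' = P' := partSum_neg_one_eq hs hq'0
  set π : ι → ℝ := fun i => Real.exp (a i + q i) / P with hπ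
  have hπpos : ∀ i, 0 < π i := fun i => div_pos (Real.exp_pos _) hPpos
  have hpart : ∀ σ, (σ = 1 ∨ σ = -1) → partSum s σ a q = P ∧ partSum s σ a q' = P' := by
    rintro σ (rfl | rfl)
    · exact ⟨rfl, rfl⟩
    · exact ⟨hM, hM'⟩
  have hJ : ∀ σ, (σ = 1 ∨ σ = -1) →
      ∑ i with s i = σ, π i * (q' i - q i) ≤ Real.log (P' / P) ∧
      (∑ i with s i = σ, π i * (q' i - q i) = Real.log (P' / P) →
        ∀ i ∈ Finset.univ.filter (fun i => s i = σ), q' i - q i = Real.log (P' / P)) := by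
    intro σ hσ
    refine sum_mul_le_log_sum_mul_exp (d := fun i => q' i - q i) (fun i _ => hπpos i) ?_
      (div_pos hPpos' hPpos) ?_
    · rw [← Finset.sum_div]
      change partSum s σ a q / P = 1
      rw [(hpart σ hσ).1, div_self hPpos.ne']
    · rw [← (hpart σ hσ).2, partSum, Finset.sum_div]
      refine Finset.sum_congr rfl fun i _ => ?_
      rw [hπ, div_mul_eq_mul_div, ← Real.exp_add]
      ring_nf
  have hc := hcrit (fun i => q' i - q i) (H.sub_mem hq' hqH)
  rw [hw, one_mul, sum_eq_sum_filter_add hs] at hc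
  have e1 : ∀ σ, ∑ i with s i = σ, w (s i) * (Real.exp (a i + q i) / P) * (q' i - q i) =
      w σ * ∑ i with s i = σ, π i * (q' i - q i) := fun σ => by
    rw [Finset.mul_sum]
    exact Finset.sum_congr rfl fun i hi => by rw [(Finset.mem_filter.1 hi).2, mul_assoc]
  rw [e1, e1] at hc
  have j1 := hJ 1 (Or.inl rfl)
  have j2 := hJ (-1) (Or.inr rfl)
  have k1 := mul_le_mul_of_nonneg_left j1.1 h1
  have k2 := mul_le_mul_of_nonneg_left j2.1 h2
  have k3 : w 1 * Real.log (P' / P) + w (-1) * Real.log (P' / P) = Real.log (P' / P) := by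
    rw [← add_mul, hw, one_mul]
  refine ⟨by linarith, fun heq σ hσ hne i hi => ?_⟩
  refine (hJ σ hσ).2 ?_ i (by simp [hi])
  refine mul_left_cancel₀ hne ?_
  rcases hσ with rfl | rfl <;> linarith

theorem IsCriticalWith.eq_of_nonneg {ι : Type*} [Fintype ι] {H : Submodule ℝ (ι → ℝ)}
    {s t a q q' : ι → ℝ} {w w' : ℝ → ℝ} {i₀ ip : ι} (hs : ∀ i, s i = 1 ∨ s i = -1)
    (hip : s ip = 1) (hH : ∀ v ∈ H, v i₀ = 0)
    (hgen : ∀ σ, (σ = 1 ∨ σ = -1) → GenericWeights H s t σ)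
    (h : IsCriticalWith H s t a q w) (h1 : 0 ≤ w 1) (h2 : 0 ≤ w (-1)) (hw : w 1 + w (-1) = 1)
    (h' : IsCriticalWith H s t a q' w') (h1' : 0 ≤ w' 1) (h2' : 0 ≤ w' (-1))
    (hw' : w' 1 + w' (-1) = 1) : q' = q := by
  have hPpos : 0 < partSum s 1 a q := partSum_pos hip a q
  have hPpos' : 0 < partSum s 1 a q' := partSum_pos hip a q'
  obtain ⟨i1, i2⟩ := h.log_div_le hs hip h1 h2 hw h'.1 h'.2.1
  obtain ⟨i1', -⟩ := h'.log_div_le hs hip h1' h2' hw' h.1 h.2.1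
  rw [← inv_div, Real.log_inv] at i1'
  have hneg : ∑ i, t i * (q i - q' i) = - ∑ i, t i * (q' i - q i) := by
    rw [← Finset.sum_neg_distrib]
    exact Finset.sum_congr rfl fun i _ => by ring
  have hconst := i2 (by linarith)
  set δ := Real.log (partSum s 1 a q' / partSum s 1 a q)
  have hd : (fun i => q' i - q i) ∈ H := H.sub_mem h'.1 h.1
  suffices hz : (fun i => q' i - q i) = 0 by
    ext i
    exact sub_eq_zero.1 (congrFun hz i)
  have hcase : ∀ σ, (σ = 1 ∨ σ = -1) → w (-σ) = 0 → (fun i => q' i - q i) = 0 := by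
    intro σ hσ h0
    have hwσ : w σ = 1 := by
      rcases hσ with rfl | rfl
      · linarith
      · rw [neg_neg] at h0; linarith
    rcases hgen σ hσ with hg | ⟨d, hdH, ε, hε, hne⟩
    · exact hg _ hd δ (hconst σ hσ (by rw [hwσ]; exact one_ne_zero))
    · refine absurd ?_ hne
      have hc := h.2.2 d hdH
      rw [hw, one_mul] at hc
      rw [← hc]
      have hpart : partSum s σ a q = partSum s 1 a q := by
        rcases hσ with rfl | rfl
        · rfl
        · exact partSum_neg_one_eq hs h.2.1
      calc ∑ i, w (s i) * (Real.exp (a i + q i) / partSum s 1 a q) * d i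
          = ∑ i with s i = σ, (Real.exp (a i + q i) / partSum s 1 a q) * ε := by
            rw [Finset.sum_filter]
            refine Finset.sum_congr rfl fun i _ => ?_
            by_cases hi : s i = σ
            · rw [if_pos hi, hi, hwσ, hε i hi, one_mul]
            · rw [if_neg hi]
              have : s i = -σ := by
                rcases hσ with rfl | rfl
                · exact (hs i).resolve_left hi
                · rw [neg_neg]; exact (hs i).resolve_right hi
              rw [this, h0, zero_mul, zero_mul]
        _ = ε := by
            rw [← Finset.sum_mul, ← Finset.sum_div]
            change partSum s σ a q / _ * ε = ε
            rw [hpart, div_self hPpos.ne', one_mul]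
  by_cases hp : w 1 = 0
  · exact hcase (-1) (Or.inr rfl) (by rw [neg_neg]; exact hp)
  by_cases hm : w (-1) = 0
  · exact hcase 1 (Or.inl rfl) hm
  have hall : ∀ i, q' i - q i = δ := fun i => by
    rcases hs i with hi | hi
    · exact hconst 1 (Or.inl rfl) hp i hi
    · exact hconst (-1) (Or.inr rfl) hm i hi
  have hδ : δ = 0 := by
    rw [← hall i₀]
    exact hH _ hd
  ext i
  rw [hall i, hδ]
  rfl

theorem encard_isCriticalWith_le {ι : Type*} [Fintype ι] {H : Submodule ℝ (ι → ℝ)}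
    {s t a : ι → ℝ} {i₀ ip : ι} {B : ℕ} (hs : ∀ i, s i = 1 ∨ s i = -1)
    (hip : s ip = 1) (hH : ∀ v ∈ H, v i₀ = 0) (ht : ∑ i, t i = 1)
    (hgen : ∀ σ, (σ = 1 ∨ σ = -1) → GenericWeights H s t σ)
    (hB : {q | q ∈ H ∧ ∃ p, IsGaleVector H s t i₀ a q p}.encard ≤ B) :
    {q | ∃ w : ℝ → ℝ, (w 1 ≠ 0 ∨ w (-1) ≠ 0) ∧ IsCriticalWith H s t a q w}.encard ≤
      (B + 1 : ℕ) := by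
  have hsub : {q | ∃ w : ℝ → ℝ, (w 1 ≠ 0 ∨ w (-1) ≠ 0) ∧ IsCriticalWith H s t a q w} ⊆
      {q | q ∈ H ∧ ∃ p, IsGaleVector H s t i₀ a q p} ∪
      {q | ∃ w : ℝ → ℝ, 0 ≤ w 1 ∧ 0 ≤ w (-1) ∧ w 1 + w (-1) = 1 ∧
        IsCriticalWith H s t a q w} := by
    rintro q ⟨w, hne, hw⟩
    by_cases hneg : w 1 * w (-1) < 0
    · exact Or.inl ⟨hw.1, hw.exists_isGaleVector hs hip ht hneg⟩
    · right
      rw [not_lt] at hneg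
      set l := w 1 + w (-1) with hl
      have hl0 : l ≠ 0 := by
        intro h0
        have : w (-1) = - w 1 := by linarith
        rw [this] at hneg
        have h1 : w 1 = 0 := by nlinarith
        rcases hne with h | h
        · exact h h1
        · exact h (by rw [this, h1, neg_zero])
      have hll := mul_self_pos.2 hl0
      refine ⟨fun σ => w σ / l, ?_, ?_, ?_, hw.1, hw.2.1, fun v hv => ?_⟩
      · change 0 ≤ w 1 / l
        rw [← mul_div_mul_right _ _ hl0]
        exact div_nonneg (by nlinarith [mul_self_nonneg (w 1)]) hll.le
      · change 0 ≤ w (-1) / l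
        rw [← mul_div_mul_right _ _ hl0]
        exact div_nonneg (by nlinarith [mul_self_nonneg (w (-1))]) hll.le
      · change w 1 / l + w (-1) / l = 1
        rw [← add_div, ← hl, div_self hl0]
      · change _ = (w 1 / l + w (-1) / l) * _
        rw [← add_div, ← hl, div_self hl0, one_mul]
        have := hw.2.2 v hv
        rw [← hl] at this
        rw [← mul_right_inj' hl0, ← this, Finset.mul_sum]
        refine Finset.sum_congr rfl fun i _ => ?_
        field_simp
  refine (encard_le_encard hsub).trans ((encard_union_le _ _).trans ?_)
  rw [Nat.cast_add, Nat.cast_one]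
  refine add_le_add hB ?_
  rw [encard_le_one_iff]
  rintro q q' ⟨w, h1, h2, h3, h4⟩ ⟨w', h1', h2', h3', h4'⟩
  exact (h4.eq_of_nonneg hs hip hH hgen h1 h2 h3 h4' h1' h2' h3').symm

theorem exists_isClopen_pairwise_disjoint {Y I : Type*} [TopologicalSpace Y] [T2Space Y]
    [CompactSpace Y] [Finite I] {p : I → Y}
    (hp : ∀ i j, i ≠ j → connectedComponent (p i) ≠ connectedComponent (p j)) :
    ∃ K : I → Set Y, (∀ i, IsClopen (K i)) ∧ (∀ i, p i ∈ K i) ∧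
      ∀ i j, i ≠ j → Disjoint (K i) (K j) := by
  classical
  have hZ : ∀ i j, ∃ Z : Set Y, IsClopen Z ∧ p i ∈ Z ∧ (i ≠ j → p j ∉ Z) := by
    intro i j
    by_cases hij : i = j
    · exact ⟨univ, isClopen_univ, mem_univ _, fun h => absurd hij h⟩
    · have h : p j ∉ connectedComponent (p i) := fun h =>
        hp i j hij (connectedComponent_eq h)
      rw [connectedComponent_eq_iInter_isClopen, mem_iInter, not_forall] at h
      obtain ⟨⟨Z, hZ, hi⟩, hj⟩ := h
      exact ⟨Z, hZ, hi, fun _ => hj⟩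
  choose Z hZc hZi hZj using hZ
  refine ⟨fun i => ⋂ j, if i = j then univ else Z i j \ Z j i, fun i => ?_, fun i => ?_, ?_⟩
  · refine isClopen_iInter_of_finite fun j => ?_
    split_ifs
    · exact isClopen_univ
    · exact (hZc i j).diff (hZc j i)
  · refine mem_iInter.2 fun j => ?_
    split_ifs with h
    · exact mem_univ _
    · exact ⟨hZi i j, hZj j i (Ne.symm h)⟩
  · intro i j hij
    rw [Set.disjoint_left]
    intro x hx hx'
    have h1 := mem_iInter.1 hx j
    have h2 := mem_iInter.1 hx' i
    rw [if_neg hij] at h1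
    rw [if_neg hij.symm] at h2
    exact h1.2 h2.1

theorem exists_pairwise_disjoint_compact_neighborhoods {E I : Type*} [MetricSpace E]
    [ProperSpace E] [Finite I] {X Y : Set E} (hY : IsCompact Y) (hYX : Y ⊆ X) {p : I → E}
    (hpY : ∀ i, p i ∈ Y)
    (hp : ∀ i j, i ≠ j → connectedComponentIn X (p i) ≠ connectedComponentIn X (p j)) :
    ∃ O C : I → Set E, (∀ i, IsOpen (O i)) ∧ (∀ i, IsCompact (C i)) ∧ (∀ i, O i ⊆ C i) ∧
      (∀ i, p i ∈ O i) ∧ (∀ i j, i ≠ j → Disjoint (C i) (C j)) ∧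
      ∀ i, Disjoint (C i \ O i) Y := by
  have : CompactSpace Y := isCompact_iff_compactSpace.1 hY
  obtain ⟨K, hK, hpK, hKd⟩ := exists_isClopen_pairwise_disjoint (Y := Y)
    (p := fun i => ⟨p i, hpY i⟩) fun i j hij heq => by
      refine hp i j hij ?_
      have h1 : p j ∈ connectedComponentIn Y (p i) := by
        rw [connectedComponentIn_eq_image (hpY i), heq]
        exact ⟨⟨p j, hpY j⟩, mem_connectedComponent, rfl⟩
      exact connectedComponentIn_eq (connectedComponentIn_mono _ hYX h1)
  have hKc : ∀ i, IsCompact (((↑) : Y → E) '' K i) := fun i =>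
    (hK i).isClosed.isCompact.image continuous_subtype_val
  have hKc' : ∀ i, IsCompact (((↑) : Y → E) '' (K i)ᶜ) := fun i =>
    (hK i).compl.isClosed.isCompact.image continuous_subtype_val
  have hdis : ∀ i, Disjoint (((↑) : Y → E) '' K i) (((↑) : Y → E) '' (K i)ᶜ) := fun i =>
    (disjoint_image_iff Subtype.val_injective).2 disjoint_compl_right
  have hδ : ∀ i, ∃ δ, 0 < δ ∧ Disjoint (Metric.cthickening δ (((↑) : Y → E) '' K i))
      (Metric.cthickening δ (((↑) : Y → E) '' (K i)ᶜ)) := fun i =>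
    (hdis i).exists_cthickenings (hKc i) (hKc' i).isClosed
  choose δ hδ0 hδ using hδ
  obtain ⟨ε, hε, hεδ⟩ : ∃ ε, 0 < ε ∧ ∀ i, ε ≤ δ i := by
    rcases isEmpty_or_nonempty I with h | h
    · exact ⟨1, one_pos, fun i => h.elim i⟩
    · obtain ⟨i, hi⟩ := Finite.exists_min δ
      exact ⟨δ i, hδ0 i, hi⟩
  refine ⟨fun i => Metric.thickening ε (((↑) : Y → E) '' K i),
    fun i => Metric.cthickening ε (((↑) : Y → E) '' K i), fun i => Metric.isOpen_thickening,
    fun i => (hKc i).cthickening, fun i => Metric.thickening_subset_cthickening _ _,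
    fun i => ?_, fun i j hij => ?_, fun i => ?_⟩
  · exact Metric.self_subset_thickening hε _ ⟨⟨p i, hpY i⟩, hpK i, rfl⟩
  · refine (hδ i).mono (Metric.cthickening_mono (hεδ i) _) ?_
    refine (Metric.cthickening_mono (hεδ i) _).trans (Metric.cthickening_subset_of_subset _ ?_)
    exact image_mono (hKd j i hij.symm).subset_compl_right
  · rw [Set.disjoint_left]
    rintro x ⟨hxC, hxO⟩ hxY
    by_cases hx : (⟨x, hxY⟩ : Y) ∈ K i
    · exact hxO (Metric.self_subset_thickening hε _ ⟨_, hx, rfl⟩)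
    · refine Set.disjoint_left.1 (hδ i) (Metric.cthickening_mono (hεδ i) _ hxC) ?_
      exact Metric.self_subset_cthickening _ ⟨_, hx, rfl⟩

theorem isCompact_height_le {ι : Type*} [Fintype ι] {H : Submodule ℝ (ι → ℝ)} {t : ι → ℝ}
    {i₀ : ι} (hH : ∀ v ∈ H, v i₀ = 0) (htpos : ∀ i, 0 < t i) (ht : ∑ i, t i = 1)
    (a : ι → ℝ) (R : ℝ) (hc : Continuous fun θ : H => height t a θ) :
    IsCompact {θ : H | height t a θ ≤ R} := by
  have : Nonempty ι := ⟨i₀⟩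
  refine Metric.isCompact_of_isClosed_isBounded (isClosed_le hc continuous_const) ?_
  obtain ⟨j₀, hj₀⟩ := Finite.exists_min t
  set A := ∑ i, |a i| with hA
  rw [isBounded_iff_forall_norm_le]
  refine ⟨|(R + A) / t j₀|, fun θ hθ => ?_⟩
  obtain ⟨i, hi⟩ := Finite.exists_max (θ : ι → ℝ)
  have h1 : a i + (θ : ι → ℝ) i ≤ Real.log (∑ i, Real.exp (a i + (θ : ι → ℝ) i)) := by
    rw [Real.le_log_iff_exp_le (Finset.sum_pos (fun _ _ => Real.exp_pos _) ⟨i, Finset.mem_univ _⟩)]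
    exact Finset.single_le_sum (f := fun i => Real.exp (a i + (θ : ι → ℝ) i))
      (fun _ _ => (Real.exp_pos _).le) (Finset.mem_univ i)
  have h2 : -A ≤ a i := by
    have h := Finset.single_le_sum (f := fun i => |a i|) (fun _ _ => abs_nonneg _)
      (Finset.mem_univ i)
    linarith [neg_abs_le (a i)]
  have h3 : ∑ j, t j * ((θ : ι → ℝ) i - (θ : ι → ℝ) j) ≤ R + A := by
    have hθ' : height t a θ ≤ R := hθ
    have : ∑ j, t j * ((θ : ι → ℝ) i - (θ : ι → ℝ) j) =
        (θ : ι → ℝ) i - ∑ j, t j * (θ : ι → ℝ) j := by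
      simp only [mul_sub, Finset.sum_sub_distrib, ← Finset.sum_mul, ht, one_mul]
    rw [this]
    rw [height] at hθ'
    linarith
  have h4 : ∀ j, (θ : ι → ℝ) i - (θ : ι → ℝ) j ≤ (R + A) / t j₀ := by
    intro j
    rw [le_div_iff₀ (htpos j₀)]
    have h5 : ∀ j, 0 ≤ t j * ((θ : ι → ℝ) i - (θ : ι → ℝ) j) := fun j =>
      mul_nonneg (htpos j).le (sub_nonneg.2 (hi j))
    have h6 := Finset.single_le_sum (fun j _ => h5 j) (Finset.mem_univ j)
    have h7 := mul_le_mul_of_nonneg_right (hj₀ j) (sub_nonneg.2 (hi j))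
    linarith
  have h0 : (θ : ι → ℝ) i₀ = 0 := hH _ θ.2
  have h8 := h4 i₀
  have h9 := hi i₀
  rw [h0] at h8 h9
  rw [Submodule.coe_norm, pi_norm_le_iff_of_nonneg (abs_nonneg _)]
  intro j
  rw [Real.norm_eq_abs]
  have hab := le_abs_self ((R + A) / t j₀)
  rw [abs_le]
  constructor <;> linarith [h4 j, hi j]

theorem continuous_signedSum {ι : Type*} [Fintype ι] (H : Submodule ℝ (ι → ℝ)) (s : ι → ℝ) :
    Continuous fun z : (ι → ℝ) × H => signedSum s z.1 z.2 := by
  have h : ∀ i, Continuous fun z : (ι → ℝ) × H => (z.2 : ι → ℝ) i := fun i =>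
    (continuous_apply i).comp (continuous_subtype_val.comp continuous_snd)
  exact continuous_finsetSum _ fun i _ => continuous_const.mul
    (Real.continuous_exp.comp (((continuous_apply i).comp continuous_fst).add (h i)))

theorem continuous_height {ι : Type*} [Fintype ι] [Nonempty ι] (H : Submodule ℝ (ι → ℝ))
    (t : ι → ℝ) : Continuous fun z : (ι → ℝ) × H => height t z.1 z.2 := by
  have h : ∀ i, Continuous fun z : (ι → ℝ) × H => (z.2 : ι → ℝ) i := fun i =>
    (continuous_apply i).comp (continuous_subtype_val.comp continuous_snd)
  refine Continuous.sub (Continuous.log (continuous_finsetSum _ fun i _ =>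
    Real.continuous_exp.comp (((continuous_apply i).comp continuous_fst).add (h i))) fun z => ?_)
    (continuous_finsetSum _ fun i _ => continuous_const.mul (h i))
  exact (Finset.sum_pos (fun _ _ => Real.exp_pos _) Finset.univ_nonempty).ne'

theorem exists_mem_perturbation {ι : Type*} [Finite ι] {s a₀ : ι → ℝ} (hs : ∀ i, s i * s i = 1)
    {G W : Set (ι → ℝ)} (hG : Dense G) (hW : W ∈ 𝓝 a₀) :
    ∃ a ∈ G, a ∈ W ∧ ∀ i, s i * (a i - a₀ i) < 0 := by
  obtain ⟨V, hVW, hV, haV⟩ := mem_nhds_iff.1 hW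
  have hD : IsOpen {a : ι → ℝ | ∀ i, s i * (a i - a₀ i) < 0} := by
    simp only [ofPred_forall]
    refine isOpen_iInter_of_finite fun i => isOpen_lt (by fun_prop) continuous_const
  have hne : (V ∩ {a : ι → ℝ | ∀ i, s i * (a i - a₀ i) < 0}).Nonempty := by
    have hcont : Continuous fun ε : ℝ => a₀ - ε • s := by fun_prop
    have h1 : ∀ᶠ ε : ℝ in 𝓝 0, a₀ - ε • s ∈ V := by
      refine hcont.continuousAt.eventually_mem (hV.mem_nhds ?_)
      simpa using haV
    obtain ⟨ε, hε, hεpos⟩ := ((h1.filter_mono nhdsWithin_le_nhds).and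
      (self_mem_nhdsWithin : Ioi (0 : ℝ) ∈ 𝓝[>] 0)).exists
    refine ⟨_, hε, fun i => ?_⟩
    have hp : (0 : ℝ) < ε := hεpos
    simp only [Pi.sub_apply, Pi.smul_apply, smul_eq_mul]
    nlinarith [hs i]
  obtain ⟨a, ⟨haV, haD⟩, haG⟩ := hG.inter_open_nonempty _ (hV.inter hD) hne
  exact ⟨a, haG, hVW haV, haD⟩

theorem eventually_forall_lt {A E : Type*} [TopologicalSpace A] [TopologicalSpace E]
    {h : A → E → ℝ} (hh : Continuous fun z : A × E => h z.1 z.2) {C : Set E} (hC : IsCompact C)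
    {a₀ : A} {R : ℝ} (h0 : ∀ θ ∈ C, h a₀ θ < R) : ∀ᶠ a in 𝓝 a₀, ∀ θ ∈ C, h a θ < R :=
  hC.eventually_forall_of_forall_eventually fun θ hθ =>
    (isOpen_lt hh continuous_const).mem_nhds (x := (a₀, θ)) (h0 θ hθ)

theorem eventually_forall_ne_or_lt {A E : Type*} [TopologicalSpace A] [TopologicalSpace E]
    {g h : A → E → ℝ} (hg : Continuous fun z : A × E => g z.1 z.2)
    (hh : Continuous fun z : A × E => h z.1 z.2) {C : Set E} (hC : IsCompact C) {a₀ : A} {R : ℝ}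
    (h0 : ∀ θ ∈ C, g a₀ θ ≠ 0 ∨ R < h a₀ θ) :
    ∀ᶠ a in 𝓝 a₀, ∀ θ ∈ C, g a θ ≠ 0 ∨ R < h a θ :=
  hC.eventually_forall_of_forall_eventually fun θ hθ =>
    ((isOpen_ne_fun hg continuous_const).union (isOpen_lt continuous_const hh)).mem_nhds
      (x := (a₀, θ)) (h0 θ hθ)

theorem card_le_of_encard_isCriticalWith_le {ι I : Type*} [Fintype ι] [Fintype I]
    {H : Submodule ℝ (ι → ℝ)} {s t a₀ : ι → ℝ} {i₀ ip : ι} {B : ℕ}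
    (hs : ∀ i, s i = 1 ∨ s i = -1) (hip : s ip = 1) (hH : ∀ v ∈ H, v i₀ = 0)
    (htpos : ∀ i, 0 < t i) (ht : ∑ i, t i = 1) {G : Set (ι → ℝ)} (hG : Dense G)
    (hB : ∀ a ∈ G, {q | ∃ w : ℝ → ℝ, (w 1 ≠ 0 ∨ w (-1) ≠ 0) ∧
      IsCriticalWith H s t a q w}.encard ≤ B)
    {p : I → H} (hp0 : ∀ i, signedSum s a₀ (p i) = 0)
    (hpc : ∀ i, p i ∈ closure {θ : H | 0 < signedSum s a₀ θ})
    (hp : ∀ i j, i ≠ j → connectedComponentIn {θ : H | signedSum s a₀ θ = 0} (p i) ≠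
      connectedComponentIn {θ : H | signedSum s a₀ θ = 0} (p j)) :
    Fintype.card I ≤ B := by
  have : Nonempty ι := ⟨i₀⟩
  have hss : ∀ i, s i * s i = 1 := fun i => by rcases hs i with h | h <;> rw [h] <;> norm_num
  have hcG := continuous_signedSum H s
  have hch := continuous_height H t
  have hcGa : ∀ a, Continuous fun θ : H => signedSum s a θ := fun a =>
    hcG.comp (Continuous.prodMk_right a)
  have hcha : ∀ a, Continuous fun θ : H => height t a θ := fun a =>
    hch.comp (Continuous.prodMk_right a)
  obtain ⟨R, hR⟩ : ∃ R, ∀ i, height t a₀ (p i) < R := by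
    obtain ⟨R, hR⟩ := (finite_range fun i => height t a₀ (p i)).bddAbove
    exact ⟨R + 1, fun i => by linarith [hR (mem_range_self i)]⟩
  set X : Set H := {θ : H | signedSum s a₀ θ = 0} with hX
  have hY : IsCompact (X ∩ {θ : H | height t a₀ θ ≤ R}) :=
    (isCompact_height_le hH htpos ht a₀ R (hcha a₀)).inter_left
      (isClosed_eq (hcGa a₀) continuous_const)
  obtain ⟨O, C, hO, hC, hOC, hpO, hCd, hCO⟩ :=
    exists_pairwise_disjoint_compact_neighborhoods hY inter_subset_left
      (fun i => ⟨hp0 i, (hR i).le⟩) hp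
  have hball : ∀ i, ∃ ε, 0 < ε ∧
      Metric.closedBall (p i) ε ⊆ O i ∩ {θ : H | height t a₀ θ < R} := fun i =>
    Metric.nhds_basis_closedBall.mem_iff.1
      (((hO i).inter (isOpen_lt (hcha a₀) continuous_const)).mem_nhds ⟨hpO i, hR i⟩)
  choose ε hε hball using hball
  have hp' : ∀ i, ∃ p' ∈ Metric.closedBall (p i) (ε i), 0 < signedSum s a₀ p' := fun i => by
    obtain ⟨p', h1, h2⟩ := mem_closure_iff_nhds.1 (hpc i) _ (Metric.closedBall_mem_nhds _ (hε i))
    exact ⟨p', h1, h2⟩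
  choose p' hp'b hp'pos using hp'
  have E1 : ∀ i, ∀ᶠ a in 𝓝 a₀, 0 < signedSum s a (p' i) := fun i =>
    (hcG.comp (Continuous.prodMk_left (p' i))).continuousAt.eventually_const_lt (hp'pos i)
  have E2 : ∀ i, ∀ᶠ a in 𝓝 a₀, ∀ θ ∈ Metric.closedBall (p i) (ε i), height t a θ < R := fun i =>
    eventually_forall_lt hch (isCompact_closedBall _ _) fun θ hθ => (hball i hθ).2
  have E3 : ∀ i, ∀ᶠ a in 𝓝 a₀, ∀ θ ∈ C i \ O i, signedSum s a θ ≠ 0 ∨ R < height t a θ := fun i =>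
    eventually_forall_ne_or_lt hcG hch ((hC i).diff (hO i)) fun θ hθ => by
      by_contra! hcon
      exact Set.disjoint_left.1 (hCO i) hθ hcon
  obtain ⟨a, haG, haW, haD⟩ := exists_mem_perturbation hss hG
    (((eventually_all.2 E1).and (eventually_all.2 E2)).and (eventually_all.2 E3))
  obtain ⟨⟨h1, h2⟩, h3⟩ := haW
  have hneg : ∀ i, signedSum s a (p i) < 0 := by
    intro i
    rw [← hp0 i]
    refine Finset.sum_lt_sum_of_nonempty Finset.univ_nonempty fun j _ => ?_
    have := haD j
    rcases hs j with hj | hj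
    · rw [hj] at this ⊢
      have := Real.exp_lt_exp.2 (show a j + (p i : ι → ℝ) j < a₀ j + (p i : ι → ℝ) j by linarith)
      linarith
    · rw [hj] at this ⊢
      have := Real.exp_lt_exp.2 (show a₀ j + (p i : ι → ℝ) j < a j + (p i : ι → ℝ) j by linarith)
      linarith
  have hq : ∀ i, ∃ q ∈ C i, ∃ w : ℝ → ℝ, (w 1 ≠ 0 ∨ w (-1) ≠ 0) ∧
      IsCriticalWith H s t a q w := by
    intro i
    obtain ⟨r, hrb, hr0⟩ := (convex_closedBall (p i) (ε i)).isPreconnected.intermediate_value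
      (Metric.mem_closedBall_self (hε i).le) (hp'b i) (hcGa a).continuousOn
      ⟨(hneg i).le, (h1 i).le⟩
    have hS : IsCompact (C i ∩ {θ : H | signedSum s a θ = 0}) :=
      (hC i).inter_right (isClosed_eq (hcGa a) continuous_const)
    obtain ⟨q, ⟨hqC, hq0⟩, hqmin⟩ := hS.exists_isMinOn
      ⟨r, hOC i (hball i hrb).1, hr0⟩ (hcha a).continuousOn
    have hqR : height t a q < R :=
      (hqmin ⟨hOC i (hball i hrb).1, hr0⟩).trans_lt (h2 i r hrb)
    have hqO : q ∈ O i := by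
      by_contra hqO
      rcases h3 i q ⟨hqC, hqO⟩ with h | h
      · exact h hq0
      · exact lt_asymm h hqR
    refine ⟨q, hqC, exists_isCriticalWith hs hip hq0 ?_⟩
    filter_upwards [inter_mem (mem_nhdsWithin_of_mem_nhds ((hO i).mem_nhds hqO))
      self_mem_nhdsWithin] with θ hθ
    exact hqmin ⟨hOC i hθ.1, hθ.2⟩
  choose q hqC hq using hq
  have hinj : Function.Injective fun i => (q i : ι → ℝ) := by
    intro i j hij
    by_contra hne
    have : q i = q j := Subtype.ext hij
    exact Set.disjoint_left.1 (hCd i j hne) (hqC i) (this ▸ hqC j)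
  have hle := (encard_le_encard (s := range fun i => (q i : ι → ℝ))
    (range_subset_iff.2 hq)).trans (hB a haG)
  rw [← image_univ, hinj.encard_image, encard_univ, ENat.card_eq_coe_fintype_card] at hle
  exact_mod_cast hle

theorem encard_zeros_le_of_hasDerivAt {f f' : ℝ → ℝ} {m : ℕ} (hf : ∀ x, HasDerivAt f (f' x) x)
    (hm : {x | f' x = 0}.encard ≤ m) : {x | f x = 0}.encard ≤ (m + 1 : ℕ) := by
  classical
  refine RolleData.encard_le_of_forall_finite fun P hP hfin => ?_
  by_contra! hlt
  have hcard : m + 2 ≤ hfin.toFinset.card := by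
    rw [hfin.encard_eq_coe_toFinset_card] at hlt
    have := Nat.cast_lt.1 hlt
    omega
  obtain ⟨Q, hQP, hQ⟩ := Finset.exists_subset_card_eq hcard
  set z := Q.orderEmbOfFin hQ with hz
  have hz0 : ∀ j, f (z j) = 0 := fun j =>
    hP (hfin.mem_toFinset.1 (hQP (Q.orderEmbOfFin_mem hQ j)))
  have hξ : ∀ j : Fin (m + 1), ∃ ξ ∈ Ioo (z j.castSucc) (z j.succ), f' ξ = 0 := fun j =>
    exists_hasDerivAt_eq_zero (z.strictMono j.castSucc_lt_succ)
      (fun x _ => (hf x).continuousAt.continuousWithinAt) (by rw [hz0, hz0]) fun x _ => hf x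
  choose ξ hξ hξ0 using hξ
  have hmono : StrictMono ξ := by
    refine Fin.strictMono_iff_lt_succ.2 fun j => ?_
    exact (hξ j.castSucc).2.trans (by simpa using (hξ j.succ).1)
  have h1 : (range ξ).encard ≤ m :=
    (encard_le_encard (range_subset_iff.2 hξ0)).trans hm
  rw [← image_univ, hmono.injective.encard_image, encard_univ, ENat.card_eq_coe_fintype_card,
    Fintype.card_fin, Nat.cast_le] at h1
  omega

theorem encard_zeros_expSum_le {ι : Type*} (S : Finset ι) {d : ι → ℝ} (hd : InjOn d S) :
    ∀ {c : ι → ℝ}, (∀ i ∈ S, c i ≠ 0) → S.Nonempty →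
      {x : ℝ | ∑ i ∈ S, c i * Real.exp (d i * x) = 0}.encard ≤ (S.card - 1 : ℕ) := by
  classical
  induction S using Finset.induction_on with
  | empty => simp
  | insert j S hj ih =>
    intro c hc _
    rcases S.eq_empty_or_nonempty with rfl | hS
    · simp [hc j (by simp)]
    have hne : ∀ i ∈ S, d i - d j ≠ 0 := fun i hi h => by
      have := hd (Finset.mem_insert_of_mem hi) (Finset.mem_insert_self j S) (sub_eq_zero.1 h)
      exact hj (this ▸ hi)
    have hd' : InjOn d S := hd.mono (by simp)
    have key : {x : ℝ | ∑ i ∈ insert j S, c i * Real.exp (d i * x) = 0} =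
        {x : ℝ | c j + ∑ i ∈ S, c i * Real.exp ((d i - d j) * x) = 0} := by
      ext x
      simp only [mem_ofPred_eq, Finset.sum_insert hj]
      have : c j * Real.exp (d j * x) + ∑ i ∈ S, c i * Real.exp (d i * x) =
          Real.exp (d j * x) * (c j + ∑ i ∈ S, c i * Real.exp ((d i - d j) * x)) := by
        rw [mul_add, Finset.mul_sum, mul_comm]
        congr 1
        refine Finset.sum_congr rfl fun i _ => ?_
        rw [mul_left_comm, ← Real.exp_add]
        ring_nf
      rw [this, mul_eq_zero, or_iff_right (Real.exp_pos _).ne']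
    have hder : ∀ x : ℝ, HasDerivAt
        (fun x : ℝ => c j + ∑ i ∈ S, c i * Real.exp ((d i - d j) * x))
        (∑ i ∈ S, c i * (Real.exp ((d i - d j) * x) * (d i - d j))) x := fun x => by
      refine HasDerivAt.const_add _ (HasDerivAt.fun_sum fun i _ => HasDerivAt.const_mul _ ?_)
      have := ((hasDerivAt_id x).const_mul (d i - d j)).exp
      simpa using this
    have key2 : {x : ℝ | ∑ i ∈ S, c i * (Real.exp ((d i - d j) * x) * (d i - d j)) = 0} =
        {x : ℝ | ∑ i ∈ S, (c i * (d i - d j)) * Real.exp (d i * x) = 0} := by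
      ext x
      simp only [mem_ofPred_eq]
      have : ∑ i ∈ S, (c i * (d i - d j)) * Real.exp (d i * x) = Real.exp (d j * x) *
          ∑ i ∈ S, c i * (Real.exp ((d i - d j) * x) * (d i - d j)) := by
        rw [Finset.mul_sum]
        refine Finset.sum_congr rfl fun i _ => ?_
        rw [show d i * x = d j * x + (d i - d j) * x by ring, Real.exp_add]
        ring
      rw [this, mul_eq_zero, or_iff_right (Real.exp_pos _).ne']
    have h1 := ih hd' (c := fun i => c i * (d i - d j))
      (fun i hi => mul_ne_zero (hc i (Finset.mem_insert_of_mem hi)) (hne i hi)) hS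
    rw [← key2] at h1
    rw [key, Finset.card_insert_of_notMem hj]
    have := encard_zeros_le_of_hasDerivAt hder h1
    rwa [Nat.sub_add_cancel hS.card_pos] at this

theorem exists_mem_injective {ι : Type*} [Finite ι] {H : Submodule ℝ (ι → ℝ)}
    (hH : ∀ i j, i ≠ j → ∃ θ ∈ H, θ i ≠ θ j) : ∃ d ∈ H, Function.Injective d := by
  classical
  let p : {x : ι × ι // x.1 ≠ x.2} → Submodule ℝ H := fun x =>
    LinearMap.ker (((LinearMap.proj x.1.1 : (ι → ℝ) →ₗ[ℝ] ℝ) - LinearMap.proj x.1.2) ∘ₗ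
      H.subtype)
  by_contra! hcon
  have hcov : ⋃ x, (p x : Set H) = univ := by
    refine eq_univ_of_forall fun θ => mem_iUnion.2 ?_
    have := hcon θ θ.2
    simp only [Function.Injective, not_forall] at this
    obtain ⟨i, j, h, hij⟩ := this
    exact ⟨⟨(i, j), hij⟩, by simp [p, h]⟩
  obtain ⟨⟨⟨i, j⟩, hij⟩, hx⟩ := Subspace.exists_eq_top_of_iUnion_eq_univ hcov
  obtain ⟨θ, hθ, hne⟩ := hH i j hij
  have : (⟨θ, hθ⟩ : H) ∈ p ⟨(i, j), hij⟩ := hx ▸ Submodule.mem_top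
  exact hne (by simpa [p, sub_eq_zero] using this)

theorem isOpen_dense_sum_mul_ne_zero {ι : Type*} [Fintype ι] {u : ι → ℝ} (hu : u ≠ 0) :
    IsOpen {t : ι → ℝ | ∑ i, t i * u i ≠ 0} ∧ Dense {t : ι → ℝ | ∑ i, t i * u i ≠ 0} := by
  classical
  have hc : Continuous fun t : ι → ℝ => ∑ i, t i * u i := by fun_prop
  refine ⟨isOpen_ne_fun hc continuous_const, fun t => ?_⟩
  have hpos : ∑ i, u i * u i ≠ 0 := by
    intro h
    refine hu (funext fun i => ?_)
    have := (Finset.sum_eq_zero_iff_of_nonneg fun i _ => mul_self_nonneg (u i)).1 h i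
      (Finset.mem_univ i)
    simpa using this
  by_cases ht : ∑ i, t i * u i = 0
  · have hlim : Tendsto (fun r : ℝ => t + r • u) (𝓝[≠] 0) (𝓝 t) := by
      have : Continuous fun r : ℝ => t + r • u := by fun_prop
      simpa using (this.tendsto 0).mono_left nhdsWithin_le_nhds
    refine mem_closure_of_tendsto hlim ?_
    filter_upwards [self_mem_nhdsWithin] with r hr
    simp only [Pi.add_apply, Pi.smul_apply, smul_eq_mul, add_mul,
      Finset.sum_add_distrib, ht, zero_add, mul_assoc, ← Finset.mul_sum]
    exact mul_ne_zero hr hpos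
  · exact subset_closure ht

theorem exists_ne_zero_genericWeights {ι : Type*} [Fintype ι] {H : Submodule ℝ (ι → ℝ)}
    {s : ι → ℝ} {i₀ : ι} (hH : ∀ v ∈ H, v i₀ = 0) (σ : ℝ) :
    ∃ u : ι → ℝ, u ≠ 0 ∧ ∀ t : ι → ℝ, ∑ i, t i = 1 → ∑ i, t i * u i ≠ 0 →
      GenericWeights H s t σ := by
  by_cases h : ∀ d ∈ H, ∀ δ : ℝ, (∀ i, s i = σ → d i = δ) → d = 0
  · exact ⟨fun _ => 1, fun h => one_ne_zero (congrFun h i₀), fun t _ _ => Or.inl h⟩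
  · push Not at h
    obtain ⟨d, hd, δ, hδ, hne⟩ := h
    refine ⟨fun i => d i - δ, fun h => hne ?_, fun t ht htu => Or.inr ⟨d, hd, δ, hδ, ?_⟩⟩
    · have h0 : δ = 0 := by
        have := congrFun h i₀
        simp only [hH d hd, Pi.zero_apply] at this
        linarith
      funext i
      have := congrFun h i
      simp only [h0, Pi.zero_apply, sub_zero] at this
      exact this
    · simp only [mul_sub, Finset.sum_sub_distrib, ← Finset.sum_mul, ht, one_mul] at htu
      exact sub_ne_zero.1 htu

theorem exists_genericWeights {ι : Type*} [Fintype ι] {H : Submodule ℝ (ι → ℝ)}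
    {s : ι → ℝ} {i₀ : ι} (hH : ∀ v ∈ H, v i₀ = 0) :
    ∃ t : ι → ℝ, (∀ i, 0 < t i) ∧ ∑ i, t i = 1 ∧
      ∀ σ, (σ = 1 ∨ σ = -1) → GenericWeights H s t σ := by
  obtain ⟨u, hu, hut⟩ := exists_ne_zero_genericWeights (s := s) hH 1
  obtain ⟨v, hv, hvt⟩ := exists_ne_zero_genericWeights (s := s) hH (-1)
  obtain ⟨hou, hdu⟩ := isOpen_dense_sum_mul_ne_zero hu
  obtain ⟨hov, hdv⟩ := isOpen_dense_sum_mul_ne_zero hv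
  have hpos : IsOpen {t : ι → ℝ | ∀ i, 0 < t i} := by
    have : {t : ι → ℝ | ∀ i, 0 < t i} = ⋂ i, {t : ι → ℝ | 0 < t i} := by ext; simp
    rw [this]
    exact isOpen_iInter_of_finite fun i => isOpen_lt continuous_const (continuous_apply i)
  obtain ⟨t, ht, htu, htv⟩ := (hdu.inter_of_isOpen_left hdv hou).inter_open_nonempty _ hpos
    ⟨fun _ => 1, fun _ => one_pos⟩
  have hS : 0 < ∑ i, t i := Finset.sum_pos (fun i _ => ht i) ⟨i₀, Finset.mem_univ _⟩
  have hsum : ∑ i, t i / ∑ i, t i = 1 := by rw [← Finset.sum_div, div_self hS.ne']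
  have hdiv : ∀ w : ι → ℝ, ∑ i, t i * w i ≠ 0 → ∑ i, (t i / ∑ i, t i) * w i ≠ 0 := by
    intro w hw
    simp only [div_mul_eq_mul_div, ← Finset.sum_div]
    exact div_ne_zero hw hS.ne'
  refine ⟨fun i => t i / ∑ i, t i, fun i => div_pos (ht i) hS, hsum, ?_⟩
  rintro σ (rfl | rfl)
  · exact hut _ hsum (hdiv u htu)
  · exact hvt _ hsum (hdiv v htv)

theorem card_le_galeBound_of_mem_closure_pos {ι I : Type*} [Fintype ι] [Fintype I] {n k : ℕ}
    {H : Submodule ℝ (ι → ℝ)} {s a : ι → ℝ} {i₀ ip im : ι} (hH : ∀ v ∈ H, v i₀ = 0)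
    (hn : Module.finrank ℝ H = n) (hcard : Fintype.card ι = n + k + 1)
    (hs : ∀ i, s i = 1 ∨ s i = -1) (hip : s ip = 1) (him : s im = -1)
    {p : I → H} (hp0 : ∀ i, signedSum s a (p i) = 0)
    (hpc : ∀ i, p i ∈ closure {θ : H | 0 < signedSum s a θ})
    (hp : ∀ i j, i ≠ j → connectedComponentIn {θ : H | signedSum s a θ = 0} (p i) ≠
      connectedComponentIn {θ : H | signedSum s a θ = 0} (p j)) :
    Fintype.card I ≤ galeBound n k + 1 := by
  obtain ⟨t, htpos, ht, hgen⟩ := exists_genericWeights (s := s) hH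
  obtain ⟨G, hG, hB⟩ := exists_dense_encard_isGaleVector_le hH hn hcard hs hip him htpos ht
  exact card_le_of_encard_isCriticalWith_le hs hip hH htpos ht hG
    (fun a ha => encard_isCriticalWith_le hs hip hH ht hgen (hB a ha)) hp0 hpc hp

theorem signedSum_neg {ι : Type*} [Fintype ι] (s a θ : ι → ℝ) :
    signedSum (-s) a θ = -signedSum s a θ := by
  simp [signedSum]

theorem signedSum_smul {ι : Type*} [Fintype ι] (s a d : ι → ℝ) (x : ℝ) :
    signedSum s a (x • d) = ∑ i, (s i * Real.exp (a i)) * Real.exp (d i * x) := by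
  refine Finset.sum_congr rfl fun i _ => ?_
  rw [Real.exp_add, Pi.smul_apply, smul_eq_mul, mul_comm x, mul_assoc]

theorem encard_signedSum_line_le {ι : Type*} [Fintype ι] [Nonempty ι] {s a d θ : ι → ℝ}
    (hs : ∀ i, s i = 1 ∨ s i = -1) (hd : Function.Injective d) :
    {x : ℝ | signedSum s a (θ + x • d) = 0}.encard ≤ (Fintype.card ι - 1 : ℕ) := by
  have h := encard_zeros_expSum_le Finset.univ (d := d) hd.injOn
    (c := fun i => s i * Real.exp (a i + θ i)) (fun i _ => mul_ne_zero
      (by rcases hs i with h | h <;> rw [h] <;> norm_num) (Real.exp_pos _).ne')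
    Finset.univ_nonempty
  rw [Finset.card_univ] at h
  convert h using 4 with x
  have : signedSum s a (θ + x • d) = signedSum s (a + θ) (x • d) := by
    simp only [signedSum, Pi.add_apply, add_assoc]
  rw [this, signedSum_smul]
  rfl

theorem mem_closure_signedSum_ne_zero {ι : Type*} [Fintype ι] [Nonempty ι]
    {H : Submodule ℝ (ι → ℝ)} {s a : ι → ℝ} (hs : ∀ i, s i = 1 ∨ s i = -1)
    (hd : ∃ d ∈ H, Function.Injective d) (θ : H) :
    θ ∈ closure {θ : H | signedSum s a θ ≠ 0} := by
  obtain ⟨d, hd, hinj⟩ := hd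
  have hfin : {x : ℝ | signedSum s a (θ + x • d) = 0}.Finite :=
    finite_of_encard_le_coe (encard_signedSum_line_le hs hinj)
  have hlim : Tendsto (fun r : ℝ => θ + r • (⟨d, hd⟩ : H)) (𝓝[≠] 0) (𝓝 θ) := by
    have : Continuous fun r : ℝ => θ + r • (⟨d, hd⟩ : H) := by fun_prop
    simpa using (this.tendsto 0).mono_left nhdsWithin_le_nhds
  refine mem_closure_of_tendsto hlim ?_
  have h1 : ({x : ℝ | signedSum s a (θ + x • d) = 0} \ {0})ᶜ ∈ 𝓝 (0 : ℝ) :=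
    (hfin.sdiff.isClosed.isOpen_compl).mem_nhds (by simp)
  filter_upwards [self_mem_nhdsWithin, mem_nhdsWithin_of_mem_nhds h1] with r hr hr' h
  exact hr' ⟨h, hr⟩

theorem card_le_two_mul_galeBound {ι I : Type*} [Fintype ι] [Fintype I] {n k : ℕ}
    {H : Submodule ℝ (ι → ℝ)} {s a : ι → ℝ} {i₀ : ι} (hH : ∀ v ∈ H, v i₀ = 0)
    (hn : Module.finrank ℝ H = n) (hcard : Fintype.card ι = n + k + 1)
    (hs : ∀ i, s i = 1 ∨ s i = -1) (hd : ∃ d ∈ H, Function.Injective d)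
    {p : I → H} (hp0 : ∀ i, signedSum s a (p i) = 0)
    (hp : ∀ i j, i ≠ j → connectedComponentIn {θ : H | signedSum s a θ = 0} (p i) ≠
      connectedComponentIn {θ : H | signedSum s a θ = 0} (p j)) :
    Fintype.card I ≤ 2 * (galeBound n k + 1) := by
  classical
  have : Nonempty ι := ⟨i₀⟩
  rcases isEmpty_or_nonempty I with hI | ⟨⟨j⟩⟩
  · simp
  have hip : ∃ ip, s ip = 1 := by
    by_contra! h
    have : signedSum s a (p j) < 0 := Finset.sum_neg (fun i _ => by
      rw [(hs i).resolve_left (h i)]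
      linarith [Real.exp_pos (a i + (p j : ι → ℝ) i)]) Finset.univ_nonempty
    exact this.ne (hp0 j)
  have him : ∃ im, s im = -1 := by
    by_contra! h
    have : 0 < signedSum s a (p j) := Finset.sum_pos (fun i _ => by
      rw [(hs i).resolve_right (h i)]
      linarith [Real.exp_pos (a i + (p j : ι → ℝ) i)]) Finset.univ_nonempty
    exact this.ne' (hp0 j)
  obtain ⟨ip, hip⟩ := hip
  obtain ⟨im, him⟩ := him
  have hcl : ∀ i, p i ∈ closure {θ : H | 0 < signedSum s a θ} ∨
      p i ∈ closure {θ : H | 0 < signedSum (-s) a θ} := fun i => by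
    rw [← mem_union, ← closure_union]
    refine closure_mono ?_ (mem_closure_signedSum_ne_zero (a := a) hs hd (p i))
    intro θ hθ
    rcases lt_or_gt_of_ne hθ with h | h
    · exact Or.inr (by simpa [signedSum_neg] using h)
    · exact Or.inl h
  have hX : {θ : H | signedSum (-s) a θ = 0} = {θ : H | signedSum s a θ = 0} := by
    simp [signedSum_neg]
  have h1 : Fintype.card {i // p i ∈ closure {θ : H | 0 < signedSum s a θ}} ≤
      galeBound n k + 1 :=
    card_le_galeBound_of_mem_closure_pos hH hn hcard hs hip him (p := fun i => p i.1)
      (fun i => hp0 i) (fun i => i.2) fun i j hij => hp i j fun h => hij (Subtype.ext h)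
  have h2 : Fintype.card {i // ¬ p i ∈ closure {θ : H | 0 < signedSum s a θ}} ≤
      galeBound n k + 1 :=
    card_le_galeBound_of_mem_closure_pos (s := -s) (ip := im) (im := ip) hH hn hcard
      (fun i => by rcases hs i with h | h <;> simp [h]) (by simp [him]) (by simp [hip])
      (p := fun i => p i.1)
      (fun i => by simp [signedSum_neg, hp0 i]) (fun i => (hcl i).resolve_left i.2)
      fun i j hij => by
        rw [hX]
        exact hp i j fun h => hij (Subtype.ext h)
  have := Fintype.card_subtype_compl fun i => p i ∈ closure {θ : H | 0 < signedSum s a θ}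
  have h3 := Fintype.card_subtype_le fun i => p i ∈ closure {θ : H | 0 < signedSum s a θ}
  omega

theorem card_le_of_finrank_eq_one {ι I : Type*} [Fintype ι] [Nonempty ι] [Fintype I]
    {H : Submodule ℝ (ι → ℝ)} {s a : ι → ℝ} (hn : Module.finrank ℝ H = 1)
    (hs : ∀ i, s i = 1 ∨ s i = -1) (hd : ∃ d ∈ H, Function.Injective d)
    (hnt : 1 < Fintype.card ι)
    {p : I → H} (hp0 : ∀ i, signedSum s a (p i) = 0) (hp : Function.Injective p) :
    Fintype.card I ≤ Fintype.card ι - 1 := by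
  obtain ⟨d, hdH, hd⟩ := hd
  have hd0 : (⟨d, hdH⟩ : H) ≠ 0 := fun h => by
    obtain ⟨i, j, hij⟩ := Fintype.exists_pair_of_one_lt_card hnt
    have h' : d = 0 := congrArg Subtype.val h
    exact hij (hd (by simp [h']))
  have hspan := (finrank_eq_one_iff_of_nonzero' _ hd0).1 hn
  choose x hx using fun i => hspan (p i)
  have hxinj : Function.Injective x := fun i j h => hp (by rw [← hx i, ← hx j, h])
  have h1 : (range x).encard ≤ (Fintype.card ι - 1 : ℕ) := by
    refine (encard_le_encard (range_subset_iff.2 fun i => ?_)).trans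
      (encard_signedSum_line_le (a := a) (θ := 0) hs hd)
    have := hp0 i
    rw [← hx i] at this
    simpa using this
  rw [← image_univ, hxinj.encard_image, encard_univ, ENat.card_eq_coe_fintype_card,
    Nat.cast_le] at h1
  exact h1

theorem mul_seven_quarters_pow_le (k : ℕ) : (k : ℝ) * (7 / 4) ^ k ≤ 7 * 2 ^ k := by
  have h := one_add_mul_le_pow (a := (1 / 7 : ℝ)) (by norm_num) k
  have h2 : (2 : ℝ) ^ k = (1 + 1 / 7) ^ k * (7 / 4) ^ k := by rw [← mul_pow]; norm_num
  have h3 : (0 : ℝ) < (7 / 4) ^ k := by positivity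
  rw [h2]
  nlinarith

theorem galeBound_succ_eq (n k : ℕ) : (galeBound n (k + 1) : ℝ) =
    2 ^ (k + 1).choose 2 * ((k + 1) * (n + 2) * (n + 3 / 2) ^ k + (n + 1) ^ (k + 1)) := by
  have h : (k + 1).choose 2 = k + k.choose 2 := by
    rw [Nat.choose_succ_succ' k 1, Nat.choose_one_right]
  rw [galeBound]
  push_cast
  rw [h, pow_add, show (2 * n + 3 : ℝ) = 2 * (n + 3 / 2) by ring, mul_pow]
  ring

theorem galeBound_succ_add_one_le {n : ℕ} (hn : 2 ≤ n) (k : ℕ) :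
    (galeBound n (k + 1) : ℝ) + 1 ≤
      2 ^ (k + 1).choose 2 * (10 * 2 ^ (k + 1) * n ^ (k + 1)) := by
  have hn' : (2 : ℝ) ≤ n := by exact_mod_cast hn
  have h1 : ((k + 1 : ℝ)) * (n + 2) * (n + 3 / 2) ^ k ≤
      (k + 1) * (2 * n) * (7 / 4 * n) ^ k := by
    gcongr <;> linarith
  have h2 : ((n : ℝ) + 1) ^ (k + 1) ≤ (3 / 2 * n) ^ (k + 1) := by
    gcongr; linarith
  have h3 : (1 : ℝ) ≤ 2 ^ (k + 1).choose 2 := one_le_pow₀ (by norm_num)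
  have h4 := mul_seven_quarters_pow_le (k + 1)
  have h5 : (3 / 2 : ℝ) ^ (k + 1) + 1 ≤ 2 * 2 ^ (k + 1) := by
    have : (3 / 2 : ℝ) ^ (k + 1) ≤ 2 ^ (k + 1) := by gcongr; norm_num
    have : (1 : ℝ) ≤ 2 ^ (k + 1) := one_le_pow₀ (by norm_num)
    linarith
  have h6 : (1 : ℝ) ≤ n ^ (k + 1) := one_le_pow₀ (by linarith)
  have h7 : (0 : ℝ) ≤ 2 ^ (k + 1) := by positivity
  rw [galeBound_succ_eq]
  have key : ((k + 1 : ℝ)) * (n + 2) * (n + 3 / 2) ^ k + (n + 1) ^ (k + 1) + 1 ≤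
      10 * 2 ^ (k + 1) * n ^ (k + 1) := by
    have e1 : ((k + 1 : ℝ)) * (2 * n) * (7 / 4 * n) ^ k =
        8 / 7 * (((k + 1 : ℕ) : ℝ) * (7 / 4) ^ (k + 1)) * n ^ (k + 1) := by
      push_cast
      rw [mul_pow]
      ring
    rw [mul_pow] at h2
    have e2 : 8 / 7 * (((k + 1 : ℕ) : ℝ) * (7 / 4) ^ (k + 1)) * n ^ (k + 1) ≤
        8 / 7 * (7 * 2 ^ (k + 1)) * (n : ℝ) ^ (k + 1) := by gcongr
    have e3 : ((3 / 2 : ℝ) ^ (k + 1) + 1) * n ^ (k + 1) ≤ 2 * 2 ^ (k + 1) * n ^ (k + 1) := by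
      gcongr
    nlinarith
  nlinarith

theorem le_exp_two_add_three_div_four : (5 / 2 : ℝ) ≤ (Real.exp 1 ^ 2 + 3) / 4 := by
  nlinarith [Real.exp_one_gt_d9]

theorem galeBound_add_one_le {n : ℕ} (hn : 2 ≤ n) (k : ℕ) : (galeBound n k : ℝ) + 1 ≤
    (Real.exp 1 ^ 2 + 3) / 4 * 2 ^ (k * (k + 1) / 2) * 2 ^ n * (n : ℝ) ^ (k + 1) := by
  have hn' : (2 : ℝ) ≤ n := by exact_mod_cast hn
  have he := le_exp_two_add_three_div_four
  have h4 : (4 : ℝ) ≤ 2 ^ n := by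
    calc (4 : ℝ) = 2 ^ 2 := by norm_num
      _ ≤ 2 ^ n := pow_le_pow_right₀ (by norm_num) hn
  have hstep : (5 / 2 : ℝ) * 2 ^ (k * (k + 1) / 2) * 4 * (n : ℝ) ^ (k + 1) ≤
      (Real.exp 1 ^ 2 + 3) / 4 * 2 ^ (k * (k + 1) / 2) * 2 ^ n * (n : ℝ) ^ (k + 1) := by
    gcongr
  refine le_trans ?_ hstep
  cases k with
  | zero => simp [galeBound]; linarith
  | succ k =>
    have hc : (k + 1) * (k + 1 + 1) / 2 = (k + 1) + (k + 1).choose 2 := by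
      have h := Nat.choose_succ_succ' (k + 1) 1
      rw [Nat.choose_one_right, Nat.choose_two_right, Nat.add_sub_cancel] at h
      rw [← h, mul_comm]
    have h := galeBound_succ_add_one_le hn k
    rw [hc, pow_add]
    refine h.trans ?_
    have hpow : (n : ℝ) ^ (k + 1) ≤ n ^ (k + 1 + 1) :=
      pow_le_pow_right₀ (by linarith) (Nat.le_succ _)
    calc (2 : ℝ) ^ (k + 1).choose 2 * (10 * 2 ^ (k + 1) * n ^ (k + 1))
        ≤ 2 ^ (k + 1).choose 2 * (10 * 2 ^ (k + 1) * n ^ (k + 1 + 1)) := by gcongr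
      _ = _ := by ring

theorem succ_le_bound (k : ℕ) : (k : ℝ) + 1 ≤
    (Real.exp 1 ^ 2 + 3) / 4 * 2 ^ (k * (k + 1) / 2) := by
  have he := le_exp_two_add_three_div_four
  have h1 : ((k + 1 : ℕ) : ℝ) ≤ ((2 ^ k : ℕ) : ℝ) := Nat.cast_le.2 Nat.lt_two_pow_self
  have h2 : k ≤ k * (k + 1) / 2 := by
    rcases k with _ | k
    · simp
    · rw [Nat.le_div_iff_mul_le two_pos]
      exact Nat.mul_le_mul_left _ (by omega)
  have h3 : (2 : ℝ) ^ k ≤ 2 ^ (k * (k + 1) / 2) := pow_le_pow_right₀ (by norm_num) h2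
  push_cast at h1
  have h4 : (0 : ℝ) ≤ 2 ^ (k * (k + 1) / 2) := by positivity
  nlinarith

theorem card_le_fewnomial_bound {ι I : Type*} [Fintype ι] [Fintype I] {n k : ℕ} (hn1 : 1 ≤ n)
    {H : Submodule ℝ (ι → ℝ)} {s a : ι → ℝ} {i₀ : ι} (hH : ∀ v ∈ H, v i₀ = 0)
    (hn : Module.finrank ℝ H = n) (hcard : Fintype.card ι = n + k + 1)
    (hs : ∀ i, s i = 1 ∨ s i = -1) (hd : ∃ d ∈ H, Function.Injective d)
    {p : I → H} (hp0 : ∀ i, signedSum s a (p i) = 0)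
    (hp : ∀ i j, i ≠ j → connectedComponentIn {θ : H | signedSum s a θ = 0} (p i) ≠
      connectedComponentIn {θ : H | signedSum s a θ = 0} (p j)) :
    (Fintype.card I : ℝ) ≤
      2 * ((Real.exp 1 ^ 2 + 3) / 4 * 2 ^ (k * (k + 1) / 2) * 2 ^ n * (n : ℝ) ^ (k + 1)) := by
  rcases hn1.eq_or_lt with rfl | hn2
  · have : Nonempty ι := ⟨i₀⟩
    have h := card_le_of_finrank_eq_one hn hs hd (by omega) hp0 fun i j h => by
      by_contra hij
      exact hp i j hij (by rw [h])
    have h' : (Fintype.card I : ℝ) ≤ k + 1 := by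
      exact_mod_cast (by omega : Fintype.card I ≤ k + 1)
    have hb := succ_le_bound k
    have : (0 : ℝ) ≤ k := Nat.cast_nonneg k
    simp only [Nat.cast_one, one_pow, pow_one, mul_one]
    linarith
  · have h := card_le_two_mul_galeBound hH hn hcard hs hd hp0 hp
    have h' : (Fintype.card I : ℝ) ≤ 2 * (galeBound n k + 1) := by exact_mod_cast h
    linarith [galeBound_add_one_le hn2 k]

theorem connectedComponentIn_log_preimage_eq {N : ℕ} {F : Type*} [AddCommGroup F] [Module ℝ F]
    [TopologicalSpace F] [IsTopologicalAddGroup F] [ContinuousSMul ℝ F] [T2Space F]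
    [FiniteDimensional ℝ F] {L : (Fin N → ℝ) →ₗ[ℝ] F} (hL : Function.Surjective L) {Z : Set F}
    {x y : Fin N → ℝ} (hx : ∀ i, 0 < x i) (hy : ∀ i, 0 < y i)
    (hxZ : L (fun i => Real.log (x i)) ∈ Z) (hyZ : L (fun i => Real.log (y i)) ∈ Z)
    (h : connectedComponentIn Z (L fun i => Real.log (x i)) =
      connectedComponentIn Z (L fun i => Real.log (y i))) :
    connectedComponentIn {x | (∀ i, 0 < x i) ∧ L (fun i => Real.log (x i)) ∈ Z} x =
      connectedComponentIn {x | (∀ i, 0 < x i) ∧ L (fun i => Real.log (x i)) ∈ Z} y := by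
  obtain ⟨σ, hσ⟩ := LinearMap.exists_rightInverse_of_surjective L (LinearMap.range_eq_top.2 hL)
  have hσ' : ∀ θ, L (σ θ) = θ := fun θ => LinearMap.congr_fun hσ θ
  have hσc : Continuous σ := σ.continuous_of_finiteDimensional
  set D := connectedComponentIn Z (L fun i => Real.log (x i)) with hD
  let φ : F × LinearMap.ker L → (Fin N → ℝ) := fun q i => Real.exp ((σ q.1 + q.2) i)
  have hφ : Continuous φ := by
    refine continuous_pi fun i => Real.continuous_exp.comp ?_
    exact (continuous_apply i).comp ((hσc.comp continuous_fst).add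
      (continuous_subtype_val.comp continuous_snd))
  have hpre : IsPreconnected (φ '' (D ×ˢ univ)) :=
    (isPreconnected_connectedComponentIn.prod
      isPreconnected_univ).image _ hφ.continuousOn
  have hsub : φ '' (D ×ˢ univ) ⊆ {x | (∀ i, 0 < x i) ∧ L (fun i => Real.log (x i)) ∈ Z} := by
    rintro _ ⟨⟨θ, v⟩, ⟨hθ, -⟩, rfl⟩
    refine ⟨fun i => Real.exp_pos _, ?_⟩
    have : (fun i => Real.log (φ (θ, v) i)) = σ θ + v := by
      funext i
      exact Real.log_exp _
    rw [this, map_add, hσ', LinearMap.mem_ker.1 v.2, add_zero]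
    exact connectedComponentIn_subset _ _ hθ
  have hmem : ∀ z : Fin N → ℝ, (∀ i, 0 < z i) → L (fun i => Real.log (z i)) ∈ D →
      z ∈ φ '' (D ×ˢ univ) := by
    intro z hz hzD
    refine ⟨(L fun i => Real.log (z i), ⟨(fun i => Real.log (z i)) -
      σ (L fun i => Real.log (z i)), ?_⟩), ⟨hzD, mem_univ _⟩, ?_⟩
    · rw [LinearMap.mem_ker, map_sub, hσ', sub_self]
    · funext i
      simp [φ, Real.exp_log (hz i)]
  have hxD := hmem x hx (mem_connectedComponentIn hxZ)
  have hyD := hmem y hy (by rw [h]; exact mem_connectedComponentIn hyZ)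
  exact connectedComponentIn_eq (hpre.subset_connectedComponentIn hxD hsub hyD)

/-- Differences of the monomial exponents to a base exponent, as a linear map. -/
def exponentMap {N : ℕ} {ι : Type*} (w : ι → Fin N → ℝ) (i₀ : ι) :
    (Fin N → ℝ) →ₗ[ℝ] (ι → ℝ) :=
  Matrix.mulVecLin (Matrix.of fun i j => w i j - w i₀ j)

theorem exponentMap_apply {N : ℕ} {ι : Type*} (w : ι → Fin N → ℝ) (i₀ : ι) (x : Fin N → ℝ)
    (i : ι) : exponentMap w i₀ x i = ∑ j, (w i j - w i₀ j) * x j := rfl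

theorem finrank_range_exponentMap {N : ℕ} {ι : Type*} [Fintype ι] (w : ι → Fin N → ℝ) (i₀ : ι) :
    Module.finrank ℝ (LinearMap.range (exponentMap w i₀)) =
      Module.finrank ℝ (affineSpan ℝ (range w)).direction := by
  rw [direction_affineSpan, vectorSpan_eq_span_vsub_set_right ℝ (mem_range_self i₀),
    ← range_comp]
  exact Matrix.rank_eq_finrank_span_row (R := ℝ) (Matrix.of fun i j => w i j - w i₀ j)

theorem eval_eq_exp_mul_signedSum {N : ℕ} (f : MvPolynomial (Fin N) ℝ) (i₀ : f.support)
    {x : Fin N → ℝ} (hx : ∀ j, 0 < x j) :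
    MvPolynomial.eval x f = Real.exp (∑ j, (i₀.1 j : ℝ) * Real.log (x j)) *
      signedSum (fun i : f.support => (SignType.sign (f.coeff i.1) : ℝ))
        (fun i => Real.log |f.coeff i.1|)
        (exponentMap (fun (i : f.support) j => (i.1 j : ℝ)) i₀ fun j => Real.log (x j)) := by
  rw [MvPolynomial.eval_eq', signedSum, Finset.mul_sum, ← Finset.sum_coe_sort]
  refine Finset.sum_congr rfl fun i _ => ?_
  have hc : f.coeff i.1 ≠ 0 := MvPolynomial.mem_support_iff.1 i.2
  rw [mul_left_comm, ← Real.exp_add, exponentMap_apply]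
  have h1 : ∑ j, (i₀.1 j : ℝ) * Real.log (x j) + (Real.log |f.coeff i.1| +
      ∑ j, ((i.1 j : ℝ) - i₀.1 j) * Real.log (x j)) =
      Real.log |f.coeff i.1| + ∑ j, (i.1 j : ℝ) * Real.log (x j) := by
    simp only [sub_mul, Finset.sum_sub_distrib]
    ring
  rw [h1, Real.exp_add, Real.exp_log (abs_pos.2 hc), ← mul_assoc, sign_mul_abs, Real.exp_sum]
  congr 1
  refine Finset.prod_congr rfl fun j _ => ?_
  rw [Real.exp_nat_mul, Real.exp_log (hx j)]

theorem encard_components_le {N n k : ℕ} (hn : 1 ≤ n) (f : MvPolynomial (Fin N) ℝ)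
    (hcard : f.support.card = n + k + 1)
    (hspan : Module.finrank ℝ
      (affineSpan ℝ ((fun (a : Fin N →₀ ℕ) (i : Fin N) => (a i : ℝ)) '' ↑f.support)).direction
      = n) {P : Set (Set (Fin N → ℝ))} (hPfin : P.Finite)
    (hP : P ⊆ components {x | (∀ i, 0 < x i) ∧ MvPolynomial.eval x f = 0}) :
    (P.ncard : ℝ) ≤
      2 * ((Real.exp 1 ^ 2 + 3) / 4 * 2 ^ (k * (k + 1) / 2) * 2 ^ n * (n : ℝ) ^ (k + 1)) := by
  classical
  have : Fintype P := hPfin.fintype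
  obtain ⟨i₀, hi₀⟩ : f.support.Nonempty := Finset.card_pos.1 (by omega)
  set b : f.support := ⟨i₀, hi₀⟩
  set w : f.support → Fin N → ℝ := fun i j => (i.1 j : ℝ) with hw
  set s : f.support → ℝ := fun i => (SignType.sign (f.coeff i.1) : ℝ) with hsdef
  set a : f.support → ℝ := fun i => Real.log |f.coeff i.1| with ha
  set Λ := exponentMap w b with hΛ
  set H := LinearMap.range Λ with hHdef
  set Z : Set H := {θ : H | signedSum s a θ = 0} with hZ
  have hX : {x | (∀ i, 0 < x i) ∧ MvPolynomial.eval x f = 0} =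
      {x | (∀ i, 0 < x i) ∧ Λ.rangeRestrict (fun i => Real.log (x i)) ∈ Z} := by
    ext x
    refine and_congr_right fun hx => ?_
    rw [eval_eq_exp_mul_signedSum f b hx, mul_eq_zero, or_iff_right (Real.exp_pos _).ne']
    rfl
  have hH : ∀ v ∈ H, v b = 0 := by
    rintro _ ⟨x, rfl⟩
    simp [hΛ, exponentMap_apply]
  have hfr : Module.finrank ℝ H = n := by
    rw [hHdef, hΛ, finrank_range_exponentMap, ← hspan, image_eq_range]
    rfl
  have hs : ∀ i, s i = 1 ∨ s i = -1 := by
    intro i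
    have hc : f.coeff i.1 ≠ 0 := MvPolynomial.mem_support_iff.1 i.2
    rcases lt_or_gt_of_ne hc with h | h
    · exact Or.inr (by simp [hsdef, sign_neg h])
    · exact Or.inl (by simp [hsdef, sign_pos h])
  have hd : ∃ d ∈ H, Function.Injective d := by
    refine exists_mem_injective fun i j hij => ?_
    obtain ⟨l, hl⟩ : ∃ l, i.1 l ≠ j.1 l := by
      by_contra! h
      exact hij (Subtype.ext (Finsupp.ext h))
    refine ⟨Λ (Pi.single l 1), LinearMap.mem_range_self _ _, fun h => hl ?_⟩
    simpa [hΛ, exponentMap_apply, Pi.single_apply, hw] using h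
  rw [hX] at hP
  choose x hxX hx using fun C : P => hP C.2
  have hle := card_le_fewnomial_bound (I := P) (p := fun C => Λ.rangeRestrict fun i =>
    Real.log (x C i)) hn hH hfr (by simpa using hcard) hs hd (fun C => (hxX C).2)
    fun C C' hne heq => hne (Subtype.ext (by
      rw [hx C, hx C']
      exact connectedComponentIn_log_preimage_eq Λ.surjective_rangeRestrict (hxX C).1
        (hxX C').1 (hxX C).2 (hxX C').2 heq))
  rwa [← Nat.card_coe_set_eq, Nat.card_eq_fintype_card]

end Fewnomial

/-- A possibly singular hypersurface in the positive orthant of `ℝ^N`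
defined by a real polynomial with `n + k + 1` monomials whose exponent vectors have
`n`-dimensional affine span has at most `2 · ((e² + 3)/4) · 2^(k(k+1)/2) · 2^n · n^(k+1)`
connected components. -/
theorem singular_fewnomial_hypersurface_bound (N n k : ℕ) (hn : 1 ≤ n)
    (f : MvPolynomial (Fin N) ℝ)
    (hcard : f.support.card = n + k + 1)
    (hspan : Module.finrank ℝ
      (affineSpan ℝ ((fun (a : Fin N →₀ ℕ) (i : Fin N) => (a i : ℝ)) '' ↑f.support)).direction
      = n)
    (X : Set (Fin N → ℝ))
    (hX : X = {x | (∀ i, 0 < x i) ∧ MvPolynomial.eval x f = 0}) :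
    (components X).Finite ∧
    ((components X).ncard : ℝ) ≤
      2 * ((Real.exp 1 ^ 2 + 3) / 4 * 2 ^ (k * (k + 1) / 2) * 2 ^ n * (n : ℝ) ^ (k + 1)) := by
  subst hX
  have hbound := fun P hPfin hP =>
    Fewnomial.encard_components_le (P := P) hn f hcard hspan hPfin hP
  suffices hfin : (components {x | (∀ i, 0 < x i) ∧ MvPolynomial.eval x f = 0}).Finite from
    ⟨hfin, hbound _ hfin subset_rfl⟩
  obtain ⟨B, hB⟩ := exists_nat_gt (2 * ((Real.exp 1 ^ 2 + 3) / 4 * 2 ^ (k * (k + 1) / 2) *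
    2 ^ n * (n : ℝ) ^ (k + 1)))
  refine Set.finite_of_encard_le_coe (k := B)
    (Fewnomial.RolleData.encard_le_of_forall_finite fun P hP hPfin => ?_)
  rw [← hPfin.cast_ncard_eq]
  exact_mod_cast ((hbound P hPfin hP).trans hB.le)
end

section
/- Let A ⊂ ℝ^N be a finite set of n+k+1 vectors whose affine span has dimension n, where 1 ≤ n < N, and let f(x) = Σ_{a ∈ A} c_a · x_1^(a_1) ⋯ x_N^(a_N) (all c_a nonzero) be the corresponding signomial on the positive orthant ℝ^N_>. Then there exists a finite set B ⊂ ℝ^n of n+k+1 vectors whose affine span is all of ℝ^n and a signomial g(y) = Σ_{b ∈ B} d_b · y_1^(b_1) ⋯ y_n^(b_n) with all d_b nonzero such that the zero set {x ∈ ℝ^N_> : f(x) = 0} is homeomorphic to ℝ^(N−n) × {y ∈ ℝ^n_> : g(y) = 0}. -/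
/-- The zero set of `F` in the positive orthant, in logarithmic coordinates. -/
noncomputable def orthantZerosHomeomorph {m : ℕ} (F : (Fin m → ℝ) → ℝ) :
    {x : Fin m → ℝ | (∀ i, 0 < x i) ∧ F x = 0} ≃ₜ
      {u : Fin m → ℝ | F (fun i => Real.exp (u i)) = 0} where
  toFun x := ⟨fun i => Real.log (x.1 i), by
    have h : (fun i => Real.exp (Real.log (x.1 i))) = x.1 :=
      funext fun i => Real.exp_log (x.2.1 i)
    simpa only [Set.mem_ofPred_eq, h] using x.2.2⟩
  invFun u := ⟨fun i => Real.exp (u.1 i), fun i => Real.exp_pos _, u.2⟩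
  left_inv x := Subtype.ext <| funext fun i => Real.exp_log (x.2.1 i)
  right_inv u := Subtype.ext <| funext fun i => Real.log_exp (u.1 i)
  continuous_toFun := by
    refine Continuous.subtype_mk (continuous_pi fun i => ?_) _
    exact ((continuous_apply i).comp continuous_subtype_val).log fun x => (x.2.1 i).ne'
  continuous_invFun := by
    refine Continuous.subtype_mk (continuous_pi fun i => ?_) _
    exact Real.continuous_exp.comp ((continuous_apply i).comp continuous_subtype_val)

/-- A set cut out by a condition on the second factor of a product decomposition is a product. -/
def cylinderHomeomorph {X Y Z : Type*} [TopologicalSpace X] [TopologicalSpace Y]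
    [TopologicalSpace Z] (e : X ≃ₜ Y × Z) (S : Set X) (T : Set Z)
    (h : ∀ x, x ∈ S ↔ (e x).2 ∈ T) : S ≃ₜ Y × T where
  toFun x := ((e x.1).1, ⟨(e x.1).2, (h _).1 x.2⟩)
  invFun p := ⟨e.symm (p.1, p.2.1), (h _).2 (by simp)⟩
  left_inv x := by simp
  right_inv p := by simp
  continuous_toFun := by fun_prop
  continuous_invFun := by fun_prop

/-- A surjective linear map between coordinate spaces is, up to a linear change of coordinates,
a projection. -/
theorem exists_homeomorph_prod_of_surjective {N n : ℕ}
    (L : (Fin N → ℝ) →ₗ[ℝ] (Fin n → ℝ)) (hL : Function.Surjective L) :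
    ∃ e : (Fin N → ℝ) ≃ₜ (Fin (N - n) → ℝ) × (Fin n → ℝ), ∀ u, (e u).2 = L u := by
  obtain ⟨s, hs⟩ := L.exists_rightInverse_of_surjective (LinearMap.range_eq_top.2 hL)
  have hs' : ∀ y, L (s y) = y := fun y => LinearMap.congr_fun hs y
  have hker : Module.finrank ℝ L.ker = Module.finrank ℝ (Fin (N - n) → ℝ) := by
    have h := L.finrank_range_add_finrank_ker
    rw [LinearMap.range_eq_top.2 hL, finrank_top] at h
    simp only [Module.finrank_fin_fun] at h ⊢
    omega
  let κ : L.ker ≃L[ℝ] (Fin (N - n) → ℝ) := ContinuousLinearEquiv.ofFinrankEq hker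
  have hmem : ∀ u, u - s (L u) ∈ L.ker := fun u => by simp [hs']
  have hsc : Continuous s := s.continuous_of_finiteDimensional
  have hLc : Continuous L := L.continuous_of_finiteDimensional
  refine ⟨{
    toFun := fun u => (κ ⟨u - s (L u), hmem u⟩, L u)
    invFun := fun p => (κ.symm p.1 : Fin N → ℝ) + s p.2
    left_inv := fun u => by simp
    right_inv := fun p => by
      have h : L ((κ.symm p.1 : Fin N → ℝ) + s p.2) = p.2 := by
        rw [map_add, hs', LinearMap.mem_ker.1 (κ.symm p.1).2, zero_add]
      refine Prod.ext ?_ h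
      simp only [h, add_sub_cancel_right, Subtype.coe_eta, ContinuousLinearEquiv.apply_symm_apply]
    continuous_toFun := by fun_prop
    continuous_invFun := by fun_prop }, fun u => rfl⟩

theorem prod_exp_rpow {m : ℕ} (u a : Fin m → ℝ) :
    ∏ i, Real.exp (u i) ^ a i = Real.exp (a ⬝ᵥ u) := by
  simp only [dotProduct, Real.exp_sum, ← Real.exp_mul, mul_comm]

open scoped Matrix in
/-- Coordinates `φ` on an `n`-dimensional subspace `D` of `ℝ^N`, extended to `ℝ^N`, and the dual
surjection `L : ℝ^N → ℝ^n`. -/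
theorem exists_coordinates_and_dual {N n : ℕ} (D : Submodule ℝ (Fin N → ℝ))
    (hD : Module.finrank ℝ D = n) :
    ∃ φ L : (Fin N → ℝ) →ₗ[ℝ] (Fin n → ℝ), Set.InjOn φ D ∧ D.map φ = ⊤ ∧
      Function.Surjective L ∧ ∀ w ∈ D, ∀ u, w ⬝ᵥ u = φ w ⬝ᵥ L u := by
  let b : Module.Basis (Fin n) ℝ D := Module.finBasisOfFinrankEq ℝ D hD
  obtain ⟨φ, hφ⟩ := LinearMap.exists_extend (b.equivFun : D →ₗ[ℝ] (Fin n → ℝ))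
  have hφ' : ∀ w : D, φ w = b.equivFun w := fun w => LinearMap.congr_fun hφ w
  let M : Matrix (Fin n) (Fin N) ℝ := fun j => (b j : Fin N → ℝ)
  have hM : LinearIndependent ℝ M.row :=
    b.linearIndependent.map' D.subtype D.ker_subtype
  refine ⟨φ, M.mulVecLin, ?_, ?_, ?_, ?_⟩
  · intro w hw w' hw' h
    have h' := (hφ' ⟨w, hw⟩).symm.trans (h.trans (hφ' ⟨w', hw'⟩))
    exact congrArg Subtype.val (b.equivFun.injective h')
  · refine Submodule.eq_top_iff'.2 fun y => ⟨b.equivFun.symm y, (b.equivFun.symm y).2, ?_⟩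
    rw [hφ', LinearEquiv.apply_symm_apply]
  · rw [← LinearMap.range_eq_top]
    apply Submodule.eq_top_of_finrank_eq
    rw [Module.finrank_fin_fun]
    exact hM.rank_matrix.trans (Fintype.card_fin n)
  · intro w hw u
    have hw' : w = φ w ᵥ* M := by
      have h := congrArg Subtype.val (b.sum_equivFun ⟨w, hw⟩)
      rw [← hφ'] at h
      rw [Matrix.vecMul_eq_sum]
      simpa [M] using h.symm
    rw [Matrix.mulVecLin_apply, Matrix.dotProduct_mulVec, ← hw']

/-- If `f` is a signomial on the positive orthant of `ℝ^N` whose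
`n + k + 1` exponent vectors have affine span of dimension `n < N`, then its zero set in
the positive orthant is homeomorphic to the product of `ℝ^(N−n)` with the zero set in the
positive orthant of `ℝ^n` of a signomial with `n + k + 1` exponent vectors affinely
spanning `ℝ^n`. -/
theorem signomial_cylinder (N n k : ℕ) (hn : 1 ≤ n) (hnN : n < N)
    (A : Finset (Fin N → ℝ)) (hA : A.card = n + k + 1)
    (hspan : Module.finrank ℝ (affineSpan ℝ (A : Set (Fin N → ℝ))).direction = n)
    (c : (Fin N → ℝ) → ℝ) (hc : ∀ a ∈ A, c a ≠ 0)
    (f : (Fin N → ℝ) → ℝ)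
    (hf : ∀ x : Fin N → ℝ, f x = ∑ a ∈ A, c a * ∏ i, (x i) ^ (a i)) :
    ∃ (B : Finset (Fin n → ℝ)) (d : (Fin n → ℝ) → ℝ),
      B.card = n + k + 1 ∧
      affineSpan ℝ (B : Set (Fin n → ℝ)) = ⊤ ∧
      (∀ b ∈ B, d b ≠ 0) ∧
      Nonempty
        (({x : Fin N → ℝ | (∀ i, 0 < x i) ∧ f x = 0}) ≃ₜ
          ((Fin (N - n) → ℝ) ×
            {y : Fin n → ℝ | (∀ i, 0 < y i) ∧ (∑ b ∈ B, d b * ∏ i, (y i) ^ (b i)) = 0})) := by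
  obtain ⟨φ, L, hinj, hmap, hL, hdual⟩ := exists_coordinates_and_dual _ hspan
  obtain ⟨a₀, ha₀⟩ : A.Nonempty := Finset.card_pos.1 (by omega)
  have hsub : ∀ a ∈ A, ∀ a' ∈ A, a - a' ∈ (affineSpan ℝ (A : Set (Fin N → ℝ))).direction :=
    fun a ha a' ha' => AffineSubspace.vsub_mem_direction
      (subset_affineSpan ℝ _ ha) (subset_affineSpan ℝ _ ha')
  have hinjA : Set.InjOn φ (A : Set (Fin N → ℝ)) := fun a ha a' ha' h =>
    sub_eq_zero.1 (hinj (hsub a ha a' ha') (Submodule.zero_mem _) (by simp [h]))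
  have hinv : ∀ a ∈ A, Function.invFunOn φ (A : Set (Fin N → ℝ)) (φ a) = a :=
    fun a ha => hinjA.leftInvOn_invFunOn ha
  obtain ⟨e, he⟩ := exists_homeomorph_prod_of_surjective L hL
  refine ⟨A.image φ, fun y => c (Function.invFunOn φ (A : Set (Fin N → ℝ)) y), ?_, ?_, ?_, ⟨?_⟩⟩
  · rw [Finset.card_image_of_injOn hinjA, hA]
  · have hne : (affineSpan ℝ (A.image φ : Set (Fin n → ℝ)) : Set (Fin n → ℝ)).Nonempty :=
      ⟨φ a₀, subset_affineSpan ℝ _ (Finset.mem_image_of_mem φ ha₀)⟩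
    rw [← AffineSubspace.direction_eq_top_iff_of_nonempty hne, Finset.coe_image,
      ← LinearMap.coe_toAffineMap, ← AffineSubspace.map_span, AffineSubspace.map_direction,
      LinearMap.toAffineMap_linear, hmap]
  · intro b hb
    obtain ⟨a, ha, rfl⟩ := Finset.mem_image.1 hb
    simpa only [hinv a ha] using hc a ha
  · refine (orthantZerosHomeomorph f).trans ((cylinderHomeomorph e _ _ fun u => ?_).trans
      ((Homeomorph.refl _).prodCongr (orthantZerosHomeomorph _).symm))
    have hfac : f (fun i => Real.exp (u i)) = Real.exp (a₀ ⬝ᵥ u - φ a₀ ⬝ᵥ L u) *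
        ∑ b ∈ A.image φ, c (Function.invFunOn φ (A : Set (Fin N → ℝ)) b) *
          ∏ i, Real.exp ((e u).2 i) ^ b i := by
      rw [hf, Finset.sum_image hinjA, Finset.mul_sum]
      refine Finset.sum_congr rfl fun a ha => ?_
      have h := hdual _ (hsub a ha a₀ ha₀) u
      rw [map_sub, sub_dotProduct, sub_dotProduct] at h
      rw [hinv a ha, prod_exp_rpow, prod_exp_rpow, he, mul_left_comm, ← Real.exp_add]
      congr 2
      linarith
    simp only [Set.mem_ofPred_eq, hfac, mul_eq_zero, Real.exp_ne_zero, false_or]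
end
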